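/- Let α ∈ R^l be an admissible function and fix 1 ≤ i ≤ l. Then α can be written as a finite sum α = Σ_m α_m of admissible functions α_m ∈ R^l satisfying: (i) either α_m = (z_i−z_j)^{−4}·β for some j ≠ i, where β ∈ R^{l−2} is an admissible function of the variables other than z_i and z_j, or ord_{ij'}α_m ≥ −2 for all j' ≠ i and the number of indices j' ≠ i with ord_{ij'}α_m = −2 is at most 2; (ii) for any 1 ≤ s < t ≤ l: if ord_{st}α ≥ −1, then ord_{st}α_m ≥ −1, and if ord_{st}α = −2, then ord_{st}α_m ≥ −2. -/

import Mathlib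

open scoped Classical

noncomputable section

namespace Griess

open MvPolynomial

variable {k : Type} [Field k]

/-- The field `k(z₁,…,z_l)` of rational functions over `k` in `l` variables. -/
abbrev RF (k : Type) [Field k] (l : ℕ) : Type := FractionRing (MvPolynomial (Fin l) k)

/-- The variable `zᵢ` as an element of the rational function field. -/
def zv {k : Type} [Field k] {l : ℕ} (i : Fin l) : RF k l :=
  algebraMap (MvPolynomial (Fin l) k) (RF k l) (MvPolynomial.X i)

/-- The space `Φ^l` of rational functions of the form
`p(z₁,…,z_l) · ∏_{i<j} (zᵢ - z_j)^{k_{ij}}`. -/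
def Phi (k : Type) [Field k] (l : ℕ) : Set (RF k l) :=
  { x | ∃ (p : MvPolynomial (Fin l) k) (e : Fin l → Fin l → ℤ),
      x = algebraMap (MvPolynomial (Fin l) k) (RF k l) p *
        ∏ i : Fin l, ∏ j : Fin l, (if i < j then (zv i - zv j) ^ e i j else 1) }

/-- `D` is the family of partial derivative operators `∂_{z₁},…,∂_{z_l}`:
a family of `k`-linear derivations with `D i (z j) = δ_{ij}`. -/
def IsPartialDeriv {l : ℕ} (D : Fin l → Derivation k (RF k l) (RF k l)) : Prop :=
  ∀ i j : Fin l, D i (zv j) = if j = i then 1 else 0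

/-- The operator `Δ = Σᵢ ∂_{zᵢ}`. -/
def Delta {l : ℕ} (D : Fin l → Derivation k (RF k l) (RF k l)) (α : RF k l) : RF k l :=
  ∑ i, D i α

/-- The operator `Δ*(n₁,…,n_l) = Σᵢ (zᵢ² ∂_{zᵢ} + nᵢ zᵢ)`. -/
def DeltaStar {l : ℕ} (D : Fin l → Derivation k (RF k l) (RF k l)) (n : Fin l → ℤ)
    (α : RF k l) : RF k l :=
  ∑ i, ((zv i) ^ 2 * D i α + (n i : RF k l) * zv i * α)

section Subst

variable {l : ℕ}

/-- The embedding of polynomials in `z₁,…,z_l` into rational functions of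
`z₁,…,z_l` and one extra variable `t` (`= RatFunc.X`). -/
def toRatFuncHom (k : Type) [Field k] (l : ℕ) :
    Polynomial (MvPolynomial (Fin l) k) →+* RatFunc (RF k l) :=
  (algebraMap (Polynomial (RF k l)) (RatFunc (RF k l))).comp
    (Polynomial.mapRingHom (algebraMap (MvPolynomial (Fin l) k) (RF k l)))

lemma toRatFuncHom_injective : Function.Injective (toRatFuncHom k l) := by
  have h1 : Function.Injective (algebraMap (Polynomial (RF k l)) (RatFunc (RF k l))) :=
    IsFractionRing.injective _ _
  have h2 : Function.Injective
      (Polynomial.mapRingHom (algebraMap (MvPolynomial (Fin l) k) (RF k l))) :=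
    Polynomial.map_injective _ (IsFractionRing.injective _ _)
  exact fun a b hab => h2 (h1 hab)

/-- Polynomial level substitution `z_j ↦ t·z_j` for `j ∈ J`. -/
def scaleAux (k : Type) [Field k] (l : ℕ) (J : Finset (Fin l)) :
    MvPolynomial (Fin l) k →+* Polynomial (MvPolynomial (Fin l) k) :=
  (MvPolynomial.aeval (R := k) fun i =>
    if i ∈ J then Polynomial.X * Polynomial.C (MvPolynomial.X i)
    else Polynomial.C (MvPolynomial.X i)).toRingHom

lemma scaleAux_injective (J : Finset (Fin l)) :
    Function.Injective (scaleAux k l J) := by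
  have h : (Polynomial.evalRingHom (1 : MvPolynomial (Fin l) k)).comp (scaleAux k l J)
      = RingHom.id _ := by
    apply MvPolynomial.ringHom_ext
    · intro r; simp [scaleAux]
    · intro i; by_cases hi : i ∈ J <;> simp [scaleAux, hi]
  intro p q hpq
  have hp := DFunLike.congr_fun h p
  have hq := DFunLike.congr_fun h q
  simp only [RingHom.comp_apply, RingHom.id_apply] at hp hq
  rw [← hp, ← hq, hpq]

/-- The substitution `z_j ↦ t·z_j` (for `j ∈ J`), as a map from rational functions
in `z₁,…,z_l` to rational functions in `z₁,…,z_l` and `t`.  Reading off the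
coefficients of the Laurent expansion in `t` at `t = 0` of `scaleJ J α` yields the
decomposition of `α` into its homogeneous components with respect to the total degree
in the variables `{z_j : j ∈ J}`, i.e. the expansion of `α` in the domain where the
variables of `J` are much smaller than the remaining variables. -/
def scaleJ (J : Finset (Fin l)) : RF k l →+* RatFunc (RF k l) :=
  IsFractionRing.lift (g := (toRatFuncHom k l).comp (scaleAux k l J))
    (fun a b hab => scaleAux_injective J (toRatFuncHom_injective hab))

/-- Polynomial level substitution `z_i ↦ z_j + t`. -/
def subPairAux (k : Type) [Field k] (l : ℕ) (i j : Fin l) :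
    MvPolynomial (Fin l) k →+* Polynomial (MvPolynomial (Fin l) k) :=
  (MvPolynomial.aeval (R := k) fun s =>
    if s = i then Polynomial.X + Polynomial.C (MvPolynomial.X j)
    else Polynomial.C (MvPolynomial.X s)).toRingHom

lemma subPairAux_injective (i j : Fin l) :
    Function.Injective (subPairAux k l i j) := by
  have h : (Polynomial.evalRingHom (MvPolynomial.X i - MvPolynomial.X j)).comp
      (subPairAux k l i j) = RingHom.id _ := by
    apply MvPolynomial.ringHom_ext
    · intro r; simp [subPairAux]
    · intro s; by_cases hs : s = i <;> simp [subPairAux, hs]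
  intro p q hpq
  have hp := DFunLike.congr_fun h p
  have hq := DFunLike.congr_fun h q
  simp only [RingHom.comp_apply, RingHom.id_apply] at hp hq
  rw [← hp, ← hq, hpq]

/-- The substitution `z_i ↦ z_j + t`, as a map from rational functions in `z₁,…,z_l`
to rational functions in the variables `z₁,…,z_l` and `t`.  Reading off the Laurent
coefficients in `t` at `t = 0` yields the expansion of a rational function in powers
of `z_i - z_j`, with coefficients not involving `z_i`. -/
def subPair (i j : Fin l) : RF k l →+* RatFunc (RF k l) :=
  IsFractionRing.lift (g := (toRatFuncHom k l).comp (subPairAux k l i j))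
    (fun a b hab => subPairAux_injective i j (toRatFuncHom_injective hab))

end Subst

/-- The coefficient of `tᵐ` in the Laurent expansion at `t = 0` of a rational
function of `t`. -/
def lcoeff {L : Type} [Field L] (m : ℤ) (f : RatFunc L) : L :=
  (f : LaurentSeries L).coeff m

/-- The component `(α)_n` of `α` of degree `n` with respect to the partition
`{1,…,l} = Jᶜ ⊔ J` and the weights `d`:  the part of the expansion of `α` in the
domain where the variables of `J` are much smaller than those of `Jᶜ` whose total
degree in the variables `{z_j : j ∈ J}` equals `n - Σ_{j∈J} d_j`. -/
def component {l : ℕ} (J : Finset (Fin l)) (d : Fin l → ℤ) (n : ℤ) (α : RF k l) :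
    RF k l :=
  lcoeff (n - ∑ j ∈ J, d j) (scaleJ J α)

/-- `α` is homogeneous of total degree `d` in the variables `{z_i : i ∈ S}`:
substituting `z_i ↦ t·z_i` for `i ∈ S` multiplies `α` by `t^d`. -/
def IsHomogeneousOn {l : ℕ} (S : Finset (Fin l)) (d : ℤ) (α : RF k l) : Prop :=
  scaleJ S α = RatFunc.X ^ d * RatFunc.C α

/-- `ρ^{(m)}_{ij} α`: the coefficient of `(z_i - z_j)^m` in the expansion of `α`
in powers of `z_i - z_j` (the coefficients do not involve `z_i`). -/
def rho {l : ℕ} (i j : Fin l) (m : ℤ) (α : RF k l) : RF k l :=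
  lcoeff m (subPair i j α)

/-- `α` is a rational function of the variables `{z_i : i ∈ S}` only. -/
def dependsOnlyOn {l : ℕ} (S : Finset (Fin l)) (α : RF k l) : Prop :=
  α ∈ Subfield.closure (Set.range (algebraMap k (RF k l)) ∪ {x | ∃ i ∈ S, x = zv i})

/-- `α` is an admissible function of the variables `{z_i : i ∈ S}` (the space
`R^{|S|}`):  `α ∈ Φ` is a rational function of the variables of `S` only, it is
`(4,…,4)`-regular and homogeneous of degree `-2|S|` in these variables, and all its
components of negative degree, as well as those of degree `1`, vanish (with respect
to every partition of `S` and all weights equal to `2`). -/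
def Admissible {l : ℕ} (D : Fin l → Derivation k (RF k l) (RF k l)) (S : Finset (Fin l))
    (α : RF k l) : Prop :=
  α ∈ Phi k l ∧ dependsOnlyOn S α ∧
    (∑ i ∈ S, ((zv i) ^ 2 * D i α + 4 * zv i * α)) = 0 ∧
    IsHomogeneousOn S (-(2 * (S.card : ℤ))) α ∧
    ∀ J ⊆ S, ∀ n : ℤ, (n < 0 ∨ n = 1) → component J (fun _ => 2) n α = 0

/-- `α` is an indecomposable admissible function of the variables `{z_i : i ∈ S}`
(the space `R₀^{|S|}`): admissible, and all the components `(α)₀` with respect to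
partitions of `S` into two nonempty parts vanish. -/
def AdmissibleInd {l : ℕ} (D : Fin l → Derivation k (RF k l) (RF k l))
    (S : Finset (Fin l)) (α : RF k l) : Prop :=
  Admissible D S α ∧
    ∀ J ⊆ S, J ≠ ∅ → J ≠ S → component J (fun _ => 2) 0 α = 0

section Shift

variable {l : ℕ}

/-- Polynomial level substitution `z_s ↦ z_s - z_t` for `s ∈ S`. -/
def shiftAuxP (k : Type) [Field k] (l : ℕ) (S : Finset (Fin l)) (t : Fin l) :
    MvPolynomial (Fin l) k →+* MvPolynomial (Fin l) k :=
  (MvPolynomial.aeval (R := k) fun s =>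
    if s ∈ S then MvPolynomial.X s - MvPolynomial.X t else MvPolynomial.X s).toRingHom

lemma shiftAuxP_injective (S : Finset (Fin l)) (t : Fin l) (ht : t ∉ S) :
    Function.Injective (shiftAuxP k l S t) := by
  have h : ((MvPolynomial.aeval (R := k) fun s =>
      if s ∈ S then MvPolynomial.X s + MvPolynomial.X t
      else MvPolynomial.X s).toRingHom).comp (shiftAuxP k l S t) = RingHom.id _ := by
    apply MvPolynomial.ringHom_ext
    · intro r; simp [shiftAuxP]
    · intro s
      by_cases hs : s ∈ S
      · have hst : s ≠ t := fun hst => ht (hst ▸ hs)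
        simp [shiftAuxP, hs, ht]
      · simp [shiftAuxP, hs]
  intro p q hpq
  have hp := DFunLike.congr_fun h p
  have hq := DFunLike.congr_fun h q
  simp only [RingHom.comp_apply, RingHom.id_apply] at hp hq
  rw [← hp, ← hq, hpq]

/-- The shift operator substituting `z_s - z_t` for `z_s`, for all `s ∈ S`. -/
def shiftT (S : Finset (Fin l)) (t : Fin l) (ht : t ∉ S) : RF k l →+* RF k l :=
  IsFractionRing.lift
    (g := (algebraMap (MvPolynomial (Fin l) k) (RF k l)).comp (shiftAuxP k l S t))
    (fun a b hab =>
      shiftAuxP_injective S t ht (IsFractionRing.injective _ _ hab))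

/-- The operator `ℰ = Σ_{s ∈ S} (-z_s⁻¹ ∂_{z_s} + 2 z_s⁻²)`. -/
def curlyE {l : ℕ} (D : Fin l → Derivation k (RF k l) (RF k l)) (S : Finset (Fin l))
    (β : RF k l) : RF k l :=
  ∑ s ∈ S, (-((zv s)⁻¹ * D s β) + 2 * (zv s) ^ (-2 : ℤ) * β)

end Shift

end Griess

namespace Griess

section H1

open MvPolynomial (X C mkDerivation)

variable {k : Type} [Field k] {l : ℕ}

abbrev MP (k : Type) [Field k] (l : ℕ) : Type := MvPolynomial (Fin l) k

abbrev PP (k : Type) [Field k] (l : ℕ) : Type := Polynomial (MvPolynomial (Fin l) k)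

def dd (k : Type) [Field k] {l : ℕ} (a b : Fin l) : MP k l := X a - X b

abbrev sc (k : Type) [Field k] {l : ℕ} (J : Finset (Fin l)) : MP k l →+* PP k l := scaleAux k l J

lemma sc_C (J : Finset (Fin l)) (c : k) : sc k J (C c) = Polynomial.C (C c) := by
  simp only [sc, scaleAux, AlgHom.toRingHom_eq_coe, RingHom.coe_coe, MvPolynomial.aeval_C]
  rfl

lemma sc_X_mem {J : Finset (Fin l)} {a : Fin l} (h : a ∈ J) :
    sc k J (X a) = Polynomial.X * Polynomial.C (X a) := by
  simp [sc, scaleAux, h]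

lemma sc_X_not_mem {J : Finset (Fin l)} {a : Fin l} (h : a ∉ J) :
    sc k J (X a) = Polynomial.C (X a) := by
  simp [sc, scaleAux, h]

lemma sc_dd_mem {J : Finset (Fin l)} {a b : Fin l} (h : a ∈ J) (hb : b ∈ J) :
    sc k J (dd k a b) = Polynomial.X * Polynomial.C (dd k a b) := by
  rw [dd, map_sub, sc_X_mem h, sc_X_mem hb, Polynomial.C_sub]; ring

lemma sc_dd_not_mem {J : Finset (Fin l)} {a b : Fin l} (h : a ∉ J) (hb : b ∉ J) :
    sc k J (dd k a b) = Polynomial.C (dd k a b) := by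
  rw [dd, map_sub, sc_X_not_mem h, sc_X_not_mem hb, Polynomial.C_sub]

lemma dd_ne_zero {a b : Fin l} (h : a ≠ b) : dd k a b ≠ 0 := by
  rw [dd, sub_ne_zero]
  exact fun h' => h (MvPolynomial.X_injective h')

lemma dd_swap (a b : Fin l) : dd k b a = - dd k a b := by simp [dd]

/-- substitution `z_i ↦ z_j`. -/
def sig (k : Type) [Field k] {l : ℕ} (i j : Fin l) : MP k l →ₐ[k] MP k l :=
  MvPolynomial.aeval (fun a => if a = i then X j else X a)

lemma sig_X (i j a : Fin l) : sig k i j (X a) = if a = i then X j else X a := by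
  simp [sig]

lemma sig_sub (i j : Fin l) (p : MP k l) : dd k i j ∣ p - sig k i j p := by
  induction p using MvPolynomial.induction_on with
  | C c => rw [MvPolynomial.algHom_C]; simp [MvPolynomial.algebraMap_eq]
  | add p q hp hq =>
    rw [map_add]
    have := dvd_add hp hq
    convert this using 1; ring
  | mul_X p a hp =>
    rw [map_mul, sig_X]
    split_ifs with h
    · subst h
      have h2 : p * X a - sig k a j p * X j = (p - sig k a j p) * X j + p * dd k a j := by
        simp only [dd]; ring
      rw [h2]
      exact dvd_add (hp.mul_right _) (dvd_mul_left _ _)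
    · rw [← sub_mul]; exact hp.mul_right _

lemma sig_dd_self (i j : Fin l) : sig k i j (dd k i j) = 0 := by
  rw [dd, map_sub, sig_X, sig_X]; split_ifs <;> simp_all

lemma dd_dvd_iff (i j : Fin l) (p : MP k l) : dd k i j ∣ p ↔ sig k i j p = 0 := by
  constructor
  · rintro ⟨q, rfl⟩
    rw [map_mul, sig_dd_self, zero_mul]
  · intro h
    have := sig_sub i j p
    rwa [h, sub_zero] at this

lemma dd_prime {i j : Fin l} (h : i ≠ j) : Prime (dd k i j) := by
  refine ⟨dd_ne_zero h, fun hu => ?_, fun a b hab => ?_⟩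
  · have := hu.map (sig k i j)
    rw [sig_dd_self] at this
    exact not_isUnit_zero this
  · rw [dd_dvd_iff, map_mul, mul_eq_zero] at hab
    rwa [dd_dvd_iff, dd_dvd_iff]

lemma dd_dvd_dd {a b c e : Fin l} (hce : c ≠ e) (h : dd k a b ∣ dd k c e) :
    (a = c ∧ b = e) ∨ (a = e ∧ b = c) := by
  rw [dd_dvd_iff, dd, map_sub, sig_X, sig_X, sub_eq_zero] at h
  split_ifs at h with h1 h2 h2
  · exact absurd (h1.trans h2.symm) hce
  · exact Or.inl ⟨h1.symm, MvPolynomial.X_injective h⟩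
  · exact Or.inr ⟨h2.symm, (MvPolynomial.X_injective h).symm⟩
  · exact absurd (MvPolynomial.X_injective h) hce

lemma X_prime (a : Fin l) : Prime (X a : MP k l) := MvPolynomial.X_prime

lemma X_not_dvd_X {a b : Fin l} (h : a ≠ b) : ¬ (X a : MP k l) ∣ X b := by
  intro hd
  exact h (by simpa using hd)

lemma X_not_dvd_dd {a c e : Fin l} (h : c ≠ e) : ¬ (X a : MP k l) ∣ dd k c e := by
  rintro ⟨q, hq⟩
  have h1 := congrArg (MvPolynomial.aeval (fun b : Fin l => if b = a then (0 : MP k l) else X b)) hq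
  rw [map_mul, dd, map_sub] at h1
  simp only [MvPolynomial.aeval_X, if_true, zero_mul] at h1
  split_ifs at h1 with h2 h3 h3
  · exact h (h2.trans h3.symm)
  · simp at h1
  · simp at h1
  · rw [sub_eq_zero] at h1
    exact h (MvPolynomial.X_injective h1)

lemma dd_not_dvd_X {a c e : Fin l} : ¬ dd k c e ∣ (X a : MP k l) := by
  rw [dd_dvd_iff, sig_X]
  split_ifs <;> simp

/-- translations -/
def TT (k : Type) [Field k] {l : ℕ} (S : Finset (Fin l)) : Derivation k (MP k l) (MP k l) :=
  mkDerivation k (fun a => if a ∈ S then 1 else 0)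

def EE (k : Type) [Field k] {l : ℕ} (S : Finset (Fin l)) : Derivation k (MP k l) (MP k l) :=
  mkDerivation k (fun a => if a ∈ S then X a ^ 2 else 0)

lemma TT_X (S : Finset (Fin l)) (a : Fin l) : TT k S (X a) = if a ∈ S then 1 else 0 := by
  simp [TT, MvPolynomial.mkDerivation_X]

lemma EE_X (S : Finset (Fin l)) (a : Fin l) : EE k S (X a) = if a ∈ S then X a ^ 2 else 0 := by
  simp [EE, MvPolynomial.mkDerivation_X]

lemma der_C (d : Derivation k (MP k l) (MP k l)) (c : k) : d (C c) = 0 :=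
  MvPolynomial.derivation_C d c

lemma der_hom {R : Type} [CommRing R] [Algebra k R] (f : MP k l →ₐ[k] R)
    (d1 : Derivation k (MP k l) (MP k l)) (d2 : Derivation k R R)
    (h : ∀ a, f (d1 (X a)) = d2 (f (X a))) (p : MP k l) : f (d1 p) = d2 (f p) := by
  induction p using MvPolynomial.induction_on with
  | C c =>
    rw [MvPolynomial.derivation_C, map_zero, MvPolynomial.algHom_C, Derivation.map_algebraMap]
  | add p q hp hq => rw [map_add, map_add, hp, hq, map_add, map_add]
  | mul_X p a hp =>
    rw [Derivation.leibniz, map_add, map_mul, Derivation.leibniz]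
    simp only [smul_eq_mul, map_mul, hp, h]

lemma der_eq (d1 d2 : Derivation k (MP k l) (MP k l)) (h : ∀ a, d1 (X a) = d2 (X a)) (p) :
    d1 p = d2 p := by
  rw [MvPolynomial.derivation_ext h]

/-- `z_a ↦ z_a - z_b` for `a ∈ S`. -/
def tau (k : Type) [Field k] {l : ℕ} (S : Finset (Fin l)) (b : Fin l) : MP k l →ₐ[k] MP k l :=
  MvPolynomial.aeval (fun a => if a ∈ S then X a - X b else X a)

lemma tau_X (S : Finset (Fin l)) (b a : Fin l) :
    tau k S b (X a) = if a ∈ S then X a - X b else X a := by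
  simp [tau]

lemma tau_eq [CharZero k] {S : Finset (Fin l)} {p : MP k l} (hp : TT k S p = 0) (b : Fin l) :
    tau k S b p = p := by
  let s : MP k l →ₐ[k] PP k l :=
    MvPolynomial.aeval (fun a => if a ∈ S then Polynomial.C (X a) + Polynomial.X else
      Polynomial.C (X a))
  have h1 : Polynomial.derivative (s p) = 0 := by
    have h2 := der_hom s (TT k S) ((Polynomial.derivative' (R := MP k l)).restrictScalars k)
      (fun a => by
        simp only [s, MvPolynomial.aeval_X, TT_X, Derivation.restrictScalars_apply]
        split_ifs <;> simp [Polynomial.derivative']) p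
    rw [hp, map_zero] at h2
    exact h2.symm
  have h3 := Polynomial.derivative_eq_zero.mp h1
  rw [Polynomial.natDegree_eq_zero] at h3
  obtain ⟨q, hq⟩ := h3
  have e0 : ∀ c : MP k l, (Polynomial.eval c (s p)) = q := by
    intro c; rw [← hq, Polynomial.eval_C]
  have e1 : Polynomial.eval 0 (s p) = p := by
    have : ((Polynomial.evalRingHom (0 : MP k l)).comp s.toRingHom) = RingHom.id _ := by
      apply MvPolynomial.ringHom_ext
      · intro r
        simp only [s, AlgHom.toRingHom_eq_coe, RingHom.comp_apply, RingHom.coe_coe,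
          MvPolynomial.algHom_C]
        simp [Polynomial.algebraMap_apply, MvPolynomial.algebraMap_eq]
      · intro a; by_cases h : a ∈ S <;> simp [s, h]
    exact DFunLike.congr_fun this p
  have e2 : Polynomial.eval (-X b) (s p) = tau k S b p := by
    have : ((Polynomial.evalRingHom (-X b : MP k l)).comp s.toRingHom) = (tau k S b).toRingHom := by
      apply MvPolynomial.ringHom_ext
      · intro r
        simp only [s, AlgHom.toRingHom_eq_coe, RingHom.comp_apply, RingHom.coe_coe,
          MvPolynomial.algHom_C]
        simp [Polynomial.algebraMap_apply, MvPolynomial.algebraMap_eq]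
      · intro a; by_cases h : a ∈ S <;> simp [s, tau, h, sub_eq_add_neg]
    exact DFunLike.congr_fun this p
  rw [← e2, e0, ← e0 0, e1]

/-- If `p` is translation invariant, its order along `{j,b}` is the order along `z_j = z_b`. -/
lemma dd_pow_dvd [CharZero k] {S : Finset (Fin l)} {p : MP k l} (hp : TT k S p = 0)
    {j b : Fin l} (hj : j ∈ S) (hb : b ∈ S) (hjb : j ≠ b) {m : ℕ}
    (h : Polynomial.X ^ m ∣ sc k {j, b} p) : dd k j b ^ m ∣ p := by
  let th : MP k l →ₐ[k] MP k l :=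
    MvPolynomial.aeval (fun a => if a = j then 1 else if a = b then 0 else
      if a ∈ S then X a - X b else X a)
  let psi : PP k l →+* MP k l := Polynomial.eval₂RingHom th.toRingHom (dd k j b)
  have : psi.comp (sc k {j, b}) = (tau k S b).toRingHom := by
    apply MvPolynomial.ringHom_ext
    · intro r
      rw [RingHom.comp_apply, sc_C]
      simp only [psi, Polynomial.coe_eval₂RingHom, Polynomial.eval₂_C]
      simp only [AlgHom.toRingHom_eq_coe, RingHom.coe_coe, MvPolynomial.algHom_C]
    · intro a
      rw [RingHom.comp_apply]
      by_cases h1 : a = j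
      · subst h1
        rw [sc_X_mem (by simp)]
        simp [psi, th, tau, hj, dd]
      · by_cases h2 : a = b
        · subst h2
          rw [sc_X_mem (by simp)]
          simp [psi, th, tau, hb, h1]
        · rw [sc_X_not_mem (by simp [h1, h2])]
          simp [psi, th, tau, h1, h2]
  have h2 := map_dvd psi h
  rw [map_pow] at h2
  have h3 : psi (sc k {j, b} p) = p := by
    have := DFunLike.congr_fun this p
    rw [RingHom.comp_apply] at this
    rw [this]
    exact tau_eq hp b
  rw [h3] at h2
  simpa [psi] using h2

end H1

section H2

open MvPolynomial (X C mkDerivation)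

variable {k : Type} [Field k] {l : ℕ}

/-- projection to the variables in `S`. -/
def pr (k : Type) [Field k] {l : ℕ} (S : Finset (Fin l)) : MP k l →ₐ[k] MP k l :=
  MvPolynomial.aeval (fun a => if a ∈ S then X a else 0)

lemma pr_X (S : Finset (Fin l)) (a : Fin l) : pr k S (X a) = if a ∈ S then X a else 0 := by
  simp [pr]

lemma pr_dd {S : Finset (Fin l)} {a b : Fin l} (ha : a ∈ S) (hb : b ∈ S) :
    pr k S (dd k a b) = dd k a b := by
  simp [dd, pr_X, ha, hb]

lemma hom_eq_of_pr {R : Type} [CommRing R] {S : Finset (Fin l)} {f g : MP k l →+* R}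
    (hC : ∀ c, f (C c) = g (C c))
    (h : ∀ a ∈ S, f (X a) = g (X a)) {p : MP k l} (hp : pr k S p = p) : f p = g p := by
  have : f.comp (pr k S).toRingHom = g.comp (pr k S).toRingHom := by
    apply MvPolynomial.ringHom_ext
    · intro r
      simp only [AlgHom.toRingHom_eq_coe, RingHom.comp_apply, RingHom.coe_coe,
          MvPolynomial.algHom_C, MvPolynomial.algebraMap_eq, hC]
    · intro a
      by_cases ha : a ∈ S
      · simp [pr_X, ha, h a ha]
      · simp [pr_X, ha]
  have := DFunLike.congr_fun this p
  simpa [hp] using this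

lemma pr_mem_supported (S : Finset (Fin l)) (p : MP k l) :
    pr k S p ∈ MvPolynomial.supported k (S : Set (Fin l)) := by
  induction p using MvPolynomial.induction_on with
  | C c => rw [MvPolynomial.algHom_C]; exact Subalgebra.algebraMap_mem _ _
  | add p q hp hq => rw [map_add]; exact add_mem hp hq
  | mul_X p a hp =>
    rw [map_mul, pr_X]
    split_ifs with h
    · exact mul_mem hp (by rw [MvPolynomial.X_mem_supported]; exact h)
    · rw [mul_zero]; exact zero_mem _

lemma der_eq_of_pr {S : Finset (Fin l)} {d1 d2 : Derivation k (MP k l) (MP k l)}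
    (h : ∀ a ∈ S, d1 (X a) = d2 (X a)) {p : MP k l} (hp : pr k S p = p) : d1 p = d2 p :=
  MvPolynomial.derivation_eqOn_supported (s := (S : Set (Fin l))) (fun a ha => h a ha)
    (hp ▸ pr_mem_supported S p)

lemma pr_mono {S S' : Finset (Fin l)} (h : S' ⊆ S) {p : MP k l} (hp : pr k S' p = p) :
    pr k S p = p := by
  have := hom_eq_of_pr (f := (pr k S).toRingHom) (g := RingHom.id _) (S := S')
    (fun c => by simp) (fun a ha => by simp [pr_X, h ha]) hp
  simpa using this

lemma sig_of_pr {S : Finset (Fin l)} {i j : Fin l} (hi : i ∉ S) {p : MP k l}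
    (hp : pr k S p = p) : sig k i j p = p := by
  have := hom_eq_of_pr (f := (sig k i j).toRingHom) (g := RingHom.id _) (S := S)
    (fun c => by simp) (fun a ha => by
      have : a ≠ i := fun h => hi (h ▸ ha)
      simp [sig_X, this]) hp
  simpa using this

lemma sc_of_pr {S : Finset (Fin l)} {J J' : Finset (Fin l)} (h : ∀ a ∈ S, a ∈ J ↔ a ∈ J')
    {p : MP k l} (hp : pr k S p = p) : sc k J p = sc k J' p := by
  refine hom_eq_of_pr (S := S) (fun c => by rw [sc_C, sc_C]) (fun a ha => ?_) hp
  by_cases h1 : a ∈ J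
  · rw [sc_X_mem h1, sc_X_mem ((h a ha).1 h1)]
  · rw [sc_X_not_mem h1, sc_X_not_mem (fun h2 => h1 ((h a ha).2 h2))]

lemma EE_dd {S : Finset (Fin l)} {a b : Fin l} (ha : a ∈ S) (hb : b ∈ S) :
    EE k S (dd k a b) = (X a + X b) * dd k a b := by
  simp only [dd, map_sub, EE_X, ha, hb, if_true]; ring

lemma TT_dd {S : Finset (Fin l)} {a b : Fin l} (ha : a ∈ S) (hb : b ∈ S) :
    TT k S (dd k a b) = 0 := by
  simp [dd, map_sub, TT_X, ha, hb]

/-- eigen-relation of derivations is multiplicative -/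
lemma der_mul {d : Derivation k (MP k l) (MP k l)} {p q u v : MP k l} (hp : d p = u * p)
    (hq : d q = v * q) : d (p * q) = (u + v) * (p * q) := by
  rw [Derivation.leibniz, hp, hq]; simp only [smul_eq_mul]; ring

lemma der_pow {d : Derivation k (MP k l) (MP k l)} {p u : MP k l} (hp : d p = u * p) (n : ℕ) :
    d (p ^ n) = ((n : MP k l) * u) * p ^ n := by
  induction n with
  | zero => simp
  | succ n ih => rw [pow_succ, der_mul ih hp]; push_cast; ring

lemma der_prod {ι : Type} {d : Derivation k (MP k l) (MP k l)} {B : Finset ι}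
    {f u : ι → MP k l} (h : ∀ b ∈ B, d (f b) = u b * f b) :
    d (∏ b ∈ B, f b) = (∑ b ∈ B, u b) * ∏ b ∈ B, f b := by
  induction B using Finset.induction_on with
  | empty => simp
  | insert a B ha ih =>
    rw [Finset.prod_insert ha, Finset.sum_insert ha]
    exact der_mul (h a (by simp)) (ih fun b hb => h b (by simp [hb]))

lemma der_cancel {d : Derivation k (MP k l) (MP k l)} {p q u v : MP k l} (h0 : p ≠ 0)
    (hp : d p = u * p) (hpq : d (p * q) = v * (p * q)) : d q = (v - u) * q := by
  rw [Derivation.leibniz, hp] at hpq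
  simp only [smul_eq_mul] at hpq
  apply mul_left_cancel₀ h0
  linear_combination hpq

lemma TT_eq_of_pr {S S' : Finset (Fin l)} (h : S' ⊆ S) {p : MP k l} (hp : pr k S' p = p) :
    TT k S p = TT k S' p :=
  der_eq_of_pr (fun a ha => by simp [TT_X, ha, h ha]) hp

lemma EE_eq_of_pr {S S' : Finset (Fin l)} (h : S' ⊆ S) {p : MP k l} (hp : pr k S' p = p) :
    EE k S p = EE k S' p :=
  der_eq_of_pr (fun a ha => by simp [EE_X, ha, h ha]) hp

lemma X_not_dvd_C {c : MP k l} (hc : c ≠ 0) : ¬ (Polynomial.X : PP k l) ∣ Polynomial.C c := by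
  rw [Polynomial.X_dvd_iff, Polynomial.coeff_C_zero]; exact hc

lemma sc_dd_cop {J : Finset (Fin l)} {a b : Fin l} (hab : a ≠ b) (h : ¬ (a ∈ J ∧ b ∈ J)) :
    ¬ (Polynomial.X : PP k l) ∣ sc k J (dd k a b) := by
  rw [Polynomial.X_dvd_iff, dd, map_sub]
  by_cases ha : a ∈ J
  · have hb : b ∉ J := fun hb => h ⟨ha, hb⟩
    rw [sc_X_mem ha, sc_X_not_mem hb]; simp
  · by_cases hb : b ∈ J
    · rw [sc_X_mem hb, sc_X_not_mem ha]; simp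
    · rw [sc_X_not_mem hb, sc_X_not_mem ha]
      simp only [Polynomial.coeff_sub, Polynomial.coeff_C_zero]
      exact dd_ne_zero hab

lemma PX_prime : Prime (Polynomial.X : PP k l) := Polynomial.prime_X

lemma not_X_dvd_mul {p q : PP k l} (hp : ¬ Polynomial.X ∣ p) (hq : ¬ Polynomial.X ∣ q) :
    ¬ Polynomial.X ∣ p * q := fun h => (PX_prime.dvd_or_dvd h).elim hp hq

lemma not_X_dvd_pow {p : PP k l} (hp : ¬ Polynomial.X ∣ p) (n : ℕ) :
    ¬ Polynomial.X ∣ p ^ n := fun h => hp (PX_prime.dvd_of_dvd_pow h)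

/-- order of a product of linear factors. -/
lemma sc_prod_dd (J : Finset (Fin l)) {j : Fin l} {B : Finset (Fin l)} (hj : j ∉ B) (e : ℕ) :
    ∃ R : PP k l, ¬ Polynomial.X ∣ R ∧
      sc k J (∏ b ∈ B, dd k j b ^ e) =
        Polynomial.X ^ (if j ∈ J then e * (B ∩ J).card else 0) * R := by
  induction B using Finset.induction_on with
  | empty => exact ⟨1, PX_prime.not_dvd_one, by simp⟩
  | insert a B ha ih =>
    obtain ⟨R, hR, hR2⟩ := ih (fun h => hj (by simp [h]))
    have hja : j ≠ a := fun h => hj (by simp [h])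
    rw [Finset.prod_insert ha, map_mul, hR2, map_pow]
    by_cases h1 : j ∈ J
    · by_cases h2 : a ∈ J
      · refine ⟨Polynomial.C (dd k j a) ^ e * R,
          not_X_dvd_mul (not_X_dvd_pow (X_not_dvd_C (dd_ne_zero hja)) e) hR, ?_⟩
        rw [sc_dd_mem h1 h2, Finset.insert_inter_of_mem h2, Finset.card_insert_of_notMem
          (fun h => ha (Finset.mem_inter.1 h).1)]
        simp only [h1, if_true]
        rw [mul_add, mul_pow, pow_add]; ring
      · refine ⟨sc k J (dd k j a) ^ e * R,
          not_X_dvd_mul (not_X_dvd_pow (sc_dd_cop hja (fun h => h2 h.2)) e) hR, ?_⟩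
        rw [Finset.insert_inter_of_notMem h2]; ring
    · refine ⟨sc k J (dd k j a) ^ e * R,
          not_X_dvd_mul (not_X_dvd_pow (sc_dd_cop hja (fun h => h1 h.1)) e) hR, ?_⟩
      simp only [h1, if_false]; ring

lemma sc_sig_mem {J : Finset (Fin l)} {i j : Fin l} (hi : i ∉ J) (hj : j ∈ J) (p : MP k l) :
    sc k J (sig k i j p) = Polynomial.map (sig k i j).toRingHom (sc k (insert i J) p) := by
  have : (sc k J).comp (sig k i j).toRingHom =
      (Polynomial.mapRingHom (sig k i j).toRingHom).comp (sc k (insert i J)) := by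
    apply MvPolynomial.ringHom_ext
    · intro r
      simp only [RingHom.comp_apply, sc_C]
      simp only [AlgHom.toRingHom_eq_coe, RingHom.coe_coe, MvPolynomial.algHom_C,
        MvPolynomial.algebraMap_eq, sc_C]
      simp
    · intro a
      simp only [RingHom.comp_apply, AlgHom.toRingHom_eq_coe, RingHom.coe_coe, sig_X]
      by_cases h : a = i
      · subst h
        rw [sc_X_mem (by simp : a ∈ insert a J)]
        simp [sc_X_mem hj, sig_X]
      · by_cases h2 : a ∈ J
        · rw [sc_X_mem (by simp [h2] : a ∈ insert i J)]
          simp [sc_X_mem h2, sig_X, h]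
        · rw [sc_X_not_mem (by simp [h2, h] : a ∉ insert i J)]
          simp [sc_X_not_mem h2, sig_X, h]
  exact DFunLike.congr_fun this p

lemma sc_sig_not_mem {J : Finset (Fin l)} {i j : Fin l} (hi : i ∉ J) (hj : j ∉ J) (p : MP k l) :
    sc k J (sig k i j p) = Polynomial.map (sig k i j).toRingHom (sc k J p) := by
  have : (sc k J).comp (sig k i j).toRingHom =
      (Polynomial.mapRingHom (sig k i j).toRingHom).comp (sc k J) := by
    apply MvPolynomial.ringHom_ext
    · intro r
      simp only [RingHom.comp_apply, sc_C]
      simp only [AlgHom.toRingHom_eq_coe, RingHom.coe_coe, MvPolynomial.algHom_C,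
        MvPolynomial.algebraMap_eq, sc_C]
      simp
    · intro a
      simp only [RingHom.comp_apply, AlgHom.toRingHom_eq_coe, RingHom.coe_coe, sig_X]
      by_cases h : a = i
      · subst h
        rw [sc_X_not_mem hi]
        simp [sc_X_not_mem hj, sig_X]
      · by_cases h2 : a ∈ J
        · rw [sc_X_mem h2]
          simp [sc_X_mem h2, sig_X, h]
        · rw [sc_X_not_mem h2]
          simp [sc_X_not_mem h2, sig_X, h]
  exact DFunLike.congr_fun this p

/-- indecomposable functions, polynomial version -/
structure PInd (S : Finset (Fin l)) (q : MP k l) : Prop where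
  sup : pr k S q = q
  tt : TT k S q = 0
  ee : EE k S q = (C (2 * ((S.card : k) - 3)) * ∑ a ∈ S, X a) * q
  hom : Polynomial.X ^ (3 * S.card) * sc k S q = Polynomial.X ^ (S.card ^ 2) * Polynomial.C q
  ord : ∀ J ⊆ S, J.Nonempty → J ≠ S →
    Polynomial.X ^ (J.card ^ 2 + 2) ∣ Polynomial.X ^ (3 * J.card) * sc k J q

lemma PInd.zero (S : Finset (Fin l)) : PInd (k := k) S 0 :=
  ⟨by simp, by simp, by simp, by simp, fun J _ _ _ => by simp⟩

lemma PInd.add {S : Finset (Fin l)} {p q : MP k l} (hp : PInd S p) (hq : PInd S q) :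
    PInd S (p + q) := by
  refine ⟨by rw [map_add, hp.sup, hq.sup], by rw [map_add, hp.tt, hq.tt, add_zero],
    by rw [map_add, hp.ee, hq.ee]; ring,
    by rw [map_add, mul_add, hp.hom, hq.hom, Polynomial.C_add]; ring, fun J h1 h2 h3 => ?_⟩
  rw [map_add, mul_add]
  exact dvd_add (hp.ord J h1 h2 h3) (hq.ord J h1 h2 h3)

lemma der_Cmul (d : Derivation k (MP k l) (MP k l)) (c : k) (p : MP k l) :
    d (C c * p) = C c * d p := by
  rw [Derivation.leibniz, der_C]; simp

lemma alg_C (f : MP k l →ₐ[k] MP k l) (c : k) : f (C c) = C c := by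
  rw [MvPolynomial.algHom_C, MvPolynomial.algebraMap_eq]

lemma PInd.smul {S : Finset (Fin l)} {p : MP k l} (c : k) (hp : PInd S p) :
    PInd S (C c * p) := by
  refine ⟨by rw [map_mul, hp.sup, alg_C], by rw [der_Cmul, hp.tt, mul_zero],
    by rw [der_Cmul, hp.ee]; ring,
    by rw [map_mul, sc_C, mul_left_comm, hp.hom, Polynomial.C_mul]; ring, fun J h1 h2 h3 => ?_⟩
  rw [map_mul, mul_left_comm]
  exact (hp.ord J h1 h2 h3).mul_left _

lemma PInd.sub {S : Finset (Fin l)} {p q : MP k l} (hp : PInd S p) (hq : PInd S q) :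
    PInd S (p - q) := by
  have := hp.add (hq.smul (-1))
  convert this using 1
  simp [sub_eq_add_neg]

lemma PInd.sum {ι : Type} {B : Finset ι} {S : Finset (Fin l)} {f : ι → MP k l}
    (h : ∀ b ∈ B, PInd S (f b)) : PInd S (∑ b ∈ B, f b) := by
  induction B using Finset.induction_on with
  | empty => simpa using PInd.zero S
  | insert a B ha ih =>
    rw [Finset.sum_insert ha]
    exact (h a (by simp)).add (ih fun b hb => h b (by simp [hb]))

end H2

section H3

open MvPolynomial (X C mkDerivation)

variable {k : Type} [Field k] {l : ℕ}

lemma xcancel {R y : PP k l} (hR : ¬ Polynomial.X ∣ R) {A B N M : ℕ}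
    (h : Polynomial.X ^ A ∣ Polynomial.X ^ B * (R * y)) (hAB : N + B ≤ A + M) :
    Polynomial.X ^ N ∣ Polynomial.X ^ M * y := by
  have h1 : Polynomial.X ^ A ∣ Polynomial.X ^ B * y := by
    apply PX_prime.pow_dvd_of_dvd_mul_left A hR
    convert h using 1; ring
  have h2 : (Polynomial.X : PP k l) ^ (N + B) ∣ Polynomial.X ^ (A + M) := pow_dvd_pow _ hAB
  have h3 : (Polynomial.X : PP k l) ^ (N + B) ∣ Polynomial.X ^ B * (Polynomial.X ^ M * y) := by
    refine h2.trans ?_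
    rw [pow_add]
    convert mul_dvd_mul_right h1 (Polynomial.X ^ M) using 1; ring
  rw [pow_add, mul_comm] at h3
  exact (mul_dvd_mul_iff_left (pow_ne_zero _ Polynomial.X_ne_zero)).1 h3

lemma TT_sig {S : Finset (Fin l)} {i j : Fin l} (hi : i ∈ S) (hj : j ∈ S) (hij : i ≠ j)
    (p : MP k l) : sig k i j (TT k S p) = TT k (S.erase i) (sig k i j p) := by
  apply der_hom
  intro a
  rw [TT_X, sig_X]
  by_cases h : a = i
  · subst h; simp [hi, TT_X, hj, hij.symm]
  · simp only [h, if_false, TT_X, Finset.mem_erase, ne_eq, not_false_eq_true, true_and]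
    split_ifs <;> simp

lemma EE_sig {S : Finset (Fin l)} {i j : Fin l} (hi : i ∈ S) (hj : j ∈ S) (hij : i ≠ j)
    (p : MP k l) : sig k i j (EE k S p) = EE k (S.erase i) (sig k i j p) := by
  apply der_hom
  intro a
  rw [EE_X, sig_X]
  by_cases h : a = i
  · subst h; simp [hi, EE_X, hj, hij.symm, sig_X]
  · simp only [h, if_false, EE_X, Finset.mem_erase, ne_eq, not_false_eq_true, true_and]
    split_ifs <;> simp [sig_X, h]

lemma pr_sig {S : Finset (Fin l)} {i j : Fin l} (hj : j ∈ S) (hij : i ≠ j)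
    {p : MP k l} (hp : pr k S p = p) : pr k (S.erase i) (sig k i j p) = sig k i j p := by
  have := hom_eq_of_pr (f := (pr k (S.erase i)).toRingHom.comp (sig k i j).toRingHom)
    (g := (sig k i j).toRingHom) (S := S)
    (fun c => by simp) (fun a ha => by
      by_cases h : a = i
      · subst h; simp [sig_X, pr_X, hj, hij.symm]
      · simp [sig_X, pr_X, h, ha]) hp
  simpa using this

lemma prod_dd_ne_zero {j : Fin l} {B : Finset (Fin l)} (hj : j ∉ B) (e : ℕ) :
    (∏ b ∈ B, dd k j b ^ e) ≠ 0 := by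
  rw [Finset.prod_ne_zero_iff]
  intro b hb
  exact pow_ne_zero _ (dd_ne_zero (fun h => hj (h ▸ hb)))

lemma dd_not_dvd_prod {s t j : Fin l} {B : Finset (Fin l)} (hst : s ≠ t) (hj : j ∉ B) (hs : s ≠ j)
    (ht : t ≠ j) (e : ℕ) : ¬ dd k s t ∣ (∏ b ∈ B, dd k j b ^ e) := by
  rw [(dd_prime hst).dvd_finsetProd_iff]
  rintro ⟨b, hb, h⟩
  have h1 := (dd_prime hst).dvd_of_dvd_pow h
  rcases dd_dvd_dd (by rintro rfl; exact hj hb) h1 with h2 | h2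
  · exact hs h2.1
  · exact ht h2.2

lemma prod_dd_dvd {j : Fin l} {B : Finset (Fin l)} (hj : j ∉ B) (e : ℕ) {p : MP k l}
    (h : ∀ b ∈ B, dd k j b ^ e ∣ p) : (∏ b ∈ B, dd k j b ^ e) ∣ p := by
  induction B using Finset.induction_on generalizing p with
  | empty => simp
  | insert a B ha ih =>
    rw [Finset.prod_insert ha, mul_comm]
    have hj' : j ∉ B := fun h => hj (by simp [h])
    have hja : j ≠ a := fun h => hj (by simp [h])
    obtain ⟨y, hy⟩ := ih hj' (fun b hb => h b (by simp [hb]))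
    have h2 := h a (by simp)
    rw [hy] at h2 ⊢
    apply mul_dvd_mul_left
    refine (dd_prime hja).pow_dvd_of_dvd_mul_left e ?_ h2
    rw [(dd_prime hja).dvd_finsetProd_iff]
    rintro ⟨b, hb, h⟩
    have h1 := (dd_prime hja).dvd_of_dvd_pow h
    rcases dd_dvd_dd (by rintro rfl; exact hj' hb) h1 with h2 | h2
    · exact ha (h2.2 ▸ hb)
    · exact hja h2.2.symm

lemma sc_prod_mem {J : Finset (Fin l)} {j : Fin l} (hj : j ∈ J) {B : Finset (Fin l)} (hB : B ⊆ J)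
    (e : ℕ) : sc k J (∏ b ∈ B, dd k j b ^ e) = Polynomial.X ^ (e * B.card) *
        Polynomial.C (∏ b ∈ B, dd k j b ^ e) := by
  rw [map_prod, map_prod, pow_mul, ← Finset.prod_const, ← Finset.prod_mul_distrib]
  refine Finset.prod_congr rfl fun b hb => ?_
  rw [map_pow, sc_dd_mem hj (hB hb), Polynomial.C_pow]; ring

lemma PInd.restrict [CharZero k] {S : Finset (Fin l)} {i j : Fin l} {q : MP k l} (hq : PInd S q)
    (hi : i ∈ S) (hj : j ∈ S) (hij : i ≠ j) (hc : 4 ≤ S.card) :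
    ∃ y, PInd (S.erase i) y ∧
      sig k i j q = (∏ b ∈ (S.erase i).erase j, dd k j b ^ 2) * y := by
  have hjS : j ∈ S.erase i := by simp [hj, hij.symm]
  have hTT : TT k (S.erase i) (sig k i j q) = 0 := by rw [← TT_sig hi hj hij, hq.tt, map_zero]
  have hjB : j ∉ (S.erase i).erase j := by simp
  have hdvd : (∏ b ∈ (S.erase i).erase j, dd k j b ^ 2) ∣ sig k i j q := by
    apply prod_dd_dvd hjB
    intro b hb
    simp only [Finset.mem_erase] at hb
    apply dd_pow_dvd hTT hjS (by simp [hb]) hb.1.symm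
    rw [sc_sig_mem (by simp [hij, hb.2.1.symm]) (by simp)]
    have hcard : (insert i ({j, b} : Finset (Fin l))).card = 3 := by
      rw [Finset.card_insert_of_notMem (by simp [hij, hb.2.1.symm]), Finset.card_pair hb.1.symm]
    have h1 := hq.ord (insert i {j, b}) (by
      intro x hx
      simp only [Finset.mem_insert, Finset.mem_singleton] at hx
      rcases hx with rfl | rfl | rfl
      exacts [hi, hj, hb.2.2]) (by simp) (by
        intro h; rw [← h, hcard] at hc; omega)
    rw [hcard] at h1
    have h2 : (Polynomial.X : PP k l) ^ 2 ∣ sc k (insert i {j, b}) q := by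
      have := xcancel (R := 1) PX_prime.not_dvd_one (N := 2) (M := 0)
        (by rw [one_mul]; exact h1) (by omega)
      simpa using this
    have h3 := map_dvd (Polynomial.mapRingHom (sig k i j).toRingHom) h2
    simpa using h3
  obtain ⟨y, hy⟩ := hdvd
  refine ⟨y, ?_, hy⟩
  set P := ∏ b ∈ (S.erase i).erase j, dd k j b ^ 2 with hP
  have hP0 : P ≠ 0 := prod_dd_ne_zero hjB 2
  have hPsup : pr k (S.erase i) P = P := by
    rw [hP, map_prod]
    refine Finset.prod_congr rfl fun b hb => ?_
    rw [map_pow, pr_dd hjS (Finset.mem_of_mem_erase hb)]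
  have hcard1 : (S.erase i).card + 1 = S.card := Finset.card_erase_add_one hi
  have hcard2 : ((S.erase i).erase j).card + 1 = (S.erase i).card := Finset.card_erase_add_one hjS
  refine ⟨?_, ?_, ?_, ?_, ?_⟩
  · have := pr_sig hj hij hq.sup
    rw [hy, map_mul, hPsup] at this
    exact mul_left_cancel₀ hP0 this
  · have h1 : TT k (S.erase i) P = 0 * P := by
      have := der_prod (d := TT k (S.erase i)) (B := (S.erase i).erase j)
        (f := fun b => dd k j b ^ 2) (u := fun b => 0) (fun b hb => by
          rw [der_pow (u := 0) (by rw [TT_dd hjS (Finset.mem_of_mem_erase hb), zero_mul])]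
          simp)
      rw [hP, this]; simp
    have := der_cancel (v := 0) hP0 h1 (by rw [← hy, hTT, zero_mul])
    simpa using this
  · have h1 : EE k (S.erase i) P = (∑ b ∈ (S.erase i).erase j, 2 * (X j + X b)) * P := by
      apply der_prod
      intro b hb
      rw [der_pow (EE_dd hjS (Finset.mem_of_mem_erase hb))]
      norm_num
    have h2 : EE k (S.erase i) (P * y) =
        (C (2 * ((S.card : k) - 3)) * (∑ a ∈ S.erase i, X a + X j)) * (P * y) := by
      rw [← hy, ← EE_sig hi hj hij, hq.ee, map_mul, map_mul, alg_C, map_sum,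
        ← Finset.sum_erase_add _ _ hi]
      congr 3
      · apply Finset.sum_congr rfl
        intro a ha
        rw [sig_X, if_neg (Finset.ne_of_mem_erase ha)]
      · simp [sig_X]
    rw [der_cancel hP0 h1 h2]
    congr 1
    rw [← Finset.mul_sum, Finset.sum_add_distrib, Finset.sum_const, ← Finset.sum_erase_add _ _ hjS,
      ← hcard1, ← hcard2]
    simp only [nsmul_eq_mul]
    push_cast
    simp only [map_mul, map_sub, map_add, map_ofNat, map_one, map_natCast]
    ring
  · have h1 := congrArg (Polynomial.map (sig k i j).toRingHom) hq.hom
    have h2 : sc k (S.erase i) P = Polynomial.X ^ (2 * ((S.erase i).erase j).card) *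
        Polynomial.C P := by
      exact sc_prod_mem hjS (Finset.erase_subset _ _) 2
    rw [Polynomial.map_mul, Polynomial.map_pow, Polynomial.map_X, Polynomial.map_mul,
      Polynomial.map_pow, Polynomial.map_X, Polynomial.map_C] at h1
    rw [show sc k S q = sc k (insert i (S.erase i)) q by rw [Finset.insert_erase hi],
      ← sc_sig_mem (by simp) hjS, AlgHom.toRingHom_eq_coe, RingHom.coe_coe, hy, map_mul, h2,
      Polynomial.C_mul] at h1
    have hne : (Polynomial.X ^ (2 * (S.erase i).card + 1) * Polynomial.C P : PP k l) ≠ 0 :=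
      mul_ne_zero (pow_ne_zero _ Polynomial.X_ne_zero) (by simpa using hP0)
    apply mul_left_cancel₀ hne
    rw [← hcard1] at h1
    have e1 : 3 * ((S.erase i).card + 1) + 2 * ((S.erase i).erase j).card =
      (2 * (S.erase i).card + 1) + 3 * (S.erase i).card := by omega
    have e2 : ((S.erase i).card + 1) ^ 2 = (2 * (S.erase i).card + 1) + (S.erase i).card ^ 2 := by
      ring
    rw [e2, pow_add _ _ ((S.erase i).card ^ 2)] at h1
    calc _ = Polynomial.X ^ ((2 * (S.erase i).card + 1) + 3 * (S.erase i).card) *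
        (Polynomial.C P * sc k (S.erase i) y) := by rw [pow_add]; ring
      _ = _ := by rw [← e1, pow_add]; linear_combination h1
  · intro J hJ hJ0 hJS
    have hiJ : i ∉ J := fun h => by simpa using hJ h
    obtain ⟨R, hR, hR2⟩ := sc_prod_dd (k := k) J hjB 2
    rw [← hP] at hR2
    by_cases hjJ : j ∈ J
    · have hcard : (insert i J).card = J.card + 1 := Finset.card_insert_of_notMem hiJ
      have h1 := hq.ord (insert i J) (by
        intro x hx
        rcases Finset.mem_insert.1 hx with rfl | hx
        · exact hi
        · exact Finset.mem_of_mem_erase (hJ hx)) (by simp) (by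
          intro h
          apply hJS
          rw [← h, Finset.erase_insert hiJ])
      have h3 := map_dvd (Polynomial.mapRingHom (sig k i j).toRingHom) h1
      rw [map_mul] at h3
      simp only [Polynomial.coe_mapRingHom] at h3
      rw [← sc_sig_mem hiJ hjJ, hy, map_mul, hR2, if_pos hjJ, hcard] at h3
      simp only [Polynomial.map_pow, Polynomial.map_X] at h3
      have e : ((S.erase i).erase j ∩ J).card + 1 = J.card := by
        rw [Finset.erase_inter, Finset.inter_eq_right.2 hJ]
        exact Finset.card_erase_add_one hjJ
      rw [mul_assoc _ R, ← mul_assoc, ← pow_add] at h3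
      refine xcancel hR h3 ?_
      nlinarith
    · have h1 := hq.ord J (hJ.trans (Finset.erase_subset _ _)) hJ0 (by
        rintro rfl; exact hiJ hi)
      have h3 := map_dvd (Polynomial.mapRingHom (sig k i j).toRingHom) h1
      rw [map_mul] at h3
      simp only [Polynomial.coe_mapRingHom] at h3
      rw [← sc_sig_not_mem hiJ hjJ, hy, map_mul, hR2, if_neg hjJ] at h3
      simp only [Polynomial.map_pow, Polynomial.map_X, pow_zero, one_mul] at h3
      exact xcancel hR h3 (by omega)

end H3

section H4

open MvPolynomial (X C mkDerivation)

variable {k : Type} [Field k] {l : ℕ}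

/-- the extension factor -/
def extF (k : Type) [Field k] {l : ℕ} (T : Finset (Fin l)) (i j a b : Fin l) : MP k l :=
  dd k j a * dd k j b * (dd k i a * dd k i b) *
    ∏ r ∈ ((T.erase j).erase a).erase b, dd k i r ^ 2

lemma pow_dvd_sc_dd {J : Finset (Fin l)} {a b : Fin l} :
    (Polynomial.X : PP k l) ^ (if a ∈ J ∧ b ∈ J then 1 else 0) ∣ sc k J (dd k a b) := by
  split_ifs with h
  · rw [sc_dd_mem h.1 h.2, pow_one]; exact dvd_mul_right _ _
  · simp

set_option maxHeartbeats 1000000 in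
lemma PInd.ext {T : Finset (Fin l)} {i j a b : Fin l} {x : MP k l} (hx : PInd T x)
    (hi : i ∉ T) (hj : j ∈ T) (ha : a ∈ T) (hb : b ∈ T) (hja : j ≠ a) (hjb : j ≠ b)
    (hab : a ≠ b) : PInd (insert i T) (extF k T i j a b * x) := by
  set B := ((T.erase j).erase a).erase b with hB
  have hBT : ∀ r ∈ B, r ∈ T := by
    intro r hr; simp only [hB, Finset.mem_erase] at hr; exact hr.2.2.2
  have haj : a ∈ T.erase j := by simp [ha, hja.symm]
  have hbj : b ∈ (T.erase j).erase a := by simp [hb, hab.symm, hjb.symm]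
  have cT : B.card + 3 = T.card := by
    have h1 := Finset.card_erase_add_one hj
    have h2 := Finset.card_erase_add_one haj
    have h3 := Finset.card_erase_add_one hbj
    rw [← hB] at h3
    omega
  have cS : (insert i T).card = T.card + 1 := Finset.card_insert_of_notMem hi
  have sT : ∀ f : Fin l → MP k l, ∑ r ∈ T, f r = ∑ r ∈ B, f r + f a + f b + f j := by
    intro f
    rw [← Finset.sum_erase_add _ _ hj, ← Finset.sum_erase_add _ _ haj,
      ← Finset.sum_erase_add _ _ hbj]; ring
  have iS : i ∈ insert i T := by simp
  have mS : ∀ {r}, r ∈ T → r ∈ insert i T := fun h => by simp [h]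
  have hsub : T ⊆ insert i T := Finset.subset_insert _ _
  have hiB : i ∉ B := fun h => hi (hBT _ h)
  have d1 : TT k (insert i T) (∏ r ∈ B, dd k i r ^ 2) = 0 * ∏ r ∈ B, dd k i r ^ 2 := by
    have := der_prod (d := TT k (insert i T)) (B := B)
      (f := fun b => dd k i b ^ 2) (u := fun b => 0) (fun b hb => by
          rw [der_pow (u := 0) (by rw [TT_dd iS (mS (hBT _ hb)), zero_mul])]
          simp)
    rw [this]; simp
  have d2 : EE k (insert i T) (∏ r ∈ B, dd k i r ^ 2) =
      (∑ r ∈ B, 2 * (X i + X r)) * ∏ r ∈ B, dd k i r ^ 2 := by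
    apply der_prod
    intro b hb
    rw [der_pow (EE_dd iS (mS (hBT _ hb)))]
    norm_num
  have tz : ∀ {c e : Fin l}, c ∈ insert i T → e ∈ insert i T →
      TT k (insert i T) (dd k c e) = 0 * dd k c e := by
    intro c e hc he; rw [TT_dd hc he, zero_mul]
  refine ⟨?_, ?_, ?_, ?_, ?_⟩
  · rw [map_mul, pr_mono hsub hx.sup, extF]
    simp only [map_mul, map_prod, map_pow]
    rw [pr_dd (mS hj) (mS ha), pr_dd (mS hj) (mS hb), pr_dd iS (mS ha), pr_dd iS (mS hb)]
    congr 2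
    refine Finset.prod_congr rfl fun r hr => ?_
    rw [pr_dd iS (mS (hBT _ hr))]
  · have := der_mul (der_mul (der_mul (der_mul (tz (mS hj) (mS ha)) (tz (mS hj) (mS hb)))
      (der_mul (tz iS (mS ha)) (tz iS (mS hb)))) d1)
      (show TT k (insert i T) x = 0 * x by rw [TT_eq_of_pr hsub hx.sup, hx.tt, zero_mul])
    rw [extF, this]; ring
  · have := der_mul (der_mul (der_mul (der_mul (EE_dd (k := k) (mS hj) (mS ha))
      (EE_dd (mS hj) (mS hb))) (der_mul (EE_dd iS (mS ha)) (EE_dd iS (mS hb)))) d2)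
      ((EE_eq_of_pr hsub hx.sup).trans hx.ee)
    rw [extF, this, Finset.sum_insert hi, cS, sT, ← cT, ← Finset.mul_sum, Finset.sum_add_distrib,
      Finset.sum_const]
    congr 1
    simp only [nsmul_eq_mul]
    push_cast
    simp only [map_mul, map_sub, map_add, map_ofNat, map_one, map_natCast]
    ring
  · have h1 : sc k (insert i T) x = sc k T x := by
      apply sc_of_pr (S := T) _ hx.sup
      intro r hr; simp [hr]
    have h2 : sc k (insert i T) (extF k T i j a b) = Polynomial.X ^ (4 + 2 * B.card) *
        Polynomial.C (extF k T i j a b) := by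
      rw [extF, ← hB]
      simp only [map_mul]
      rw [sc_dd_mem (mS hj) (mS ha), sc_dd_mem (mS hj) (mS hb), sc_dd_mem iS (mS ha),
        sc_dd_mem iS (mS hb), sc_prod_mem iS (fun r hr => mS (hBT r hr))]
      ring
    have h3 := hx.hom
    rw [map_mul, h1, h2, cS, Polynomial.C_mul]
    calc _ = Polynomial.X ^ (3 * (T.card + 1) + (4 + 2 * B.card) - 3 * T.card) *
          Polynomial.C (extF k T i j a b) * (Polynomial.X ^ (3 * T.card) * sc k T x) := by
          rw [show (3 * (T.card + 1) + (4 + 2 * B.card) - 3 * T.card) = 3 + (4 + 2 * B.card) by omega,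
            show 3 * (T.card + 1) = 3 + 3 * T.card by ring]
          ring
      _ = _ := by
        rw [h3, show (3 * (T.card + 1) + (4 + 2 * B.card) - 3 * T.card) = 2 * T.card + 1 by omega]
        ring
  · intro J hJ hJ0 hJS
    rw [map_mul]
    by_cases hiJ : i ∈ J
    · have hJ' : J.erase i ⊆ T := by
        intro r hr
        rw [Finset.mem_erase] at hr
        simpa [hr.1] using hJ hr.2
      have hsc : sc k J x = sc k (J.erase i) x := by
        apply sc_of_pr (S := T) _ hx.sup
        intro r hr
        have : r ≠ i := fun h => hi (h ▸ hr)
        simp [this]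
      have cJ := Finset.card_erase_add_one hiJ
      by_cases hne : (J.erase i).Nonempty
      · have h1 := hx.ord _ hJ' hne (by
          intro h; apply hJS; rw [← h, Finset.insert_erase hiJ])
        have cJ0 : 0 < (J.erase i).card := Finset.card_pos.2 hne
        rw [hsc]
        have h2 : (Polynomial.X : PP k l) ^ (2 * (J.erase i).card - 2) ∣
            sc k J (extF k T i j a b) := by
          have q1 := pow_dvd_sc_dd (k := k) (J := J) (a := j) (b := a)
          have q2 := pow_dvd_sc_dd (k := k) (J := J) (a := j) (b := b)
          have q3 := pow_dvd_sc_dd (k := k) (J := J) (a := i) (b := a)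
          have q4 := pow_dvd_sc_dd (k := k) (J := J) (a := i) (b := b)
          obtain ⟨R, hR, hR2⟩ := sc_prod_dd (k := k) J hiB 2
          have q5 : (Polynomial.X : PP k l) ^ (2 * (B ∩ J).card) ∣
            sc k J (∏ r ∈ B, dd k i r ^ 2) := by
            rw [hR2, if_pos hiJ]; exact dvd_mul_right _ _
          have q := mul_dvd_mul (mul_dvd_mul (mul_dvd_mul q1 q2) (mul_dvd_mul q3 q4)) q5
          rw [extF, ← hB]
          simp only [map_mul]
          refine dvd_trans ?_ q
          simp only [← pow_add]
          apply pow_dvd_pow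
          have cc : (J.erase i).card = (B ∩ J).card + (if a ∈ J then 1 else 0) +
              (if b ∈ J then 1 else 0) + (if j ∈ J then 1 else 0) := by
            have e1 : J.erase i = T.filter (· ∈ J) := by
              ext r
              simp only [Finset.mem_erase, Finset.mem_filter]
              constructor
              · rintro ⟨h1, h2⟩
                exact ⟨hJ' (by simp [h1, h2]), h2⟩
              · rintro ⟨h1, h2⟩
                exact ⟨fun h => hi (h ▸ h1), h2⟩
            have e2 : B ∩ J = B.filter (· ∈ J) := by ext r; simp
            rw [e1, e2, Finset.card_filter, Finset.card_filter, ← Finset.sum_erase_add _ _ hj,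
              ← Finset.sum_erase_add _ _ haj, ← Finset.sum_erase_add _ _ hbj]
            ring
          rw [cc]
          by_cases q1 : a ∈ J <;> by_cases q2 : b ∈ J <;> by_cases q3 : j ∈ J <;>
            simp only [q1, q2, q3, hiJ, if_true, if_false, and_self, and_true, and_false, true_and,
              false_and] <;> omega
        have h4 := mul_dvd_mul h2 h1
        rw [← pow_add] at h4
        have := xcancel (R := 1) (y := sc k J (extF k T i j a b) * sc k (J.erase i) x)
          PX_prime.not_dvd_one (A := 2 * (J.erase i).card - 2 + ((J.erase i).card ^ 2 + 2))
          (B := 3 * (J.erase i).card) (N := J.card ^ 2 + 2) (M := 3 * J.card)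
          (by rw [one_mul, mul_left_comm]; exact h4) (by
            rw [← cJ]
            have : (J.erase i).card ≥ 1 := cJ0
            obtain ⟨c, hc⟩ := Nat.exists_eq_add_of_le this
            rw [hc]
            have : 2 * (1 + c) - 2 = 2 * c := by omega
            rw [this]
            nlinarith)
        exact this
      · rw [Finset.not_nonempty_iff_eq_empty] at hne
        rw [hne, Finset.card_empty] at cJ
        rw [← cJ]
        exact Dvd.intro _ rfl
    · have hJT : J ⊆ T := by
        intro r hr
        have : r ≠ i := fun h => hiJ (h ▸ hr)
        simpa [this] using hJ hr
      by_cases hJT' : J = T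
      · subst hJT'
        have q1 := pow_dvd_sc_dd (k := k) (J := J) (a := j) (b := a)
        have q2 := pow_dvd_sc_dd (k := k) (J := J) (a := j) (b := b)
        have h2 : (Polynomial.X : PP k l) ^ 2 ∣ sc k J (extF k J i j a b) := by
          have := mul_dvd_mul q1 q2
          simp only [hj, ha, hb, and_self, if_true, pow_one, ← pow_two] at this
          rw [extF, map_mul, map_mul, map_mul]
          exact (this.mul_right _).mul_right _
        have := mul_dvd_mul h2 (Dvd.intro (Polynomial.C x) rfl :
          Polynomial.X ^ (J.card ^ 2) ∣ Polynomial.X ^ (J.card ^ 2) * Polynomial.C x)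
        rw [← hx.hom, ← pow_add, add_comm 2] at this
        rw [mul_left_comm]
        exact this
      · rw [mul_left_comm]
        exact (hx.ord J hJT hJ0 hJT').mul_left _

/-- generators for Theorem A -/
def GA (S : Finset (Fin l)) (i : Fin l) (q : MP k l) : Set (MP k l) :=
  {x | PInd S x ∧ (∃ a ∈ S, ∃ b ∈ S, a ≠ i ∧ b ≠ i ∧ a ≠ b ∧
    ∀ r ∈ S, r ≠ i → r ≠ a → r ≠ b → dd k i r ∣ x) ∧
    ∀ s ∈ S, ∀ t ∈ S, s ≠ t → dd k s t ∣ q → dd k s t ∣ x}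

lemma GA_closure_dvd {S : Finset (Fin l)} {i : Fin l} {q x : MP k l}
    (hx : x ∈ AddSubmonoid.closure (GA S i q)) {s t : Fin l} (hs : s ∈ S) (ht : t ∈ S)
    (hst : s ≠ t) (h : dd k s t ∣ q) : dd k s t ∣ x := by
  induction hx using AddSubmonoid.closure_induction with
  | mem x hx => exact hx.2.2 s hs t ht hst h
  | zero => simp
  | add x y _ _ hx hy => exact dvd_add hx hy

lemma GA_closure_PInd {S : Finset (Fin l)} {i : Fin l} {q x : MP k l}
    (hx : x ∈ AddSubmonoid.closure (GA S i q)) : PInd S x := by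
  induction hx using AddSubmonoid.closure_induction with
  | mem x hx => exact hx.1
  | zero => exact PInd.zero S
  | add x y _ _ hx hy => exact hx.add hy

lemma sig_dd_ij {i j r : Fin l} (hr : r ≠ i) : sig k i j (dd k i r) = dd k j r := by
  simp [dd, sig_X, hr]

lemma sig_dd_ne {i j s r : Fin l} (hs : s ≠ i) (hr : r ≠ i) : sig k i j (dd k s r) = dd k s r := by
  simp [dd, sig_X, hr, hs]

set_option maxHeartbeats 1000000 in
theorem thmA [CharZero k] (n : ℕ) : ∀ (S : Finset (Fin l)) (i : Fin l) (q : MP k l), S.card = n →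
    3 ≤ n → i ∈ S → PInd S q → q ∈ AddSubmonoid.closure (GA S i q) := by
  induction n with
  | zero => intro S i q _ h; omega
  | succ n ih =>
    intro S i q hcard hn hi hq
    have c1 := Finset.card_erase_add_one hi
    -- a lemma on existence of a, b
    have hab : ∃ a b, a ∈ S ∧ b ∈ S ∧ a ≠ i ∧ b ≠ i ∧ a ≠ b := by
      have : 1 < (S.erase i).card := by omega
      obtain ⟨a, ha, b, hb, hab⟩ := Finset.one_lt_card.1 this
      simp only [Finset.mem_erase] at ha hb
      exact ⟨a, b, ha.2, hb.2, ha.1, hb.1, hab⟩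
    obtain ⟨a0, b0, ha0, hb0, ha0i, hb0i, hab0⟩ := hab
    by_cases hn3 : n = 2
    · refine AddSubmonoid.subset_closure ⟨hq, ⟨a0, ha0, b0, hb0, ha0i, hb0i, hab0, ?_⟩,
        fun _ _ _ _ _ h => h⟩
      intro r hr h1 h2 h3
      exfalso
      have h4 : ({i, a0, b0, r} : Finset (Fin l)) ⊆ S := by
        intro x hx
        simp only [Finset.mem_insert, Finset.mem_singleton] at hx
        rcases hx with rfl | rfl | rfl | rfl <;> assumption
      have := Finset.card_le_card h4
      rw [Finset.card_insert_of_notMem (by simp [ha0i.symm, hb0i.symm, h1.symm]),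
        Finset.card_insert_of_notMem (by simp [hab0, h2.symm]), Finset.card_pair h3.symm] at this
      omega
    have key : ∀ j ∈ S.erase i, ∃ r ∈ AddSubmonoid.closure (GA S i q),
        sig k i j r = sig k i j q ∧ ∀ b ∈ S.erase i, b ≠ j → sig k i b r = 0 := by
      intro j hj
      have hjS := (Finset.mem_erase.1 hj).2
      have hij : i ≠ j := (Finset.mem_erase.1 hj).1.symm
      by_cases hd : dd k i j ∣ q
      · exact ⟨0, zero_mem _, by rw [(dd_dvd_iff _ _ _).1 hd, map_zero], fun b _ _ => map_zero _⟩
      obtain ⟨y, hy, hyq⟩ := hq.restrict hi hjS hij (by omega)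
      have hjB : j ∉ (S.erase i).erase j := by simp
      have hyc := ih (S.erase i) j y (by omega) (by omega) hj hy
      suffices H : ∀ x ∈ AddSubmonoid.closure (GA (S.erase i) j y),
          ∃ r ∈ AddSubmonoid.closure (GA S i q),
          sig k i j r = (∏ b ∈ (S.erase i).erase j, dd k j b ^ 2) * x ∧
            ∀ b ∈ S.erase i, b ≠ j → sig k i b r = 0 by
        rw [hyq]; exact H y hyc
      intro x hx
      induction hx using AddSubmonoid.closure_induction with
      | zero => exact ⟨0, zero_mem _, by simp, by simp⟩
      | add x x' _ _ h1 h2 =>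
        obtain ⟨r, hr, hr1, hr2⟩ := h1
        obtain ⟨r', hr', hr1', hr2'⟩ := h2
        refine ⟨r + r', add_mem hr hr', by rw [map_add, hr1, hr1']; ring, fun b hb hbj => ?_⟩
        rw [map_add, hr2 b hb hbj, hr2' b hb hbj, add_zero]
      | mem x hx =>
        obtain ⟨hx1, ⟨a, ha, b, hb, haj, hbj, hab, hr⟩, hx2⟩ := hx
        have hai := (Finset.mem_erase.1 ha).1
        have hbi := (Finset.mem_erase.1 hb).1
        set B := (((S.erase i).erase j).erase a).erase b with hB
        have hdvd1 : ∀ r ∈ S.erase i, r ≠ j → dd k i r ∣ extF k (S.erase i) i j a b := by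
          intro r hr hrj
          rw [extF]
          by_cases h1 : r = a
          · subst h1; exact Dvd.dvd.mul_right (Dvd.dvd.mul_left (dvd_mul_right _ _) _) _
          · by_cases h2 : r = b
            · subst h2; exact Dvd.dvd.mul_right (Dvd.dvd.mul_left (dvd_mul_left _ _) _) _
            · apply Dvd.dvd.mul_left
              have hrB : r ∈ B := by
                rw [hB]; simp only [Finset.mem_erase] at hr ⊢; exact ⟨h2, h1, hrj, hr⟩
              exact (dvd_pow_self _ two_ne_zero).trans
                (Finset.dvd_prod_of_mem (fun r => dd k i r ^ 2) hrB)
        have hdvd2 : ∀ r ∈ S.erase i, r ≠ j → dd k j r ∣ extF k (S.erase i) i j a b * x := by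
          intro r hr' hrj
          by_cases h1 : r = a
          · subst h1; rw [extF]
            exact (((dvd_mul_right _ _).mul_right _).mul_right _).mul_right _
          · by_cases h2 : r = b
            · subst h2; rw [extF]
              exact (((dvd_mul_left _ _).mul_right _).mul_right _).mul_right _
            · exact (hr r hr' hrj h1 h2).mul_left _
        have hP : PInd S (extF k (S.erase i) i j a b * x) := by
          have := hx1.ext (i := i) (by simp) hj ha hb haj.symm hbj.symm hab
          rwa [Finset.insert_erase hi] at this
        refine ⟨extF k (S.erase i) i j a b * x, AddSubmonoid.subset_closure ⟨hP, ?_, ?_⟩, ?_, ?_⟩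
        · refine ⟨j, hjS, ?_⟩
          by_cases h : a0 = j
          · refine ⟨b0, hb0, hij.symm, hb0i, fun h' => hab0 (h.trans h'), fun r hr hri hrj _ => ?_⟩
            exact (hdvd1 r (by simp [hr, hri]) hrj).mul_right _
          · refine ⟨a0, ha0, hij.symm, ha0i, fun h' => h h'.symm, fun r hr hri hrj _ => ?_⟩
            exact (hdvd1 r (by simp [hr, hri]) hrj).mul_right _
        · have symm_dvd : ∀ {u v : Fin l} {p : MP k l}, dd k u v ∣ p → dd k v u ∣ p := by
            intro u v p h; rw [dd_swap, neg_dvd]; exact h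
          intro s hs t ht hst hdq
          by_cases hsi : s = i
          · subst hsi
            by_cases htj : t = j
            · subst htj; exact absurd hdq hd
            · exact (hdvd1 t (by simp [ht, hst.symm]) htj).mul_right _
          by_cases hti : t = i
          · subst hti
            by_cases hsj : s = j
            · subst hsj; exact absurd (symm_dvd hdq) hd
            · exact (symm_dvd (hdvd1 s (by simp [hs, hst]) hsj)).mul_right _
          by_cases hsj : s = j
          · subst hsj
            exact hdvd2 t (by simp [ht, hti]) hst.symm
          by_cases htj : t = j
          · subst htj
            exact symm_dvd (hdvd2 s (by simp [hs, hsi]) hst)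
          apply Dvd.dvd.mul_left
          apply hx2 s (by simp [hs, hsi]) t (by simp [ht, hti]) hst
          have h1 := map_dvd (sig k i j) hdq
          rw [sig_dd_ne hsi hti, hyq] at h1
          exact ((dd_prime hst).dvd_or_dvd h1).resolve_left (dd_not_dvd_prod hst hjB hsj htj 2)
        · have hbB : b ∈ ((S.erase i).erase j).erase a := by
            simp only [Finset.mem_erase] at hb ⊢; exact ⟨hab.symm, hbj, hb⟩
          have haB : a ∈ ((S.erase i).erase j) := by
            simp only [Finset.mem_erase] at ha ⊢; exact ⟨haj, ha⟩
          rw [map_mul, sig_of_pr (by simp) hx1.sup, extF]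
          simp only [map_mul, map_prod, map_pow]
          rw [sig_dd_ne hij.symm hai, sig_dd_ne hij.symm hbi, sig_dd_ij hai, sig_dd_ij hbi,
            ← Finset.prod_erase_mul _ _ haB, ← Finset.prod_erase_mul _ _ hbB,
            Finset.prod_congr rfl (g := fun r => dd k j r ^ 2)]
          · ring
          · intro r hr
            rw [sig_dd_ij]
            simp only [Finset.mem_erase] at hr
            exact hr.2.2.2.1
        · intro r hr hrj
          exact (dd_dvd_iff _ _ _).1 ((hdvd1 r hr hrj).mul_right _)
    choose! R hR hR1 hR2 using key
    have hsum : ∑ j ∈ S.erase i, R j ∈ AddSubmonoid.closure (GA S i q) := sum_mem hR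
    have hrest : q - ∑ j ∈ S.erase i, R j ∈ AddSubmonoid.closure (GA S i q) := by
      refine AddSubmonoid.subset_closure ⟨hq.sub (GA_closure_PInd hsum),
        ⟨a0, ha0, b0, hb0, ha0i, hb0i, hab0, ?_⟩, ?_⟩
      · intro r hr hri _ _
        have hr' : r ∈ S.erase i := by simp [hr, hri]
        rw [dd_dvd_iff, map_sub, map_sum, Finset.sum_eq_single r, hR1 r hr', sub_self]
        · intro b hb hbr
          exact hR2 b hb r hr' hbr.symm
        · intro h; exact absurd hr' h
      · intro s hs t ht hst h
        exact dvd_sub h (GA_closure_dvd hsum hs ht hst h)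
    have := add_mem hrest hsum
    rwa [sub_add_cancel] at this

end H4

section H5

open MvPolynomial (X C mkDerivation)

variable {k : Type} [Field k] {l : ℕ}

/-- normalized components -/
def nc (J : Finset (Fin l)) (N : ℕ) (p : MP k l) : MP k l :=
  (Polynomial.X ^ (4 * J.card) * sc k J p).coeff N

lemma nc_eq (J : Finset (Fin l)) (N : ℕ) (p : MP k l) :
    nc J N p = if 4 * J.card ≤ N then (sc k J p).coeff (N - 4 * J.card) else 0 := by
  rw [nc, Polynomial.coeff_X_pow_mul']

lemma nc_zero (J : Finset (Fin l)) (N : ℕ) : nc J N (0 : MP k l) = 0 := by simp [nc]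

lemma nc_add (J : Finset (Fin l)) (N : ℕ) (p q : MP k l) : nc J N (p + q) = nc J N p + nc J N q := by
  simp only [nc, map_add, mul_add, Polynomial.coeff_add]

lemma nc_Cmul (J : Finset (Fin l)) (N : ℕ) (c : k) (p : MP k l) :
    nc J N (C c * p) = C c * nc J N p := by
  simp only [nc, map_mul, sc_C]
  rw [mul_left_comm, Polynomial.coeff_C_mul]

lemma nc_sum {ι : Type} (J : Finset (Fin l)) (N : ℕ) (B : Finset ι) (f : ι → MP k l) :
    nc J N (∑ b ∈ B, f b) = ∑ b ∈ B, nc J N (f b) := by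
  simp only [nc, map_sum, Finset.mul_sum, Polynomial.finsetSum_coeff]

lemma nc_hmul {J : Finset (Fin l)} {d : ℕ} {h : MP k l}
    (hh : sc k J h = Polynomial.X ^ d * Polynomial.C h) (N : ℕ) (p : MP k l) :
    nc J (N + d) (h * p) = h * nc J N p := by
  simp only [nc, map_mul, hh]
  rw [show ∀ a b c e : PP k l, a * (b * c * e) = c * (a * e) * b by intros; ring,
    Polynomial.coeff_mul_X_pow, Polynomial.coeff_C_mul]

lemma nc_hmul_lt {J : Finset (Fin l)} {d : ℕ} {h : MP k l}
    (hh : sc k J h = Polynomial.X ^ d * Polynomial.C h) {N : ℕ} (hN : N < d) (p : MP k l) :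
    nc J N (h * p) = 0 := by
  simp only [nc, map_mul, hh]
  rw [show ∀ a b c e : PP k l, a * (b * c * e) = b * (c * (a * e)) by intros; ring,
    Polynomial.coeff_X_pow_mul', if_neg (by omega)]

lemma coeff_comm_mul {f g : MP k l →+* PP k l} {p q : MP k l}
    (hp : ∀ m n, (f ((g p).coeff n)).coeff m = (g ((f p).coeff m)).coeff n)
    (hq : ∀ m n, (f ((g q).coeff n)).coeff m = (g ((f q).coeff m)).coeff n) (m n : ℕ) :
    (f ((g (p * q)).coeff n)).coeff m = (g ((f (p * q)).coeff m)).coeff n := by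
  rw [map_mul, map_mul, Polynomial.coeff_mul, Polynomial.coeff_mul, map_sum, map_sum,
    Polynomial.finsetSum_coeff, Polynomial.finsetSum_coeff]
  simp only [map_mul, Polynomial.coeff_mul]
  rw [Finset.sum_comm]
  refine Finset.sum_congr rfl fun x _ => Finset.sum_congr rfl fun y _ => ?_
  rw [hp, hq]

lemma coeff_comm {f g : MP k l →+* PP k l} (hf : ∀ c, f (C c) = Polynomial.C (C c))
    (hg : ∀ c, g (C c) = Polynomial.C (C c))
    (h : ∀ a m n, (f ((g (X a)).coeff n)).coeff m = (g ((f (X a)).coeff m)).coeff n)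
    (p : MP k l) (m n : ℕ) :
    (f ((g p).coeff n)).coeff m = (g ((f p).coeff m)).coeff n := by
  induction p using MvPolynomial.induction_on generalizing m n with
  | C c =>
    rw [hf, hg, Polynomial.coeff_C, Polynomial.coeff_C]
    split_ifs with h1 h2 h2 <;> simp only [hf, hg, Polynomial.coeff_C, h1, h2, if_true, if_false, map_zero, Polynomial.coeff_zero]
  | add p q hp hq => simp only [map_add, Polynomial.coeff_add, hp, hq]
  | mul_X p a hp => exact coeff_comm_mul hp (h a) m n

lemma coeff_X_mul_C' (p : MP k l) (n : ℕ) :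
    (Polynomial.X * Polynomial.C p : PP k l).coeff n = if n = 1 then p else 0 := by
  rw [Polynomial.coeff_mul_C, Polynomial.coeff_X]
  by_cases h : n = 1
  · simp [h]
  · simp [h, Ne.symm h]

lemma sc_comm (J K : Finset (Fin l)) (p : MP k l) (m n : ℕ) :
    (sc k J ((sc k K p).coeff n)).coeff m = (sc k K ((sc k J p).coeff m)).coeff n := by
  refine coeff_comm (sc_C J) (sc_C K) (fun a m n => ?_) p m n
  by_cases h1 : a ∈ J <;> by_cases h2 : a ∈ K <;>
  simp only [sc_X_mem, sc_X_not_mem, h1, h2, not_false_eq_true, coeff_X_mul_C',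
    Polynomial.coeff_C] <;> split_ifs with h3 h4 h4 <;>
  simp only [sc_X_mem, sc_X_not_mem, h1, h2, not_false_eq_true, coeff_X_mul_C',
    Polynomial.coeff_C, map_zero, Polynomial.coeff_zero, h3, h4, if_true, if_false]

lemma nc_comm (J K : Finset (Fin l)) (p : MP k l) (m n : ℕ) :
    nc J m (nc K n p) = nc K n (nc J m p) := by
  simp only [nc_eq]
  split_ifs <;> simp [sc_comm J K]

lemma sc_coeff_self (J : Finset (Fin l)) (p : MP k l) (N : ℕ) :
    sc k J ((sc k J p).coeff N) = Polynomial.X ^ N * Polynomial.C ((sc k J p).coeff N) := by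
  induction p using MvPolynomial.induction_on generalizing N with
  | C c =>
    rw [sc_C, Polynomial.coeff_C]
    split_ifs with h
    · subst h; simp [sc_C]
    · simp
  | add p q hp hq => simp only [map_add, Polynomial.coeff_add, hp, hq, mul_add]
  | mul_X p a hp =>
    have hX : ∀ n, sc k J ((sc k J (X a)).coeff n) =
        Polynomial.X ^ n * Polynomial.C ((sc k J (X a)).coeff n) := by
      intro n
      by_cases h1 : a ∈ J
      · rw [sc_X_mem h1, coeff_X_mul_C']
        split_ifs with h
        · subst h
          rw [sc_X_mem h1, pow_one]
        · simp
      · rw [sc_X_not_mem h1, Polynomial.coeff_C]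
        split_ifs with h2
        · subst h2; rw [sc_X_not_mem h1, pow_zero, one_mul]
        · simp
    rw [map_mul, Polynomial.coeff_mul, map_sum, map_sum, Finset.mul_sum]
    refine Finset.sum_congr rfl fun x hx => ?_
    rw [map_mul, hp, hX, map_mul, ← Finset.HasAntidiagonal.mem_antidiagonal.1 hx]
    ring

lemma nc_homog (J : Finset (Fin l)) (p : MP k l) (N : ℕ) :
    Polynomial.X ^ (4 * J.card) * sc k J (nc J N p) =
      Polynomial.X ^ N * Polynomial.C (nc J N p) := by
  rw [nc_eq]
  split_ifs with h
  · rw [sc_coeff_self, ← mul_assoc, ← pow_add, Nat.add_sub_cancel' h]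
  · simp

lemma hom_iff {S : Finset (Fin l)} {p q : MP k l} {d : ℕ} :
    Polynomial.X ^ (4 * S.card) * sc k S p = Polynomial.X ^ d * Polynomial.C q ↔
      ∀ M, nc S M p = if M = d then q else 0 := by
  rw [Polynomial.ext_iff]
  refine forall_congr' fun M => ?_
  rw [nc, Polynomial.coeff_X_pow_mul', Polynomial.coeff_X_pow_mul' (n := d), Polynomial.coeff_C]
  by_cases h : M = d
  · simp [h]
  · have : (if d ≤ M then if M - d = 0 then q else 0 else 0) = 0 := by
      split_ifs with h1 h2
      · omega
      · rfl
      · rfl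
    rw [this, if_neg h]

lemma sc_union {I J : Finset (Fin l)} (h : Disjoint I J) (p : MP k l) :
    sc k (I ∪ J) p = Polynomial.eval₂ (sc k I) Polynomial.X (sc k J p) := by
  have : sc k (I ∪ J) = (Polynomial.eval₂RingHom (sc k I) Polynomial.X).comp (sc k J) := by
    apply MvPolynomial.ringHom_ext
    · intro r
      rw [RingHom.comp_apply, sc_C, sc_C]
      simp [sc_C]
    · intro a
      rw [RingHom.comp_apply]
      by_cases h1 : a ∈ I
      · have h2 : a ∉ J := Finset.disjoint_left.1 h h1
        rw [sc_X_mem (by simp [h1]), sc_X_not_mem h2]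
        simp [sc_X_mem h1]
      · by_cases h2 : a ∈ J
        · rw [sc_X_mem (by simp [h2]), sc_X_mem h2]
          simp [sc_X_not_mem h1]
        · rw [sc_X_not_mem (by simp [h1, h2]), sc_X_not_mem h2]
          simp [sc_X_not_mem h1]
  exact DFunLike.congr_fun this p

/-- derivations acting on coefficients -/
lemma der_rel {R : Type} [CommRing R] (f : MP k l →+* R) (u v : R)
    (d1 : Derivation k (MP k l) (MP k l)) (d2 : R → R) (hC : ∀ c, d2 (f (C c)) = 0)
    (hadd : ∀ x y, d2 (x + y) = d2 x + d2 y) (hmul : ∀ x y, d2 (x * y) = x * d2 y + y * d2 x)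
    (h : ∀ a, u * f (d1 (X a)) = v * d2 (f (X a))) (p : MP k l) : u * f (d1 p) = v * d2 (f p) := by
  induction p using MvPolynomial.induction_on with
  | C c => rw [der_C, map_zero, mul_zero, hC, mul_zero]
  | add p q hp hq => rw [map_add, map_add, mul_add, hp, hq, map_add, hadd, mul_add]
  | mul_X p a hp =>
    rw [Derivation.leibniz, map_add, map_mul, hmul]
    simp only [smul_eq_mul, map_mul]
    linear_combination (f (X a)) * hp + f p * h a

def hatD (d : Derivation k (MP k l) (MP k l)) (p : PP k l) : PP k l :=
  p.sum (fun n a => Polynomial.monomial n (d a))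

lemma hatD_coeff (d : Derivation k (MP k l) (MP k l)) (p : PP k l) (n : ℕ) :
    (hatD d p).coeff n = d (p.coeff n) := by
  rw [hatD, Polynomial.sum_def, Polynomial.finsetSum_coeff]
  simp only [Polynomial.coeff_monomial]
  rw [Finset.sum_ite_eq' p.support n]
  split_ifs with h
  · rfl
  · rw [Polynomial.notMem_support_iff.1 h, map_zero]

lemma hatD_C (d : Derivation k (MP k l) (MP k l)) (p : MP k l) :
    hatD d (Polynomial.C p) = Polynomial.C (d p) := by
  ext n : 1
  rw [hatD_coeff, Polynomial.coeff_C, Polynomial.coeff_C]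
  split_ifs <;> simp

lemma hatD_X (d : Derivation k (MP k l) (MP k l)) :
    hatD d (Polynomial.X) = 0 := by
  ext n : 1
  rw [hatD_coeff, Polynomial.coeff_X]
  split_ifs <;> simp

lemma hatD_add (d : Derivation k (MP k l) (MP k l)) (p q : PP k l) :
    hatD d (p + q) = hatD d p + hatD d q := by
  ext n : 1
  simp only [hatD_coeff, Polynomial.coeff_add, map_add]

lemma hatD_mul (d : Derivation k (MP k l) (MP k l)) (p q : PP k l) :
    hatD d (p * q) = p * hatD d q + q * hatD d p := by
  ext n : 1
  rw [mul_comm q]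
  simp only [hatD_coeff, Polynomial.coeff_add, Polynomial.coeff_mul, map_sum, Derivation.leibniz,
    smul_eq_mul, ← Finset.sum_add_distrib]
  exact Finset.sum_congr rfl fun x _ => by ring

lemma hatD_Xpow (d : Derivation k (MP k l) (MP k l)) (p : PP k l) (n : ℕ) :
    hatD d (Polynomial.X ^ n * p) = Polynomial.X ^ n * hatD d p := by
  ext m : 1
  simp only [hatD_coeff, Polynomial.coeff_X_pow_mul']
  split_ifs <;> simp

lemma TT_J_rel (J : Finset (Fin l)) (p : MP k l) :
    Polynomial.X * sc k J (TT k J p) = hatD (TT k J) (sc k J p) := by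
  have := der_rel (sc k J) Polynomial.X 1 (TT k J) (hatD (TT k J))
    (fun c => by rw [sc_C, hatD_C, der_C, map_zero]) (hatD_add _) (hatD_mul _) (fun a => by
      by_cases h : a ∈ J
      · rw [TT_X, if_pos h, sc_X_mem h, hatD_mul, hatD_X, hatD_C, TT_X, if_pos h]
        simp
      · rw [TT_X, if_neg h, sc_X_not_mem h, hatD_C, TT_X, if_neg h]
        simp) p
  rwa [one_mul] at this

lemma TT_I_rel {I J : Finset (Fin l)} (hd : Disjoint I J) (p : MP k l) :
    sc k J (TT k I p) = hatD (TT k I) (sc k J p) := by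
  have := der_rel (sc k J) 1 1 (TT k I) (hatD (TT k I))
    (fun c => by rw [sc_C, hatD_C, der_C, map_zero]) (hatD_add _) (hatD_mul _) (fun a => by
      by_cases h : a ∈ J
      · have h2 : a ∉ I := Finset.disjoint_right.1 hd h
        rw [TT_X, if_neg h2, sc_X_mem h, hatD_mul, hatD_X, hatD_C, TT_X, if_neg h2]
        simp
      · rw [TT_X, sc_X_not_mem h, hatD_C, TT_X]
        split_ifs <;> simp) p
  rwa [one_mul, one_mul] at this

lemma EE_J_rel (J : Finset (Fin l)) (p : MP k l) :
    sc k J (EE k J p) = Polynomial.X * hatD (EE k J) (sc k J p) := by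
  have := der_rel (sc k J) 1 Polynomial.X (EE k J) (hatD (EE k J))
    (fun c => by rw [sc_C, hatD_C, der_C, map_zero]) (hatD_add _) (hatD_mul _) (fun a => by
      by_cases h : a ∈ J
      · rw [EE_X, if_pos h, map_pow, sc_X_mem h, hatD_mul, hatD_X, hatD_C, EE_X, if_pos h]
        simp only [smul_eq_mul, map_pow]
        ring
      · rw [EE_X, if_neg h, sc_X_not_mem h, hatD_C, EE_X, if_neg h]
        simp) p
  rwa [one_mul] at this

lemma EE_I_rel {I J : Finset (Fin l)} (hd : Disjoint I J) (p : MP k l) :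
    sc k J (EE k I p) = hatD (EE k I) (sc k J p) := by
  have := der_rel (sc k J) 1 1 (EE k I) (hatD (EE k I))
    (fun c => by rw [sc_C, hatD_C, der_C, map_zero]) (hatD_add _) (hatD_mul _) (fun a => by
      by_cases h : a ∈ J
      · have h2 : a ∉ I := Finset.disjoint_right.1 hd h
        rw [EE_X, if_neg h2, sc_X_mem h, hatD_mul, hatD_X, hatD_C, EE_X, if_neg h2]
        simp
      · rw [EE_X, sc_X_not_mem h, hatD_C, EE_X]
        split_ifs <;> simp [sc_X_not_mem h]) p
  rwa [one_mul, one_mul] at this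

lemma nc_TT_J (J : Finset (Fin l)) (N : ℕ) (p : MP k l) :
    nc J N (TT k J p) = TT k J (nc J (N + 1) p) := by
  rw [nc, nc, ← hatD_coeff, hatD_Xpow, ← TT_J_rel, mul_left_comm, Polynomial.coeff_X_mul]

lemma nc_TT_J_zero (J : Finset (Fin l)) (p : MP k l) : TT k J (nc J 0 p) = 0 := by
  rw [nc, ← hatD_coeff, hatD_Xpow, ← TT_J_rel, mul_left_comm, Polynomial.coeff_X_mul_zero]

lemma nc_TT_I {I J : Finset (Fin l)} (hd : Disjoint I J) (N : ℕ) (p : MP k l) :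
    nc J N (TT k I p) = TT k I (nc J N p) := by
  rw [nc, nc, ← hatD_coeff, hatD_Xpow, ← TT_I_rel hd]

lemma nc_EE_J (J : Finset (Fin l)) (N : ℕ) (p : MP k l) :
    nc J (N + 1) (EE k J p) = EE k J (nc J N p) := by
  rw [nc, nc, ← hatD_coeff, hatD_Xpow, EE_J_rel, mul_left_comm, Polynomial.coeff_X_mul]

lemma nc_EE_J_zero (J : Finset (Fin l)) (p : MP k l) : nc J 0 (EE k J p) = 0 := by
  rw [nc, EE_J_rel, mul_left_comm, Polynomial.coeff_X_mul_zero]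

lemma nc_EE_I {I J : Finset (Fin l)} (hd : Disjoint I J) (N : ℕ) (p : MP k l) :
    nc J N (EE k I p) = EE k I (nc J N p) := by
  rw [nc, nc, ← hatD_coeff, hatD_Xpow, ← EE_I_rel hd]

lemma TT_union {I J : Finset (Fin l)} (hd : Disjoint I J) (p : MP k l) :
    TT k (I ∪ J) p = TT k I p + TT k J p := by
  have := der_eq (TT k (I ∪ J)) (TT k I + TT k J) (fun a => by
    simp only [TT_X, Derivation.add_apply]
    by_cases h1 : a ∈ I
    · simp [h1, Finset.disjoint_left.1 hd h1]
    · simp [h1]) p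
  simpa using this

lemma EE_union {I J : Finset (Fin l)} (hd : Disjoint I J) (p : MP k l) :
    EE k (I ∪ J) p = EE k I p + EE k J p := by
  have := der_eq (EE k (I ∪ J)) (EE k I + EE k J) (fun a => by
    simp only [EE_X, Derivation.add_apply]
    by_cases h1 : a ∈ I
    · simp [h1, Finset.disjoint_left.1 hd h1]
    · simp [h1]) p
  simpa using this

end H5

section H6

open MvPolynomial (X C mkDerivation)

variable {k : Type} [Field k] {l : ℕ}

def e0 (k : Type) [Field k] {l : ℕ} (I : Finset (Fin l)) : MP k l := ∏ a ∈ I, X a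
def e1 (k : Type) [Field k] {l : ℕ} (I : Finset (Fin l)) : MP k l :=
  ∑ a ∈ I, ∏ b ∈ I.erase a, X b
def sg (k : Type) [Field k] {l : ℕ} (I : Finset (Fin l)) : MP k l := ∑ a ∈ I, X a

lemma TT_disj {I J : Finset (Fin l)} (hd : Disjoint I J) {p : MP k l} (hp : pr k I p = p) :
    TT k J p = 0 := by
  have := der_eq_of_pr (d1 := TT k J) (d2 := 0) (S := I) (fun a ha => by
    simp [TT_X, Finset.disjoint_left.1 hd ha]) hp
  simpa using this

lemma EE_disj {I J : Finset (Fin l)} (hd : Disjoint I J) {p : MP k l} (hp : pr k I p = p) :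
    EE k J p = 0 := by
  have := der_eq_of_pr (d1 := EE k J) (d2 := 0) (S := I) (fun a ha => by
    simp [EE_X, Finset.disjoint_left.1 hd ha]) hp
  simpa using this

lemma sc_disj {I J : Finset (Fin l)} (hd : Disjoint I J) {p : MP k l} (hp : pr k I p = p) :
    sc k J p = Polynomial.C p := by
  have := hom_eq_of_pr (f := sc k J) (g := Polynomial.C) (S := I) (fun c => sc_C J c)
    (fun a ha => sc_X_not_mem (Finset.disjoint_left.1 hd ha)) hp
  exact this

lemma pr_e0 (I : Finset (Fin l)) : pr k I (e0 k I) = e0 k I := by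
  rw [e0, map_prod]
  exact Finset.prod_congr rfl fun a ha => by rw [pr_X, if_pos ha]

lemma pr_e1 (I : Finset (Fin l)) : pr k I (e1 k I) = e1 k I := by
  rw [e1, map_sum]
  refine Finset.sum_congr rfl fun a ha => ?_
  rw [map_prod]
  exact Finset.prod_congr rfl fun b hb => by rw [pr_X, if_pos (Finset.mem_of_mem_erase hb)]

lemma pr_sg (I : Finset (Fin l)) : pr k I (sg k I) = sg k I := by
  rw [sg, map_sum]
  exact Finset.sum_congr rfl fun a ha => by rw [pr_X, if_pos ha]

lemma e0_ne_zero (I : Finset (Fin l)) : e0 k I ≠ 0 := by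
  rw [e0, Finset.prod_ne_zero_iff]
  intro a _
  exact MvPolynomial.X_ne_zero a

lemma e0_insert {a : Fin l} {K : Finset (Fin l)} (h : a ∉ K) :
    e0 k (insert a K) = X a * e0 k K := Finset.prod_insert h

lemma sg_insert {a : Fin l} {K : Finset (Fin l)} (h : a ∉ K) :
    sg k (insert a K) = X a + sg k K := Finset.sum_insert h

lemma e1_insert {a : Fin l} {K : Finset (Fin l)} (h : a ∉ K) :
    e1 k (insert a K) = e0 k K + X a * e1 k K := by
  rw [e1, Finset.sum_insert h, Finset.erase_insert h, e1, Finset.mul_sum]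
  congr 1
  refine Finset.sum_congr rfl fun b hb => ?_
  have hab : a ≠ b := fun h' => h (h' ▸ hb)
  rw [Finset.erase_insert_of_ne hab, Finset.prod_insert]
  simp [h]

lemma e0_union {I K : Finset (Fin l)} (h : Disjoint I K) :
    e0 k (I ∪ K) = e0 k I * e0 k K := Finset.prod_union h

lemma sg_union {I K : Finset (Fin l)} (h : Disjoint I K) :
    sg k (I ∪ K) = sg k I + sg k K := Finset.sum_union h

lemma e1_union {I K : Finset (Fin l)} (h : Disjoint I K) :
    e1 k (I ∪ K) = e1 k I * e0 k K + e0 k I * e1 k K := by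
  induction I using Finset.induction_on with
  | empty => simp [e1, e0]
  | insert a I ha ih =>
    rw [Finset.disjoint_insert_left] at h
    rw [Finset.insert_union, e1_insert (by simp [ha, h.1]), ih h.2, e1_insert ha, e0_insert ha,
      e0_union h.2]
    ring

lemma TT_e0 {I S : Finset (Fin l)} (h : I ⊆ S) : TT k S (e0 k I) = e1 k I := by
  induction I using Finset.induction_on with
  | empty => simp [e1, e0]
  | insert a I ha ih =>
    rw [Finset.insert_subset_iff] at h
    rw [e0_insert ha, e1_insert ha, Derivation.leibniz, ih h.2, TT_X, if_pos h.1]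
    simp only [smul_eq_mul]; ring

lemma TT_sg {I S : Finset (Fin l)} (h : I ⊆ S) : TT k S (sg k I) = (I.card : MP k l) := by
  rw [sg, map_sum, Finset.sum_congr rfl (fun a ha => by rw [TT_X, if_pos (h ha)])]
  simp

lemma EE_e0 {I S : Finset (Fin l)} (h : I ⊆ S) : EE k S (e0 k I) = sg k I * e0 k I := by
  apply der_prod
  intro a ha
  rw [EE_X, if_pos (h ha)]; ring

lemma EE_e1 {I S : Finset (Fin l)} (h : I ⊆ S) :
    EE k S (e1 k I) = sg k I * e1 k I - (I.card : MP k l) * e0 k I := by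
  induction I using Finset.induction_on with
  | empty => simp [e1]
  | insert a I ha ih =>
    have h' := h
    rw [Finset.insert_subset_iff] at h
    rw [e0_insert ha, e1_insert ha, sg_insert ha, map_add, Derivation.leibniz, ih h.2, EE_X,
      if_pos h.1, EE_e0 h.2, Finset.card_insert_of_notMem ha]
    simp only [smul_eq_mul]; push_cast; ring

lemma sc_e0 {I J : Finset (Fin l)} (h : I ⊆ J) :
    sc k J (e0 k I) = Polynomial.X ^ I.card * Polynomial.C (e0 k I) := by
  rw [e0, map_prod, map_prod, ← Finset.prod_const, ← Finset.prod_mul_distrib]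
  exact Finset.prod_congr rfl fun b hb => sc_X_mem (h hb)

lemma sc_sg {I J : Finset (Fin l)} (h : I ⊆ J) :
    sc k J (sg k I) = Polynomial.X * Polynomial.C (sg k I) := by
  rw [sg, map_sum, map_sum, Finset.mul_sum]
  exact Finset.sum_congr rfl fun b hb => sc_X_mem (h hb)

lemma sc_e1 {I J : Finset (Fin l)} (h : I ⊆ J) :
    Polynomial.X * sc k J (e1 k I) = Polynomial.X ^ I.card * Polynomial.C (e1 k I) := by
  rw [e1, map_sum, map_sum, Finset.mul_sum, Finset.mul_sum]
  refine Finset.sum_congr rfl fun b hb => ?_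
  have := sc_e0 (k := k) ((Finset.erase_subset b I).trans h)
  rw [e0] at this
  rw [this, ← Finset.card_erase_add_one hb]
  ring

/-- polynomial version of admissibility, in the variables of `S` (others are parameters) -/
structure PA (S : Finset (Fin l)) (p : MP k l) : Prop where
  tt : TT k S p = 0
  ee : EE k S p = (C (4 * ((S.card : k) - 2)) * sg k S) * p
  hom : Polynomial.X ^ (4 * S.card) * sc k S p = Polynomial.X ^ (2 * S.card ^ 2) * Polynomial.C p
  lo : ∀ J ⊆ S, ∀ N < 2 * J.card ^ 2, nc J N p = 0
  rel : ∀ J ⊆ S, e0 k (S \ J) * nc J (2 * J.card ^ 2 + 1) p +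
    4 * sg k J * e1 k (S \ J) * nc J (2 * J.card ^ 2) p = 0

lemma PA.zero (S : Finset (Fin l)) : PA (k := k) S 0 :=
  ⟨by simp, by simp, by simp, fun J _ N _ => by simp [nc_zero], fun J _ => by simp [nc_zero]⟩

lemma PA.add {S : Finset (Fin l)} {p q : MP k l} (hp : PA S p) (hq : PA S q) :
    PA S (p + q) := by
  refine ⟨by rw [map_add, hp.tt, hq.tt, add_zero],
    by rw [map_add, hp.ee, hq.ee]; ring,
    by rw [map_add, mul_add, hp.hom, hq.hom, Polynomial.C_add]; ring, fun J h1 N h2 => ?_,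
    fun J h1 => ?_⟩
  · rw [nc_add, hp.lo J h1 N h2, hq.lo J h1 N h2, add_zero]
  · rw [nc_add, nc_add]
    linear_combination hp.rel J h1 + hq.rel J h1

lemma PA.smul {S : Finset (Fin l)} {p : MP k l} (c : k) (hp : PA S p) :
    PA S (C c * p) := by
  refine ⟨by rw [der_Cmul, hp.tt, mul_zero],
    by rw [der_Cmul, hp.ee]; ring,
    by rw [map_mul, sc_C, mul_left_comm, hp.hom, Polynomial.C_mul]; ring, fun J h1 N h2 => ?_,
    fun J h1 => ?_⟩
  · rw [nc_Cmul, hp.lo J h1 N h2, mul_zero]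
  · rw [nc_Cmul, nc_Cmul]
    linear_combination C c * hp.rel J h1

lemma PA.sub {S : Finset (Fin l)} {p q : MP k l} (hp : PA S p) (hq : PA S q) :
    PA S (p - q) := by
  have := hp.add (hq.smul (-1))
  convert this using 1
  simp [sub_eq_add_neg]

lemma X_pow_dvd_of_rel [CharZero k] {I : Finset (Fin l)} {p : MP k l} {c : ℕ}
    (h : e0 k I * TT k I p = (c : MP k l) * e1 k I * p) {a : Fin l} (ha : a ∈ I) {e : ℕ}
    (he : e ≤ c) : X a ^ e ∣ p := by
  induction e with
  | zero => simp
  | succ e ih =>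
    obtain ⟨u, rfl⟩ := ih (by omega)
    rw [pow_succ]
    apply mul_dvd_mul_left
    have haK : a ∉ I.erase a := by simp
    have hI : insert a (I.erase a) = I := Finset.insert_erase ha
    have hE0 := e0_insert (k := k) haK
    have hE1 := e1_insert (k := k) haK
    rw [hI] at hE0 hE1
    have hpow : X a * TT k I (X a ^ e) = (e : MP k l) * X a ^ e := by
      rw [Derivation.leibniz_pow, TT_X, if_pos ha]
      cases e with
      | zero => simp
      | succ e => simp [pow_succ]; ring
    rw [Derivation.leibniz] at h
    simp only [smul_eq_mul] at h
    have h2 : X a ^ e * ((c - e : MP k l) * (e0 k (I.erase a) * u)) =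
        X a ^ e * (X a * (e0 k (I.erase a) * TT k I u - (c : MP k l) * e1 k (I.erase a) * u)) := by
      rw [hE0, hE1] at h
      linear_combination -h + e0 k (I.erase a) * u * hpow
    have h3 := mul_left_cancel₀ (pow_ne_zero e (MvPolynomial.X_ne_zero a)) h2
    have h4 : X a ∣ (c - e : MP k l) * (e0 k (I.erase a) * u) := h3 ▸ dvd_mul_right _ _
    have hce : (c - e : MP k l) = C ((c : k) - e) := by simp
    rw [hce] at h4
    have h5 : X a ∣ e0 k (I.erase a) * u := by
      have hne : ((c : k) - e) ≠ 0 := by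
        rw [sub_ne_zero]; exact_mod_cast (by omega : c ≠ e)
      have := Dvd.dvd.mul_left h4 (C ((c : k) - e)⁻¹)
      rwa [← mul_assoc, ← MvPolynomial.C_mul, inv_mul_cancel₀ hne, MvPolynomial.C_1, one_mul] at this
    refine ((X_prime a).dvd_or_dvd h5).resolve_left ?_
    rw [e0, (X_prime a).dvd_finsetProd_iff]
    rintro ⟨b, hb, h⟩
    exact X_not_dvd_X (Finset.ne_of_mem_erase hb).symm h

lemma e0_pow_dvd {I : Finset (Fin l)} {p : MP k l} {c : ℕ} (h : ∀ a ∈ I, X a ^ c ∣ p) :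
    e0 k I ^ c ∣ p := by
  induction I using Finset.induction_on with
  | empty => simp [e0]
  | insert a I ha ih =>
    obtain ⟨u, rfl⟩ := ih fun b hb => h b (by simp [hb])
    rw [e0_insert ha, mul_pow, mul_comm]
    apply mul_dvd_mul_left
    refine (X_prime a).pow_dvd_of_dvd_mul_left c ?_ (h a (by simp))
    intro h
    have h2 := (X_prime a).dvd_of_dvd_pow h
    rw [e0, (X_prime a).dvd_finsetProd_iff] at h2
    obtain ⟨b, hb, h⟩ := h2
    exact X_not_dvd_X (by rintro rfl; exact ha hb) h

lemma nc_pred_zero {S J : Finset (Fin l)} {p : MP k l} (hp : PA S p) (hJ : J ⊆ S) :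
    TT k J (nc J (2 * J.card ^ 2) p) = 0 := by
  have hd : Disjoint (S \ J) J := Finset.sdiff_disjoint
  rcases Nat.eq_zero_or_pos (2 * J.card ^ 2) with h | h
  · rw [h]; exact nc_TT_J_zero J p
  · obtain ⟨N, hN⟩ : ∃ N, 2 * J.card ^ 2 = N + 1 := ⟨_, (Nat.succ_pred_eq_of_pos h).symm⟩
    rw [hN]
    have h1 : nc J N (TT k S p) = 0 := by rw [hp.tt, nc_zero]
    rw [← Finset.sdiff_union_of_subset hJ, TT_union hd, nc_add, nc_TT_I hd,
      hp.lo J hJ N (by omega), map_zero, zero_add, nc_TT_J] at h1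
    exact h1

lemma TT_I_p0 {S J : Finset (Fin l)} {p : MP k l} (hp : PA S p) (hJ : J ⊆ S) :
    e0 k (S \ J) * TT k (S \ J) (nc J (2 * J.card ^ 2) p) =
      ((4 * J.card : ℕ) : MP k l) * e1 k (S \ J) * nc J (2 * J.card ^ 2) p := by
  have hd : Disjoint (S \ J) J := Finset.sdiff_disjoint
  have h1 : nc J (2 * J.card ^ 2) (TT k S p) = 0 := by rw [hp.tt, nc_zero]
  rw [show TT k S p = TT k ((S \ J) ∪ J) p by rw [Finset.sdiff_union_of_subset hJ],
    TT_union hd, nc_add, nc_TT_I hd, nc_TT_J] at h1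
  have h2 := congrArg (TT k J) (hp.rel J hJ)
  have h4 : TT k J (4 : MP k l) = 0 := by
    rw [show (4 : MP k l) = C 4 from (map_ofNat C 4).symm, der_C]
  simp only [map_add, map_zero, Derivation.leibniz, smul_eq_mul, nc_pred_zero hp hJ, h4,
    TT_disj hd (pr_e0 _), TT_disj hd (pr_e1 _), TT_sg (subset_refl J)] at h2
  push_cast
  linear_combination e0 k (S \ J) * h1 - h2

lemma exists_B [CharZero k] {S J : Finset (Fin l)} {p : MP k l} (hp : PA S p) (hJ : J ⊆ S) :
    ∃ B, nc J (2 * J.card ^ 2) p = e0 k (S \ J) ^ (4 * J.card) * B := by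
  obtain ⟨B, hB⟩ := e0_pow_dvd (fun a ha => X_pow_dvd_of_rel (TT_I_p0 hp hJ) ha le_rfl)
  exact ⟨B, hB⟩

end H6

section H7

open MvPolynomial (X C mkDerivation)

variable {k : Type} [Field k] {l : ℕ}

lemma sc_four (J : Finset (Fin l)) : sc k J 4 = 4 := map_ofNat _ 4

lemma C_four : (Polynomial.C (4 : MP k l)) = 4 := map_ofNat _ 4

lemma C_mul' (c : k) : (C (4 * c) : MP k l) = 4 * C c := by
  rw [MvPolynomial.C_mul, map_ofNat C 4]

lemma nc_hmul0 {J : Finset (Fin l)} {h : MP k l}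
    (hh : sc k J h = Polynomial.C h) (N : ℕ) (p : MP k l) :
    nc J N (h * p) = h * nc J N p :=
  nc_hmul (d := 0) (by rw [hh, pow_zero, one_mul]) N p

lemma nc_hmul_low {S J : Finset (Fin l)} {p h : MP k l} {d : ℕ} (hp : PA S p) (hJ : J ⊆ S)
    (hh : sc k J h = Polynomial.X ^ (d + 1) * Polynomial.C h) (K : Finset (Fin l)) (M : ℕ) :
    nc J (2 * J.card ^ 2 + d) (h * nc K M p) = 0 := by
  rcases Nat.eq_zero_or_pos (2 * J.card ^ 2) with h0 | h0
  · rw [h0]; exact nc_hmul_lt hh (by omega) _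
  · obtain ⟨N, hN⟩ : ∃ N, 2 * J.card ^ 2 = N + 1 := ⟨_, (Nat.succ_pred_eq_of_pos h0).symm⟩
    rw [hN, show N + 1 + d = N + (d + 1) by ring, nc_hmul hh, nc_comm,
      hp.lo J hJ N (by omega), nc_zero, mul_zero]

lemma nc_self_zero (J : Finset (Fin l)) (p : MP k l) : nc ∅ 0 p = p := by
  have : sc k (∅ : Finset (Fin l)) p = Polynomial.C p :=
    sc_disj (I := Finset.univ) (by simp) (hom_eq_of_pr_univ p)
  simp [nc, this]
where
  hom_eq_of_pr_univ (p : MP k l) : pr k Finset.univ p = p := by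
    have : (pr k Finset.univ) = (AlgHom.id k (MP k l)) := by
      apply MvPolynomial.algHom_ext
      intro a; simp [pr_X]
    rw [this]; rfl

/-- `E_I p0` and `E_J p0` -/
lemma EE_I_p0 {S J : Finset (Fin l)} {p : MP k l} (hp : PA S p) (hJ : J ⊆ S) :
    EE k (S \ J) (nc J (2 * J.card ^ 2) p) =
      C (4 * ((S.card : k) - 2)) * sg k (S \ J) * nc J (2 * J.card ^ 2) p := by
  have hd : Disjoint (S \ J) J := Finset.sdiff_disjoint
  have h1 := congrArg (nc J (2 * J.card ^ 2)) hp.ee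
  rw [show EE k S p = EE k ((S \ J) ∪ J) p by rw [Finset.sdiff_union_of_subset hJ],
    show sg k S = sg k ((S \ J) ∪ J) by rw [Finset.sdiff_union_of_subset hJ],
    EE_union hd, sg_union hd, nc_add, nc_EE_I hd, mul_assoc, nc_Cmul, add_mul, nc_add,
    nc_hmul0 (sc_disj hd (pr_sg _))] at h1
  have h2 : nc J (2 * J.card ^ 2) (EE k J p) = 0 := by
    rcases Nat.eq_zero_or_pos (2 * J.card ^ 2) with h0 | h0
    · rw [h0]; exact nc_EE_J_zero J p
    · obtain ⟨N, hN⟩ : ∃ N, 2 * J.card ^ 2 = N + 1 := ⟨_, (Nat.succ_pred_eq_of_pos h0).symm⟩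
      rw [hN, nc_EE_J, hp.lo J hJ N (by omega), map_zero]
  have h3 : nc J (2 * J.card ^ 2) (sg k J * p) = 0 := by
    have := nc_hmul_low (d := 0) hp hJ (by rw [sc_sg (subset_refl J), zero_add, pow_one]) ∅ 0
    rwa [add_zero, nc_self_zero ∅] at this
  rw [h2, h3] at h1
  linear_combination h1

lemma EE_J_p0 {S J : Finset (Fin l)} {p : MP k l} (hp : PA S p) (hJ : J ⊆ S) :
    EE k J (nc J (2 * J.card ^ 2) p) =
      C (4 * ((J.card : k) - 2)) * sg k J * nc J (2 * J.card ^ 2) p := by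
  have hd : Disjoint (S \ J) J := Finset.sdiff_disjoint
  have h1 := congrArg (nc J (2 * J.card ^ 2 + 1)) hp.ee
  rw [show EE k S p = EE k ((S \ J) ∪ J) p by rw [Finset.sdiff_union_of_subset hJ],
    show sg k S = sg k ((S \ J) ∪ J) by rw [Finset.sdiff_union_of_subset hJ],
    EE_union hd, sg_union hd, nc_add, nc_EE_I hd, mul_assoc, nc_Cmul, add_mul, nc_add,
    nc_hmul0 (sc_disj hd (pr_sg _)), nc_EE_J,
    nc_hmul (d := 1) (by rw [sc_sg (subset_refl J), pow_one])] at h1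
  have h2 := congrArg (EE k (S \ J)) (hp.rel J hJ)
  have h4 : EE k (S \ J) (4 : MP k l) = 0 := by
    rw [show (4 : MP k l) = C 4 from (map_ofNat C 4).symm, der_C]
  simp only [map_add, map_zero, Derivation.leibniz, smul_eq_mul, EE_I_p0 hp hJ, h4,
    EE_disj hd.symm (pr_sg _), EE_e1 (subset_refl _), EE_e0 (subset_refl _)] at h2
  have h5 : (C (4 * ((J.card : k) - 2)) : MP k l) =
      C (4 * ((S.card : k) - 2)) - 4 * ((S \ J).card : MP k l) := by
    rw [show (4 : MP k l) * ((S \ J).card : MP k l) = C (4 * (((S \ J).card : ℕ) : k)) by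
        rw [C_mul', map_natCast],
      ← map_sub]
    congr 1
    have : (S.card : k) = (S \ J).card + J.card := by
      have := Finset.card_sdiff_add_card_eq_card hJ
      rw [← this]; push_cast; rfl
    rw [this]; ring
  rw [h5]
  apply mul_left_cancel₀ (e0_ne_zero (S \ J))
  linear_combination e0 k (S \ J) * h1 - h2 +
    (1 + C (4 * ((S.card : k) - 2))) * sg k (S \ J) * hp.rel J hJ

lemma PA_J {S J : Finset (Fin l)} {p B : MP k l} (hp : PA S p) (hJ : J ⊆ S)
    (hB : nc J (2 * J.card ^ 2) p = e0 k (S \ J) ^ (4 * J.card) * B) : PA J B := by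
  have hd : Disjoint (S \ J) J := Finset.sdiff_disjoint
  have hne : e0 k (S \ J) ^ (4 * J.card) ≠ 0 := pow_ne_zero _ (e0_ne_zero _)
  have hpr : pr k (S \ J) (e0 k (S \ J) ^ (4 * J.card)) = e0 k (S \ J) ^ (4 * J.card) := by
    rw [map_pow, pr_e0]
  have hsc := sc_disj hd hpr
  have hnc : ∀ J' ⊆ J, ∀ N, nc J' N (nc J (2 * J.card ^ 2) p) =
      e0 k (S \ J) ^ (4 * J.card) * nc J' N B := by
    intro J' hJ' N
    rw [hB, nc_hmul0 (sc_disj (Finset.disjoint_of_subset_right hJ' hd) hpr)]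
  refine ⟨?_, ?_, ?_, ?_, ?_⟩
  · have := nc_pred_zero hp hJ
    rw [hB, Derivation.leibniz, TT_disj hd hpr, smul_zero, add_zero, smul_eq_mul] at this
    exact (mul_eq_zero.1 this).resolve_left hne
  · have := EE_J_p0 hp hJ
    rw [hB, Derivation.leibniz, EE_disj hd hpr, smul_zero, add_zero, smul_eq_mul] at this
    apply mul_left_cancel₀ hne
    rw [this]; ring
  · have := nc_homog J p (2 * J.card ^ 2)
    rw [hB, map_mul, hsc, Polynomial.C_mul] at this
    apply mul_left_cancel₀ (Polynomial.C_ne_zero.2 hne)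
    linear_combination this
  · intro J' hJ' N hN
    have := hnc J' hJ' N
    rw [nc_comm, hp.lo J' (hJ'.trans hJ) N hN, nc_zero] at this
    exact (mul_eq_zero.1 this.symm).resolve_left hne
  · intro J' hJ'
    have hS : S \ J' = (S \ J) ∪ (J \ J') := by
      ext a; simp only [Finset.mem_sdiff, Finset.mem_union]
      constructor
      · rintro ⟨h1, h2⟩; by_cases a ∈ J <;> tauto
      · rintro (⟨h1, h2⟩ | ⟨h1, h2⟩)
        · exact ⟨h1, fun h => h2 (hJ' h)⟩
        · exact ⟨hJ h1, h2⟩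
    have hd2 : Disjoint (S \ J) (J \ J') := Finset.disjoint_of_subset_right Finset.sdiff_subset hd
    have h1 := congrArg (nc J (2 * J.card ^ 2 + (J \ J').card)) (hp.rel J' (hJ'.trans hJ))
    rw [nc_zero, nc_add, hS, e0_union hd2, e1_union hd2,
      show 4 * sg k J' * (e1 k (S \ J) * e0 k (J \ J') + e0 k (S \ J) * e1 k (J \ J')) *
        nc J' (2 * J'.card ^ 2) p = (4 * sg k J' * e0 k (S \ J) * e1 k (J \ J')) *
        nc J' (2 * J'.card ^ 2) p + (4 * sg k J' * e1 k (S \ J) * e0 k (J \ J')) *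
        nc J' (2 * J'.card ^ 2) p by ring, nc_add] at h1
    have s1 := sc_sg (k := k) hJ'
    have s2 := sc_disj hd (pr_e0 (k := k) _)
    have s3 := sc_disj hd (pr_e1 (k := k) _)
    have s4 := sc_e0 (k := k) (Finset.sdiff_subset (s := J) (t := J'))
    have s5 := sc_e1 (k := k) (Finset.sdiff_subset (s := J) (t := J'))
    have g1 : sc k J (e0 k (S \ J) * e0 k (J \ J')) =
        Polynomial.X ^ (J \ J').card * Polynomial.C (e0 k (S \ J) * e0 k (J \ J')) := by
      rw [map_mul, s2, s4, Polynomial.C_mul]; ring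
    have g2 : sc k J (4 * sg k J' * e0 k (S \ J) * e1 k (J \ J')) =
        Polynomial.X ^ (J \ J').card *
          Polynomial.C (4 * sg k J' * e0 k (S \ J) * e1 k (J \ J')) := by
      rw [map_mul, map_mul, map_mul, s2, s1, sc_four]
      simp only [Polynomial.C_mul, C_four]
      linear_combination 4 * Polynomial.C (sg k J') * Polynomial.C (e0 k (S \ J)) * s5
    have g3 : sc k J (4 * sg k J' * e1 k (S \ J) * e0 k (J \ J')) =
        Polynomial.X ^ ((J \ J').card + 1) *
          Polynomial.C (4 * sg k J' * e1 k (S \ J) * e0 k (J \ J')) := by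
      rw [map_mul, map_mul, map_mul, s3, s1, s4, sc_four]
      simp only [Polynomial.C_mul, C_four]
      ring
    rw [nc_hmul_low hp hJ g3, nc_hmul g1, nc_hmul g2, nc_comm, hnc J' hJ', nc_comm J,
      hnc J' hJ'] at h1
    apply mul_left_cancel₀ (mul_ne_zero hne (e0_ne_zero (S \ J)))
    linear_combination h1

lemma PA_I {S J : Finset (Fin l)} {p B : MP k l} (hp : PA S p) (hJ : J ⊆ S)
    (hB : nc J (2 * J.card ^ 2) p = e0 k (S \ J) ^ (4 * J.card) * B) : PA (S \ J) B := by
  have hd : Disjoint (S \ J) J := Finset.sdiff_disjoint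
  have hne : e0 k (S \ J) ^ (4 * J.card) ≠ 0 := pow_ne_zero _ (e0_ne_zero _)
  have hcard : S.card = (S \ J).card + J.card := by
      have := Finset.card_sdiff_add_card_eq_card hJ
      omega
  have hJhom := nc_homog J p (2 * J.card ^ 2)
  have hun : ∀ I' ⊆ S \ J, Polynomial.X ^ (4 * J.card) *
      sc k (I' ∪ J) (nc J (2 * J.card ^ 2) p) = Polynomial.X ^ (2 * J.card ^ 2) *
        sc k I' (nc J (2 * J.card ^ 2) p) := by
    intro I' hI'
    have := congrArg (Polynomial.eval₂RingHom (sc k I') Polynomial.X) hJhom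
    simp only [map_mul, map_pow, Polynomial.coe_eval₂RingHom, Polynomial.eval₂_X,
      Polynomial.eval₂_C] at this
    rw [sc_union (Finset.disjoint_of_subset_left hI' hd), this]
  have hsc0 : ∀ I' ⊆ S \ J, sc k I' (e0 k (S \ J)) =
      Polynomial.X ^ I'.card * Polynomial.C (e0 k (S \ J)) := by
    intro I' hI'
    have : S \ J = I' ∪ ((S \ J) \ I') := by rw [Finset.union_sdiff_of_subset hI']
    rw [this, e0_union Finset.disjoint_sdiff, map_mul, sc_e0 (subset_refl I'),
      sc_disj Finset.sdiff_disjoint (pr_e0 _), Polynomial.C_mul]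
    ring
  have hscp : ∀ I' ⊆ S \ J, sc k I' (e0 k (S \ J) ^ (4 * J.card)) =
      Polynomial.X ^ (I'.card * (4 * J.card)) * Polynomial.C (e0 k (S \ J) ^ (4 * J.card)) := by
    intro I' hI'
    rw [map_pow, hsc0 I' hI', mul_pow, ← pow_mul, Polynomial.C_pow]
  have hnc : ∀ I' ⊆ S \ J, ∀ N, e0 k (S \ J) ^ (4 * J.card) * nc I' N B =
      nc J (2 * J.card ^ 2) (nc (I' ∪ J) (N + I'.card * (4 * J.card) + 2 * J.card ^ 2) p) := by
    intro I' hI' N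
    have hc : (I' ∪ J).card = I'.card + J.card :=
      Finset.card_union_of_disjoint (Finset.disjoint_of_subset_left hI' hd)
    rw [nc_comm, ← nc_hmul (hscp I' hI'), ← hB]
    rw [nc, nc.eq_def (I' ∪ J)]
    rw [hc, show 4 * (I'.card + J.card) = 4 * I'.card + 4 * J.card by ring, pow_add, mul_assoc,
      hun I' hI', mul_left_comm (Polynomial.X ^ (4 * I'.card) : PP k l) (Polynomial.X ^ _), Polynomial.coeff_X_pow_mul]
  refine ⟨?_, ?_, ?_, ?_, ?_⟩
  · have := TT_I_p0 hp hJ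
    rw [hB, Derivation.leibniz, Derivation.leibniz_pow, TT_e0 (subset_refl _)] at this
    apply (mul_eq_zero.1 (_ : (e0 k (S \ J) * e0 k (S \ J) ^ (4 * J.card)) *
      TT k (S \ J) B = 0)).resolve_left (mul_ne_zero (e0_ne_zero _) hne)
    simp only [smul_eq_mul, nsmul_eq_mul] at this
    rcases Nat.eq_zero_or_pos (4 * J.card) with h0 | h0
    · rw [h0] at this ⊢
      simp at this ⊢; tauto
    · have h5 : e0 k (S \ J) ^ (4 * J.card) = e0 k (S \ J) * e0 k (S \ J) ^ (4 * J.card - 1) := by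
        rw [← pow_succ']; congr 1; omega
      rw [h5] at this ⊢
      linear_combination this
  · have := EE_I_p0 hp hJ
    have h2 : EE k (S \ J) (e0 k (S \ J) ^ (4 * J.card)) =
        (4 * J.card : ℕ) * sg k (S \ J) * e0 k (S \ J) ^ (4 * J.card) := by
      rw [Derivation.leibniz_pow, EE_e0 (subset_refl _)]
      simp only [smul_eq_mul, nsmul_eq_mul]
      rcases Nat.eq_zero_or_pos (4 * J.card) with h0 | h0
      · rw [h0]; simp
      · have h5 : e0 k (S \ J) ^ (4 * J.card) =
            e0 k (S \ J) * e0 k (S \ J) ^ (4 * J.card - 1) := by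
          rw [← pow_succ']; congr 1; omega
        rw [h5]; ring
    rw [hB, Derivation.leibniz, h2] at this
    simp only [smul_eq_mul] at this
    have h5 : (C (4 * (((S \ J).card : k) - 2)) : MP k l) =
        C (4 * ((S.card : k) - 2)) - ((4 * J.card : ℕ) : MP k l) := by
      rw [show ((4 * J.card : ℕ) : MP k l) = C (4 * ((J.card : ℕ) : k)) by
        rw [C_mul', map_natCast]; push_cast; rfl, ← map_sub, hcard]
      congr 1
      push_cast; ring
    rw [h5]
    apply mul_left_cancel₀ hne
    linear_combination this
  · have hS : Polynomial.X ^ (4 * S.card) * sc k S (nc J (2 * J.card ^ 2) p) =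
        Polynomial.X ^ (2 * S.card ^ 2) * Polynomial.C (nc J (2 * J.card ^ 2) p) := by
      rw [hom_iff]
      intro M
      rw [nc_comm, hom_iff.1 hp.hom M]
      split_ifs
      · rfl
      · exact nc_zero _ _
    have h2 := hun (S \ J) (subset_refl _)
    rw [Finset.sdiff_union_of_subset hJ] at h2
    rw [hB, map_mul, map_mul, hscp _ (subset_refl _)] at h2
    rw [hB, map_mul, Polynomial.C_mul] at hS
    rw [hcard] at hS
    apply mul_left_cancel₀ (Polynomial.C_ne_zero.2 hne)
    apply mul_left_cancel₀ (pow_ne_zero (4 * J.card + 2 * J.card ^ 2 +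
      (S \ J).card * (4 * J.card)) (Polynomial.X_ne_zero (R := MP k l)))
    have e1 : (Polynomial.X : PP k l) ^ (2 * ((S \ J).card + J.card) ^ 2) *
       Polynomial.X ^ (4 * J.card) = Polynomial.X ^ (4 * J.card + 2 * J.card ^ 2 +
      (S \ J).card * (4 * J.card)) * Polynomial.X ^ (2 * (S \ J).card ^ 2) := by
      rw [← pow_add, ← pow_add]; congr 1; ring
    simp only [pow_add, mul_add] at h2 hS e1 ⊢
    linear_combination Polynomial.X ^ (4 * J.card) * hS -
      Polynomial.X ^ (4 * (S \ J).card) * Polynomial.X ^ (4 * J.card) * h2 +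
      Polynomial.C (e0 k (S \ J) ^ (4 * J.card)) * Polynomial.C B * e1
  · intro I' hI' N hN
    have hc : (I' ∪ J).card = I'.card + J.card :=
      Finset.card_union_of_disjoint (Finset.disjoint_of_subset_left hI' hd)
    have := hnc I' hI' N
    rw [hp.lo (I' ∪ J) (Finset.union_subset (hI'.trans Finset.sdiff_subset) hJ) _
      (by rw [hc]; nlinarith), nc_zero] at this
    exact (mul_eq_zero.1 this).resolve_left hne
  · intro I' hI'
    have hd' := Finset.disjoint_of_subset_left hI' hd
    have hc : (I' ∪ J).card = I'.card + J.card :=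
      Finset.card_union_of_disjoint hd'
    have hS : S \ (I' ∪ J) = (S \ J) \ I' := by
      ext a; simp only [Finset.mem_sdiff, Finset.mem_union]; tauto
    have hd2 : Disjoint ((S \ J) \ I') J :=
      Finset.disjoint_of_subset_left Finset.sdiff_subset hd
    have h1 := congrArg (nc J (2 * J.card ^ 2))
      (hp.rel (I' ∪ J) (Finset.union_subset (hI'.trans Finset.sdiff_subset) hJ))
    rw [nc_zero, nc_add, hS, sg_union hd'] at h1
    rw [show 4 * (sg k I' + sg k J) * e1 k ((S \ J) \ I') * nc (I' ∪ J) (2 * (I' ∪ J).card ^ 2) p =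
      (4 * sg k I' * e1 k ((S \ J) \ I')) * nc (I' ∪ J) (2 * (I' ∪ J).card ^ 2) p +
      (4 * sg k J * e1 k ((S \ J) \ I')) * nc (I' ∪ J) (2 * (I' ∪ J).card ^ 2) p by ring,
      nc_add] at h1
    have s1 := sc_sg (k := k) (subset_refl J)
    have s2 := sc_disj hd2 (pr_e0 (k := k) _)
    have s3 := sc_disj hd2 (pr_e1 (k := k) _)
    have s4 := sc_disj hd' (pr_sg (k := k) _)
    have g1 : sc k J (4 * sg k I' * e1 k ((S \ J) \ I')) =
        Polynomial.C (4 * sg k I' * e1 k ((S \ J) \ I')) := by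
      rw [map_mul, map_mul, s3, s4, sc_four]; simp only [Polynomial.C_mul, C_four]
    have g2 : sc k J (4 * sg k J * e1 k ((S \ J) \ I')) = Polynomial.X ^ (0 + 1) *
        Polynomial.C (4 * sg k J * e1 k ((S \ J) \ I')) := by
      rw [map_mul, map_mul, s3, s1, sc_four]; simp only [Polynomial.C_mul, C_four]; ring
    have h3 := nc_hmul_low hp hJ g2 (I' ∪ J) (2 * (I' ∪ J).card ^ 2)
    rw [add_zero] at h3
    rw [h3, nc_hmul0 g1, nc_hmul0 s2,
      show 2 * (I' ∪ J).card ^ 2 + 1 = (2 * I'.card ^ 2 + 1) + I'.card * (4 * J.card) +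
        2 * J.card ^ 2 by rw [hc]; ring,
      show 2 * (I' ∪ J).card ^ 2 = (2 * I'.card ^ 2) + I'.card * (4 * J.card) +
        2 * J.card ^ 2 by rw [hc]; ring, ← hnc I' hI', ← hnc I' hI'] at h1
    apply mul_left_cancel₀ hne
    linear_combination h1

end H7

section H8

open MvPolynomial (X C mkDerivation)

variable {k : Type} [Field k] {l : ℕ}

/-- a coefficient map `f` commutes with `sc K` -/
lemma sc_map_comm {K : Finset (Fin l)} (f : MP k l →ₐ[k] MP k l)
    (h : ∀ a, sc k K (f (X a)) = Polynomial.map f.toRingHom (sc k K (X a))) (p : MP k l) :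
    sc k K (f p) = Polynomial.map f.toRingHom (sc k K p) := by
  have : (sc k K).comp f.toRingHom = (Polynomial.mapRingHom f.toRingHom).comp (sc k K) := by
    apply MvPolynomial.ringHom_ext
    · intro r
      have : f.toRingHom (C r) = C r := alg_C f r
      simp only [RingHom.comp_apply, sc_C, this, Polynomial.coe_mapRingHom, Polynomial.map_C]
    · intro a
      exact h a
  exact congrArg (fun g => g p) this

lemma nc_map_comm {K : Finset (Fin l)} (f : MP k l →ₐ[k] MP k l)
    (h : ∀ a, sc k K (f (X a)) = Polynomial.map f.toRingHom (sc k K (X a))) (N : ℕ) (p : MP k l) :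
    nc K N (f p) = f (nc K N p) := by
  rw [nc, nc, sc_map_comm f h]
  have : (f ((Polynomial.X ^ (4 * K.card) * sc k K p).coeff N)) =
      (Polynomial.map f.toRingHom (Polynomial.X ^ (4 * K.card) * sc k K p)).coeff N := by
    rw [Polynomial.coeff_map]; rfl
  rw [this]; simp only [Polynomial.map_mul, Polynomial.map_pow, Polynomial.map_X]

lemma nc_pr (S K : Finset (Fin l)) (N : ℕ) (p : MP k l) :
    nc K N (pr k S p) = pr k S (nc K N p) := by
  apply nc_map_comm
  intro a
  by_cases h1 : a ∈ S <;> by_cases h2 : a ∈ K <;> simp [pr_X, h1, h2, sc_X_mem, sc_X_not_mem]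

lemma B_sup {S J : Finset (Fin l)} {p B : MP k l} (hp : pr k S p = p)
    (hB : nc J (2 * J.card ^ 2) p = e0 k (S \ J) ^ (4 * J.card) * B) : pr k S B = B := by
  have hne : e0 k (S \ J) ^ (4 * J.card) ≠ 0 := pow_ne_zero _ (e0_ne_zero _)
  have h1 := nc_pr S J (2 * J.card ^ 2) p
  rw [hp, hB, map_mul, map_pow, pr_mono Finset.sdiff_subset (pr_e0 _)] at h1
  exact (mul_left_cancel₀ hne h1).symm

lemma sc_dd_pow_mem {J : Finset (Fin l)} {a b : Fin l} (h : a ∈ J) (hb : b ∈ J) (e : ℕ) :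
    sc k J (dd k a b ^ e) = Polynomial.X ^ e * Polynomial.C (dd k a b ^ e) := by
  rw [map_pow, sc_dd_mem h hb, mul_pow, Polynomial.C_pow]

lemma B_dvd {S J : Finset (Fin l)} {p B : MP k l}
    (hB : nc J (2 * J.card ^ 2) p = e0 k (S \ J) ^ (4 * J.card) * B) {s t : Fin l} (hst : s ≠ t)
    (h : (s ∈ J ∧ t ∈ J) ∨ (s ∉ J ∧ t ∉ J)) {e : ℕ} (hd : dd k s t ^ e ∣ p) :
    dd k s t ^ e ∣ B := by
  have h1 : dd k s t ^ e ∣ nc J (2 * J.card ^ 2) p := by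
    obtain ⟨u, rfl⟩ := hd
    rcases h with h | h
    · have hs := sc_dd_pow_mem (k := k) h.1 h.2 e
      by_cases hN : 2 * J.card ^ 2 < e
      · rw [nc_hmul_lt hs hN]; simp
      · obtain ⟨N, hN⟩ := Nat.exists_eq_add_of_le (not_lt.1 hN)
        rw [hN, add_comm, nc_hmul hs]; exact dvd_mul_right _ _
    · rw [nc_hmul0 (by rw [map_pow, sc_dd_not_mem h.1 h.2, Polynomial.C_pow])]
      exact dvd_mul_right _ _
  rw [hB] at h1
  refine (dd_prime hst).pow_dvd_of_dvd_mul_left e ?_ h1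
  intro h
  have h2 := (dd_prime hst).dvd_of_dvd_pow h
  rw [e0, (dd_prime hst).dvd_finsetProd_iff] at h2
  obtain ⟨b, hb, h⟩ := h2
  exact dd_not_dvd_X h

/-! symmetric lemma -/

def ph (k : Type) [Field k] {l : ℕ} (I : Finset (Fin l)) (a0 : Fin l) : MP k l →ₐ[k] PP k l :=
  MvPolynomial.aeval (fun a => if a ∈ I then Polynomial.C (X a0) +
    Polynomial.X * Polynomial.C (dd k a a0) else Polynomial.C (X a))

lemma ph_X (I : Finset (Fin l)) (a0 a : Fin l) : ph k I a0 (X a) =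
    if a ∈ I then Polynomial.C (X a0) +
    Polynomial.X * Polynomial.C (dd k a a0) else Polynomial.C (X a) := by
  simp [ph]

lemma ph_C (I : Finset (Fin l)) (a0 : Fin l) (c : k) : ph k I a0 (C c) = Polynomial.C (C c) := by
  rw [ph, MvPolynomial.aeval_C]; rfl

lemma ph_eq [CharZero k] {I S : Finset (Fin l)} (hI : I ⊆ S) {a0 : Fin l} (ha : a0 ∈ I)
    {p : MP k l} (hp : TT k S p = 0) :
    ph k I a0 p = Polynomial.map (tau k S a0).toRingHom (sc k I p) := by
  have : (ph k I a0).toRingHom.comp (tau k S a0).toRingHom =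
      (Polynomial.mapRingHom (tau k S a0).toRingHom).comp (sc k I) := by
    apply MvPolynomial.ringHom_ext
    · intro r
      have h1 : (tau k S a0).toRingHom (C r) = C r := alg_C _ r
      have h2 : (ph k I a0).toRingHom (C r) = Polynomial.C (C r) := ph_C _ _ _
      simp only [RingHom.comp_apply, sc_C, h1, h2, Polynomial.coe_mapRingHom, Polynomial.map_C]
    · intro a
      simp only [RingHom.comp_apply, Polynomial.coe_mapRingHom, AlgHom.toRingHom_eq_coe,
        RingHom.coe_coe, tau_X]
      by_cases h1 : a ∈ I
      · have h2 := hI h1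
        simp [h1, h2, ph_X, ha, sc_X_mem, tau_X, dd]; ring
      · by_cases h2 : a ∈ S <;> simp [h1, h2, ph_X, ha, sc_X_not_mem, tau_X, dd]
  have h := congrArg (fun g => g p) this
  simp only [RingHom.comp_apply, AlgHom.toRingHom_eq_coe, RingHom.coe_coe, tau_eq hp] at h
  exact h

lemma ph_comm {I J : Finset (Fin l)} (hd : Disjoint I J) {a0 : Fin l} (ha : a0 ∈ I)
    (p : MP k l) (m n : ℕ) :
    (ph k I a0 ((sc k J p).coeff n)).coeff m = (sc k J ((ph k I a0 p).coeff m)).coeff n := by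
  refine coeff_comm (f := (ph k I a0).toRingHom) (ph_C I a0) (sc_C J) (fun a m n => ?_) p m n
  have h0 : a0 ∉ J := Finset.disjoint_left.1 hd ha
  by_cases h1 : a ∈ I
  · have h2 : a ∉ J := Finset.disjoint_left.1 hd h1
    rw [sc_X_not_mem h2, Polynomial.coeff_C]
    have h3 : ∀ m, sc k J (((ph k I a0).toRingHom (X a)).coeff m) =
        Polynomial.C (((ph k I a0).toRingHom (X a)).coeff m) := by
      intro m
      simp only [AlgHom.toRingHom_eq_coe, RingHom.coe_coe, ph_X, h1, if_true, Polynomial.coeff_add,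
        coeff_X_mul_C', Polynomial.coeff_C]
      split_ifs <;> simp [sc_X_not_mem h0, sc_dd_not_mem h2 h0]
    rw [h3, Polynomial.coeff_C]
    split_ifs <;> simp
  · have h3 : (ph k I a0).toRingHom (X a) = Polynomial.C (X a) := by
      simp [ph_X, h1]
    rw [h3, Polynomial.coeff_C]
    by_cases h2 : a ∈ J
    · rw [sc_X_mem h2, coeff_X_mul_C']
      split_ifs with h4 h5 h5
      · rw [h3, sc_X_mem h2, coeff_X_mul_C', if_pos h4, h5, Polynomial.coeff_C_zero]
      · rw [h3, Polynomial.coeff_C, if_neg h5]; simp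
      · rw [sc_X_mem h2, coeff_X_mul_C', if_neg h4]; simp
      · simp
    · rw [sc_X_not_mem h2, Polynomial.coeff_C]
      split_ifs with h4 h5 h5
      · rw [h3, sc_X_not_mem h2, h4, h5, Polynomial.coeff_C_zero]
      · rw [h3, Polynomial.coeff_C, if_neg h5]; simp
      · rw [sc_X_not_mem h2, Polynomial.coeff_C, if_neg h4]; simp
      · simp

lemma sym_lemma [CharZero k] {S J : Finset (Fin l)} {p : MP k l} (hp : PA S p) (hJ : J ⊆ S)
    (h0 : nc (S \ J) (2 * (S \ J).card ^ 2) p = 0) : nc J (2 * J.card ^ 2) p = 0 := by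
  have hd : Disjoint (S \ J) J := Finset.sdiff_disjoint
  rcases (S \ J).eq_empty_or_nonempty with hI | ⟨a0, ha⟩
  · rw [hI] at h0
    have : p = 0 := by simpa [nc_self_zero ∅] using h0
    rw [this, nc_zero]
  obtain ⟨B, hB⟩ := exists_B hp hJ
  have hBI := PA_I hp hJ hB
  have hIS : S \ J ⊆ S := Finset.sdiff_subset
  set I := S \ J with hIdef
  set r := I.card with hr
  have h1 : (Polynomial.X : PP k l) ^ (2 * r ^ 2 + 1) ∣ Polynomial.X ^ (4 * r) * sc k I p := by
    rw [Polynomial.X_pow_dvd_iff]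
    intro N hN
    rcases Nat.lt_succ_iff_lt_or_eq.1 hN with h | h
    · exact hp.lo I hIS N h
    · rw [h]; exact h0
  have h2 : (Polynomial.X : PP k l) ^ (2 * r ^ 2 + 1) ∣ Polynomial.X ^ (4 * r) * ph k I a0 p := by
    rw [ph_eq hIS ha hp.tt]
    have := (Polynomial.mapRingHom (tau k S a0).toRingHom).map_dvd h1
    simpa using this
  have h3 : (Polynomial.X : PP k l) ^ (2 * r ^ 2 + 1) ∣ Polynomial.X ^ (4 * r) *
      ph k I a0 (nc J (2 * J.card ^ 2) p) := by
    rw [Polynomial.X_pow_dvd_iff] at h2 ⊢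
    intro N hN
    have h4 := h2 N hN
    rw [Polynomial.coeff_X_pow_mul'] at h4 ⊢
    split_ifs with h5
    · rw [if_pos h5] at h4
      rw [nc_eq]
      split_ifs
      · rw [ph_comm hd ha, h4]; simp
      · simp
    · rfl
  rw [hB, map_mul] at h3
  have h6 : ¬ (Polynomial.X : PP k l) ∣ ph k I a0 (e0 k I ^ (4 * J.card)) := by
    rw [map_pow]
    apply not_X_dvd_pow
    rw [e0, map_prod, PX_prime.dvd_finsetProd_iff]
    rintro ⟨b, hb, h⟩
    rw [ph_X, if_pos hb, Polynomial.X_dvd_iff] at h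
    simp at h
  have h7 := xcancel h6 h3 (le_refl _)
  rw [ph_eq (subset_refl I) ha hBI.tt] at h7
  have h8 : Polynomial.X ^ (4 * r) * Polynomial.map (tau k I a0).toRingHom (sc k I B) =
      Polynomial.map (tau k I a0).toRingHom (Polynomial.X ^ (4 * r) * sc k I B) := by simp
  rw [h8, hBI.hom] at h7
  simp only [Polynomial.map_mul, Polynomial.map_pow, Polynomial.map_X, Polynomial.map_C] at h7
  have h9 : (tau k I a0).toRingHom B = B := tau_eq hBI.tt a0
  rw [h9, Polynomial.X_pow_dvd_iff] at h7
  have h10 := h7 (2 * r ^ 2) (Nat.lt_succ_self _)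
  rw [← hr, Polynomial.coeff_X_pow_mul', if_pos le_rfl, Nat.sub_self, Polynomial.coeff_C_zero] at h10
  rw [hB, h10, mul_zero]

end H8

section H9

open MvPolynomial (X C mkDerivation)

variable {k : Type} [Field k] {l : ℕ}

structure RR (x : MP k l) (P : PP k l) (d : ℕ) (y : MP k l) : Prop where
  lo : ∀ N < d, P.coeff N = 0
  rel : x * P.coeff (d + 1) + y * P.coeff d = 0

lemma coeff_mul_lead {P Q : PP k l} {d e : ℕ} (hP : ∀ N < d, P.coeff N = 0)
    (hQ : ∀ N < e, Q.coeff N = 0) : (∀ N < d + e, (P * Q).coeff N = 0) ∧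
    (P * Q).coeff (d + e) = P.coeff d * Q.coeff e ∧
    (P * Q).coeff (d + e + 1) = P.coeff (d + 1) * Q.coeff e + P.coeff d * Q.coeff (e + 1) := by
  obtain ⟨P, rfl⟩ := Polynomial.X_pow_dvd_iff.2 hP
  obtain ⟨Q, rfl⟩ := Polynomial.X_pow_dvd_iff.2 hQ
  have h : Polynomial.X ^ d * P * (Polynomial.X ^ e * Q) = Polynomial.X ^ (d + e) * (P * Q) := by
    ring
  have h1 : ∀ (P : PP k l) d, (Polynomial.X ^ d * P).coeff d = P.coeff 0 := by
    intro P d; simpa using Polynomial.coeff_X_pow_mul P d 0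
  have h2 : ∀ (P : PP k l) d, (Polynomial.X ^ d * P).coeff (d + 1) = P.coeff 1 := by
    intro P d; rw [add_comm]; exact Polynomial.coeff_X_pow_mul P d 1
  rw [h]
  refine ⟨fun N hN => ?_, ?_, ?_⟩
  · rw [Polynomial.coeff_X_pow_mul', if_neg (by omega)]
  · rw [h1, h1, h1, Polynomial.mul_coeff_zero]
  · rw [h2, h1, h1, h2, h2, Polynomial.mul_coeff_one]; ring

lemma RR.mul {x : MP k l} {P Q : PP k l} {d e : ℕ} {y z : MP k l} (hP : RR x P d y)
    (hQ : RR x Q e z) : RR x (P * Q) (d + e) (y + z) := by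
  obtain ⟨h1, h2, h3⟩ := coeff_mul_lead hP.lo hQ.lo
  refine ⟨h1, ?_⟩
  rw [h2, h3]
  linear_combination Q.coeff e * hP.rel + P.coeff d * hQ.rel

lemma RR.one (x : MP k l) : RR x (1 : PP k l) 0 0 :=
  ⟨fun N h => by omega, by simp [Polynomial.coeff_one]⟩

lemma RR.prod {ι : Type} {x : MP k l} {B : Finset ι} {P : ι → PP k l} {d : ι → ℕ} {y : ι → MP k l}
    (h : ∀ b ∈ B, RR x (P b) (d b) (y b)) :
    RR x (∏ b ∈ B, P b) (∑ b ∈ B, d b) (∑ b ∈ B, y b) := by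
  induction B using Finset.induction_on with
  | empty => simpa using RR.one x
  | insert b B hb ih =>
    rw [Finset.prod_insert hb, Finset.sum_insert hb, Finset.sum_insert hb]
    exact (h b (by simp)).mul (ih fun c hc => h c (by simp [hc]))

lemma RR.pow {x : MP k l} {P : PP k l} {d : ℕ} {y : MP k l} (hP : RR x P d y) (n : ℕ) :
    RR x (P ^ n) (n * d) (n * y) := by
  have := RR.prod (B := Finset.range n) (fun b _ => hP)
  simpa using this

def Z (k : Type) [Field k] {l : ℕ} (K : Finset (Fin l)) (a : Fin l) : MP k l :=
  if a ∈ K then X a else 0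
def E (k : Type) [Field k] {l : ℕ} (S K : Finset (Fin l)) (b : Fin l) : MP k l :=
  if b ∈ K then 0 else e0 k ((S \ K).erase b)

lemma mul_E {S K : Finset (Fin l)} {b : Fin l} (hb : b ∈ S) (hK : b ∉ K) :
    X b * E k S K b = e0 k (S \ K) := by
  rw [E, if_neg hK, ← e0_insert (by simp), Finset.insert_erase (by simp [hb, hK])]

lemma RR_dd {S K : Finset (Fin l)} {a b : Fin l} (ha : a ∈ S) (hb : b ∈ S) :
    RR (e0 k (S \ K)) (sc k K (dd k a b)) (if a ∈ K ∧ b ∈ K then 1 else 0)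
      (Z k K a * E k S K b + Z k K b * E k S K a) := by
  by_cases h1 : a ∈ K <;> by_cases h2 : b ∈ K
  · rw [sc_dd_mem h1 h2, if_pos ⟨h1, h2⟩]
    refine ⟨fun N hN => ?_, ?_⟩
    · rw [coeff_X_mul_C', if_neg (by omega)]
    · rw [coeff_X_mul_C', if_neg (by omega)]; simp [E, h1, h2]
  · rw [if_neg (by tauto)]
    refine ⟨fun N hN => by omega, ?_⟩
    rw [dd, map_sub, sc_X_mem h1, sc_X_not_mem h2, ← mul_E hb h2]
    simp [Z, h1, h2, Polynomial.coeff_C]; ring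
  · rw [if_neg (by tauto)]
    refine ⟨fun N hN => by omega, ?_⟩
    rw [dd, map_sub, sc_X_mem h2, sc_X_not_mem h1, ← mul_E ha h1]
    simp [Z, h1, h2, Polynomial.coeff_C]; ring
  · rw [if_neg (by tauto), sc_dd_not_mem h1 h2]
    refine ⟨fun N hN => by omega, ?_⟩
    simp [Z, h1, h2, Polynomial.coeff_C]

def Cr (k : Type) [Field k] {l : ℕ} (I J : Finset (Fin l)) : MP k l :=
  ∏ a ∈ I, ∏ b ∈ J, dd k a b ^ 4

lemma sum_Z (I K : Finset (Fin l)) : ∑ a ∈ I, Z k K a = sg k (K ∩ I) := by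
  simp only [Z]
  rw [← Finset.sum_filter, sg, Finset.filter_mem_eq_inter, Finset.inter_comm]

lemma sum_E {I J : Finset (Fin l)} (hd : Disjoint I J) (K : Finset (Fin l)) :
    ∑ b ∈ I, E k (I ∪ J) K b = e1 k (I \ K) * e0 k (J \ K) := by
  have h1 : ∑ b ∈ I, E k (I ∪ J) K b = ∑ b ∈ I \ K, e0 k (((I ∪ J) \ K).erase b) := by
    rw [Finset.sdiff_eq_filter, Finset.sum_filter]
    refine Finset.sum_congr rfl fun b _ => ?_
    simp only [E]; split_ifs <;> simp_all [Finset.sdiff_eq_filter]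
  rw [h1, e1, Finset.sum_mul]
  refine Finset.sum_congr rfl fun b hb => ?_
  have hb' : b ∈ I ∧ b ∉ K := by simpa using hb
  have hbJ : b ∉ J := Finset.disjoint_left.1 hd hb'.1
  rw [show ((I ∪ J) \ K).erase b = (I \ K).erase b ∪ (J \ K) by
    ext a
    simp only [Finset.mem_erase, Finset.mem_sdiff, Finset.mem_union]
    by_cases hab : a = b
    · subst hab; tauto
    · tauto, e0_union, e0]
  apply Finset.disjoint_of_subset_left ((Finset.erase_subset _ _).trans Finset.sdiff_subset)
  exact Finset.disjoint_of_subset_right Finset.sdiff_subset hd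

lemma sum_ite_and (I J K : Finset (Fin l)) (c : ℕ) :
    ∑ a ∈ I, ∑ b ∈ J, c * (if a ∈ K ∧ b ∈ K then 1 else 0) = c * ((K ∩ I).card * (K ∩ J).card) := by
  have : ∀ a b, (if a ∈ K ∧ b ∈ K then 1 else 0) = (if a ∈ K then 1 else 0) *
      (if b ∈ K then 1 else 0) := by
    intro a b; split_ifs <;> simp_all
  simp only [this, ← Finset.mul_sum, ← Finset.sum_mul, Finset.sum_boole]
  rw [Finset.filter_mem_eq_inter, Finset.filter_mem_eq_inter, Finset.inter_comm, Finset.inter_comm J]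
  simp

lemma RR_Cr {I J K : Finset (Fin l)} :
    RR (e0 k ((I ∪ J) \ K)) (sc k K (Cr k I J)) (4 * ((K ∩ I).card * (K ∩ J).card))
      (4 * (sg k (K ∩ I) * (∑ b ∈ J, E k (I ∪ J) K b) +
        sg k (K ∩ J) * (∑ b ∈ I, E k (I ∪ J) K b))) := by
  have := RR.prod (B := I) (x := e0 k ((I ∪ J) \ K)) (fun a (ha : a ∈ I) =>
    RR.prod (B := J) (fun b (hb : b ∈ J) => (RR_dd (k := k) (K := K)
      (Finset.mem_union_left J ha) (Finset.mem_union_right I hb)).pow 4))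
  rw [sum_ite_and] at this
  convert this using 1
  · rw [Cr]; simp only [map_prod, map_pow]
  · rw [← sum_Z, ← sum_Z, Finset.sum_mul_sum, Finset.sum_mul_sum,
      Finset.sum_comm (s := J), ← Finset.sum_add_distrib, Finset.mul_sum]
    refine Finset.sum_congr rfl fun a _ => ?_
    rw [← Finset.sum_add_distrib, Finset.mul_sum]
    refine Finset.sum_congr rfl fun b _ => ?_
    push_cast; rfl

lemma RR_PA {I J K : Finset (Fin l)} {u : MP k l} (hd : Disjoint I J) (hu : PA I u) :
    RR (e0 k ((I ∪ J) \ K)) (Polynomial.X ^ (4 * (K ∩ I).card) * sc k (K ∩ I) u)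
      (2 * (K ∩ I).card ^ 2) (4 * sg k (K ∩ I) * ∑ b ∈ I, E k (I ∪ J) K b) := by
  refine ⟨fun N hN => hu.lo (K ∩ I) Finset.inter_subset_right N hN, ?_⟩
  have h1 := hu.rel (K ∩ I) Finset.inter_subset_right
  rw [show I \ (K ∩ I) = I \ K by ext; simp] at h1
  rw [sum_E hd, Finset.union_sdiff_distrib, e0_union (Finset.disjoint_of_subset_left
    Finset.sdiff_subset (Finset.disjoint_of_subset_right Finset.sdiff_subset hd))]
  simp only [nc] at h1
  linear_combination e0 k (J \ K) * h1

/-- polynomial admissible with support -/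
def PAdm (S : Finset (Fin l)) (p : MP k l) : Prop := pr k S p = p ∧ PA S p

lemma sc_split {I J K : Finset (Fin l)} (hK : K ⊆ I ∪ J) (hd : Disjoint I J) {u v : MP k l}
    (hu : pr k I u = u) (hv : pr k J v = v) :
    Polynomial.X ^ (4 * K.card) * sc k K (u * v * Cr k I J) =
    (Polynomial.X ^ (4 * (K ∩ I).card) * sc k (K ∩ I) u) *
      (Polynomial.X ^ (4 * (K ∩ J).card) * sc k (K ∩ J) v) * sc k K (Cr k I J) ∧
    K.card = (K ∩ I).card + (K ∩ J).card := by
  have hc : K.card = (K ∩ I).card + (K ∩ J).card := by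
    rw [← Finset.card_union_of_disjoint, ← Finset.inter_union_distrib_left,
      Finset.inter_eq_left.2 hK]
    exact Finset.disjoint_of_subset_left Finset.inter_subset_right
      (Finset.disjoint_of_subset_right Finset.inter_subset_right hd)
  refine ⟨?_, hc⟩
  rw [map_mul, map_mul, sc_of_pr (J' := K ∩ I) (fun a ha => by simp [ha]) hu,
    sc_of_pr (J' := K ∩ J) (fun a ha => by simp [ha]) hv]
  generalize sc k (K ∩ I) u = s
  generalize sc k (K ∩ J) v = t
  rw [hc, mul_add, pow_add]; ring

lemma PAdm.prod {I J : Finset (Fin l)} {u v : MP k l} (hd : Disjoint I J) (hu : PAdm I u)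
    (hv : PAdm J v) : PAdm (I ∪ J) (u * v * Cr k I J) := by
  have hI : I ⊆ I ∪ J := Finset.subset_union_left
  have hJ : J ⊆ I ∪ J := Finset.subset_union_right
  have hcard : (I ∪ J).card = I.card + J.card := Finset.card_union_of_disjoint hd
  have key : ∀ K ⊆ I ∪ J, RR (e0 k ((I ∪ J) \ K))
      (Polynomial.X ^ (4 * K.card) * sc k K (u * v * Cr k I J)) (2 * K.card ^ 2)
      (4 * sg k K * e1 k ((I ∪ J) \ K)) := by
    intro K hK
    obtain ⟨h1, h2⟩ := sc_split hK hd hu.1 hv.1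
    have r1 := RR_PA (K := K) hd hu.2
    have r2 := RR_PA (K := K) hd.symm hv.2
    rw [Finset.union_comm J I] at r2
    have r3 := (r1.mul r2).mul (RR_Cr (k := k) (I := I) (J := J) (K := K))
    rw [h1]
    have hd' : Disjoint (K ∩ I) (K ∩ J) := Finset.disjoint_of_subset_left Finset.inter_subset_right
      (Finset.disjoint_of_subset_right Finset.inter_subset_right hd)
    have e : sg k K = sg k (K ∩ I) + sg k (K ∩ J) := by
      rw [← sg_union hd', ← Finset.inter_union_distrib_left, Finset.inter_eq_left.2 hK]
    have e' : e1 k ((I ∪ J) \ K) = (∑ b ∈ I, E k (I ∪ J) K b) + ∑ b ∈ J, E k (I ∪ J) K b := by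
      rw [sum_E hd, Finset.union_comm I J, sum_E hd.symm, Finset.union_comm J I,
        Finset.union_sdiff_distrib, e1_union (Finset.disjoint_of_subset_left
    Finset.sdiff_subset (Finset.disjoint_of_subset_right Finset.sdiff_subset hd))]
      ring
    convert r3 using 1
    · rw [h2]; ring
    · rw [e, e']; ring
  have hpr : pr k (I ∪ J) (Cr k I J) = Cr k I J := by
    rw [Cr]; simp only [map_prod, map_pow]
    exact Finset.prod_congr rfl fun a ha => Finset.prod_congr rfl fun b hb => by
      rw [pr_dd (hI ha) (hJ hb)]
  refine ⟨?_, ?_, ?_, ?_, ?_, ?_⟩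
  · rw [map_mul, map_mul, pr_mono hI hu.1, pr_mono hJ hv.1, hpr]
  · have h1 : TT k (I ∪ J) u = 0 * u := by rw [TT_eq_of_pr hI hu.1, hu.2.tt, zero_mul]
    have h2 : TT k (I ∪ J) v = 0 * v := by rw [TT_eq_of_pr hJ hv.1, hv.2.tt, zero_mul]
    have h3 : TT k (I ∪ J) (Cr k I J) = (∑ a ∈ I, ∑ b ∈ J, ((4 : ℕ) : MP k l) * 0) * (Cr k I J) :=
      der_prod fun a ha => der_prod fun b hb => der_pow (by rw [TT_dd (hI ha) (hJ hb), zero_mul]) 4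
    rw [der_mul (der_mul h1 h2) h3]; simp
  · have h1 : EE k (I ∪ J) u = (C (4 * ((I.card : k) - 2)) * sg k I) * u := by
      rw [EE_eq_of_pr hI hu.1]; exact hu.2.ee
    have h2 : EE k (I ∪ J) v = (C (4 * ((J.card : k) - 2)) * sg k J) * v := by
      rw [EE_eq_of_pr hJ hv.1]; exact hv.2.ee
    have h3 : EE k (I ∪ J) (Cr k I J) = (∑ a ∈ I, ∑ b ∈ J, ((4 : ℕ) : MP k l) * (X a + X b)) *
        (Cr k I J) :=
      der_prod fun a ha => der_prod fun b hb => der_pow (by rw [EE_dd (hI ha) (hJ hb)]) 4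
    rw [der_mul (der_mul h1 h2) h3]
    congr 1
    have h4 : (∑ a ∈ I, ∑ b ∈ J, ((4 : ℕ) : MP k l) * (X a + X b)) =
        4 * ((J.card : MP k l) * sg k I + (I.card : MP k l) * sg k J) := by
      simp only [← Finset.mul_sum, Finset.sum_add_distrib, Finset.sum_const, nsmul_eq_mul, sg]
      push_cast; rfl
    rw [h4, sg_union hd, hcard, C_mul', C_mul', C_mul']
    simp only [map_sub, map_natCast]
    push_cast
    ring
  · have h1 : sc k (I ∪ J) u = sc k I u := sc_of_pr (fun a ha => by simp [ha]) hu.1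
    have h2 : sc k (I ∪ J) v = sc k J v := sc_of_pr (fun a ha => by simp [ha]) hv.1
    have h3 : sc k (I ∪ J) (Cr k I J) = Polynomial.X ^ (4 * (I.card * J.card)) *
        Polynomial.C (Cr k I J) := by
      rw [Cr]
      simp only [map_prod]
      rw [show (Polynomial.X : PP k l) ^ (4 * (I.card * J.card)) =
        ∏ a ∈ I, ∏ b ∈ J, Polynomial.X ^ 4 by
          simp only [Finset.prod_const]; rw [← pow_mul, ← pow_mul]; congr 1; ring,
        ← Finset.prod_mul_distrib]
      refine Finset.prod_congr rfl fun a ha => ?_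
      rw [← Finset.prod_mul_distrib]
      refine Finset.prod_congr rfl fun b hb => ?_
      exact sc_dd_pow_mem (hI ha) (hJ hb) 4
    have h4 := hu.2.hom
    have h5 := hv.2.hom
    rw [map_mul, map_mul, h1, h2, h3, hcard, Polynomial.C_mul, Polynomial.C_mul]
    have e1 : (Polynomial.X : PP k l) ^ (2 * (I.card + J.card) ^ 2) =
      Polynomial.X ^ (2 * I.card ^ 2) * Polynomial.X ^ (2 * J.card ^ 2) *
        Polynomial.X ^ (4 * (I.card * J.card)) := by
      rw [← pow_add, ← pow_add]; congr 1; ring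
    rw [e1, mul_add, pow_add]
    generalize sc k I u = s at *
    generalize sc k J v = t at *
    generalize (Polynomial.X : PP k l) ^ (4 * (I.card * J.card)) = w
    generalize Polynomial.C (Cr k I J) = w'
    linear_combination w * w' * (Polynomial.X ^ (4 * J.card) * t * h4 +
      Polynomial.X ^ (2 * I.card ^ 2) * Polynomial.C u * h5)
  · intro K hK N hN
    exact (key K hK).lo N hN
  · intro K hK
    exact (key K hK).rel

lemma lead_prod {I J K : Finset (Fin l)} (hK : K ⊆ I ∪ J) (hd : Disjoint I J) {u v : MP k l}
    (hu : PAdm I u) (hv : PAdm J v) : nc K (2 * K.card ^ 2) (u * v * Cr k I J) =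
      nc (K ∩ I) (2 * (K ∩ I).card ^ 2) u * nc (K ∩ J) (2 * (K ∩ J).card ^ 2) v *
        (sc k K (Cr k I J)).coeff (4 * ((K ∩ I).card * (K ∩ J).card)) := by
  obtain ⟨h1, h2⟩ := sc_split hK hd hu.1 hv.1
  have r1 := RR_PA (K := K) hd hu.2
  have r2 := RR_PA (K := K) hd.symm hv.2
  have r3 := RR_Cr (k := k) (I := I) (J := J) (K := K)
  rw [nc, h1, h2, show 2 * ((K ∩ I).card + (K ∩ J).card) ^ 2 = 2 * (K ∩ I).card ^ 2 +
    2 * (K ∩ J).card ^ 2 + 4 * ((K ∩ I).card * (K ∩ J).card) by ring,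
    (coeff_mul_lead (coeff_mul_lead r1.lo r2.lo).1 r3.lo).2.1, (coeff_mul_lead r1.lo r2.lo).2.1]
  rfl

lemma lead_J {I J : Finset (Fin l)} (hd : Disjoint I J) {u v : MP k l}
    (hu : PAdm I u) (hv : PAdm J v) : nc J (2 * J.card ^ 2) (u * v * Cr k I J) =
      e0 k I ^ (4 * J.card) * (u * v) := by
  rw [lead_prod Finset.subset_union_right hd hu hv, Finset.disjoint_iff_inter_eq_empty.1 hd.symm,
    Finset.inter_self]
  simp only [Finset.card_empty, ne_eq, OfNat.ofNat_ne_zero, not_false_eq_true, zero_pow, mul_zero,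
    zero_mul, nc_self_zero ∅]
  rw [hom_iff.1 hv.2.hom, if_pos rfl]
  have : (sc k J (Cr k I J)).coeff 0 = e0 k I ^ (4 * J.card) := by
    rw [Cr, ← Polynomial.constantCoeff_apply]
    simp only [map_prod, map_pow]
    rw [e0, ← Finset.prod_pow]
    refine Finset.prod_congr rfl fun a ha => ?_
    rw [pow_mul, ← Finset.prod_const]
    refine Finset.prod_congr rfl fun b hb => ?_
    rw [dd, map_sub, sc_X_mem hb, sc_X_not_mem (Finset.disjoint_left.1 hd ha)]
    simp
  rw [this]; ring

end H9

section H10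

open MvPolynomial (X C mkDerivation)

variable {k : Type} [Field k] {l : ℕ}

def ev (k : Type) [Field k] {l : ℕ} (J : Finset (Fin l)) (y : Fin l → k) : MP k l →ₐ[k] MP k l :=
  MvPolynomial.aeval (fun a => if a ∈ J then C (y a) else X a)

lemma ev_X (J : Finset (Fin l)) (y : Fin l → k) (a : Fin l) :
    ev k J y (X a) = if a ∈ J then C (y a) else X a := by
  simp [ev]

lemma ev_of_pr {I J : Finset (Fin l)} (hd : Disjoint I J) (y : Fin l → k) {p : MP k l}
    (hp : pr k I p = p) : ev k J y p = p := by
  have := hom_eq_of_pr (f := (ev k J y).toRingHom) (g := RingHom.id _) (S := I)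
    (fun c => by simp) (fun a ha => by simp [ev_X, Finset.disjoint_left.1 hd ha]) hp
  simpa using this

lemma ev_pr {I J : Finset (Fin l)} (hd : Disjoint I J) (y : Fin l → k) {p : MP k l}
    (hp : pr k (I ∪ J) p = p) : pr k I (ev k J y p) = ev k J y p := by
  have := hom_eq_of_pr (f := (pr k I).toRingHom.comp (ev k J y).toRingHom)
    (g := (ev k J y).toRingHom) (S := I ∪ J)
    (fun c => by simp) (fun a ha => by
      simp only [RingHom.comp_apply, AlgHom.toRingHom_eq_coe, RingHom.coe_coe, ev_X]
      by_cases h : a ∈ J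
      · simp [h]
      · have : a ∈ I := by simpa [h] using ha
        simp [h, pr_X, this]) hp
  simpa using this

lemma ev_ev {I J : Finset (Fin l)} (hd : Disjoint I J) (x y : Fin l → k) {p : MP k l}
    (hp : pr k (I ∪ J) p = p) :
    ev k I x (ev k J y p) = C (MvPolynomial.eval (J.piecewise y x) p) := by
  have := hom_eq_of_pr (f := (ev k I x).toRingHom.comp (ev k J y).toRingHom)
    (g := (C (σ := Fin l)).comp (MvPolynomial.eval (J.piecewise y x))) (S := I ∪ J)
    (fun c => by simp) (fun a ha => by
      simp only [RingHom.comp_apply, AlgHom.toRingHom_eq_coe, RingHom.coe_coe, ev_X]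
      by_cases h : a ∈ J
      · simp [h]
      · have : a ∈ I := by simpa [h] using ha
        simp [h, ev_X, this]) hp
  simpa using this

lemma ev_nc {J K : Finset (Fin l)} (hd : Disjoint K J) (y : Fin l → k) (N : ℕ) (p : MP k l) :
    nc K N (ev k J y p) = ev k J y (nc K N p) := by
  apply nc_map_comm
  intro a
  by_cases h1 : a ∈ K
  · have := Finset.disjoint_left.1 hd h1
    simp [ev_X, h1, this, sc_X_mem]
  · by_cases h2 : a ∈ J <;> simp [ev_X, h1, h2, sc_X_not_mem, sc_C]

lemma PA_ev {I J : Finset (Fin l)} (hd : Disjoint I J) (y : Fin l → k) {p : MP k l}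
    (hp : PA I p) : PA I (ev k J y p) := by
  have hT : ev k J y (TT k I p) = TT k I (ev k J y p) := by
    apply der_hom
    intro a
    by_cases h1 : a ∈ J
    · have := Finset.disjoint_right.1 hd h1
      simp [ev_X, h1, this, TT_X]
    · rw [ev_X, if_neg h1, TT_X]; split_ifs <;> simp
  have hE : ev k J y (EE k I p) = EE k I (ev k J y p) := by
    apply der_hom
    intro a
    by_cases h1 : a ∈ J
    · have := Finset.disjoint_right.1 hd h1
      simp [ev_X, h1, this, EE_X]
    · rw [ev_X, if_neg h1, EE_X]; split_ifs <;> simp [ev_X, h1]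
  have hn : ∀ K ⊆ I, ∀ N, nc K N (ev k J y p) = ev k J y (nc K N p) :=
    fun K hK N => ev_nc (Finset.disjoint_of_subset_left hK hd) y N p
  refine ⟨?_, ?_, ?_, ?_, ?_⟩
  · rw [← hT, hp.tt, map_zero]
  · rw [← hE, hp.ee, map_mul, map_mul, alg_C, ev_of_pr hd y (pr_sg I)]
  · rw [hom_iff]
    intro M
    rw [hn I (subset_refl I), hom_iff.1 hp.hom]
    split_ifs <;> simp
  · intro K hK N hN
    rw [hn K hK, hp.lo K hK N hN, map_zero]
  · intro K hK
    have h1 := congrArg (ev k J y) (hp.rel K hK)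
    have h4 : ev k J y 4 = 4 := map_ofNat _ 4
    have hs : I \ K ⊆ I := Finset.sdiff_subset
    rw [map_zero, map_add, map_mul, map_mul, map_mul, map_mul, h4,
      ev_of_pr hd y (pr_mono hs (pr_e0 _)),
      ev_of_pr hd y (pr_mono hs (pr_e1 _)), ev_of_pr hd y (pr_mono hK (pr_sg _)),
      ← hn K hK, ← hn K hK] at h1
    exact h1

lemma ev_dd_dvd {J : Finset (Fin l)} (y : Fin l → k) {s t : Fin l} (hs : s ∉ J) (ht : t ∉ J)
    {e : ℕ} {p : MP k l} (h : dd k s t ^ e ∣ p) : dd k s t ^ e ∣ ev k J y p := by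
  have := map_dvd (ev k J y) h
  rw [map_pow] at this
  have h2 : ev k J y (dd k s t) = dd k s t := by simp [dd, ev_X, hs, ht]
  rwa [h2] at this

def FF (J : Finset (Fin l)) (B : MP k l) : Submodule k (MP k l) :=
  Submodule.span k (Set.range fun y => ev k J y B)

instance FF_fin (J : Finset (Fin l)) (B : MP k l) : FiniteDimensional k (FF J B) := by
  let G : Submodule k (MP k l) := Submodule.span k
    ((B.support.image fun m => ev k J 1 (MvPolynomial.monomial m 1) : Finset (MP k l)) : Set (MP k l))
  have hG : FiniteDimensional k G := FiniteDimensional.span_finset k _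
  have hle : FF J B ≤ G := by
    rw [FF, Submodule.span_le]
    rintro _ ⟨y, rfl⟩
    show ev k J y B ∈ G
    rw [B.as_sum, map_sum]
    refine Submodule.sum_mem _ fun m hm => ?_
    have h1 : ev k J y (MvPolynomial.monomial m (B.coeff m)) =
        (B.coeff m * ∏ a ∈ J, y a ^ m a) • ev k J 1 (MvPolynomial.monomial m 1) := by
      have h2 : ∀ (y : Fin l → k) c, ev k J y (MvPolynomial.monomial m c) = C c *
          ((∏ a ∈ J, C (y a) ^ m a) * ∏ a ∈ Finset.univ \ J, X a ^ m a) := by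
        intro y c
        rw [MvPolynomial.monomial_eq, map_mul, alg_C, Finsupp.prod_fintype _ _ (by simp), map_prod,
          ← Finset.prod_sdiff (Finset.subset_univ J), mul_comm (∏ a ∈ J, C (y a) ^ m a)]
        congr 2
        · refine Finset.prod_congr rfl fun a ha => ?_
          rw [map_pow, ev_X, if_neg (by simpa using ha)]
        · refine Finset.prod_congr rfl fun a ha => ?_
          rw [map_pow, ev_X, if_pos ha]
      rw [h2, h2, MvPolynomial.smul_eq_C_mul]
      simp only [Pi.one_apply, map_one, one_pow, Finset.prod_const_one, MvPolynomial.C_mul, map_prod,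
        map_pow]
      ring
    rw [h1]
    apply Submodule.smul_mem
    apply Submodule.subset_span
    simp only [Finset.coe_image]
    exact ⟨m, hm, rfl⟩
  exact Submodule.finiteDimensional_of_le hle

lemma factor [CharZero k] {I J : Finset (Fin l)} (hd : Disjoint I J) (U V : Submodule k (MP k l))
    (n : ℕ) : ∀ B : MP k l, Module.finrank k (FF J B) < n → pr k (I ∪ J) B = B →
    (∀ y, ev k J y B ∈ U) → (∀ x, ev k I x B ∈ V) → B ∈ U * V := by
  induction n with
  | zero => intro B h; omega
  | succ n ih =>
    intro B hn hB hU hV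
    by_cases h0 : B = 0
    · rw [h0]; exact zero_mem _
    obtain ⟨z, hz⟩ : ∃ z, MvPolynomial.eval z B ≠ 0 := by
      by_contra! h
      exact h0 (MvPolynomial.funext fun z => by rw [h z, map_zero])
    have hBs : pr k (J ∪ I) B = B := by rw [Finset.union_comm]; exact hB
    set c := MvPolynomial.eval z B with hc
    set B1 := B - C c⁻¹ * (ev k J z B * ev k I z B) with hB1
    have hJ := fun y => ev_pr hd y hB
    have hI := fun y => ev_pr hd.symm y hBs
    have hev : ∀ y, ev k J y B1 = ev k J y B -
        (c⁻¹ * MvPolynomial.eval (I.piecewise z y) B) • ev k J z B := by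
      intro y
      rw [hB1, map_sub, map_mul, map_mul, alg_C, ev_of_pr hd y (hJ z), ev_ev hd.symm y z hBs,
        MvPolynomial.smul_eq_C_mul, MvPolynomial.C_mul]
      ring
    have hev' : ∀ x, ev k I x B1 = ev k I x B -
        (c⁻¹ * MvPolynomial.eval (J.piecewise z x) B) • ev k I z B := by
      intro x
      rw [hB1, map_sub, map_mul, map_mul, alg_C, ev_of_pr hd.symm x (hI z), ev_ev hd x z hB,
        MvPolynomial.smul_eq_C_mul, MvPolynomial.C_mul]
      ring
    have hle : FF J B1 < FF J B := by
      refine lt_of_le_of_ne ?_ ?_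
      · rw [FF, Submodule.span_le]
        rintro _ ⟨y, rfl⟩
        show ev k J y B1 ∈ FF J B
        rw [hev]
        exact sub_mem (Submodule.subset_span ⟨y, rfl⟩)
          (Submodule.smul_mem _ _ (Submodule.subset_span ⟨z, rfl⟩))
      · intro heq
        have h1 : FF J B1 ≤ LinearMap.ker (ev k I z).toLinearMap := by
          rw [FF, Submodule.span_le]
          rintro _ ⟨y, rfl⟩
          show ev k I z (ev k J y B1) = 0
          rw [hev, map_sub, map_smul, ev_ev hd z y hB, ev_ev hd z z hB, MvPolynomial.smul_eq_C_mul,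
            Finset.piecewise_same, ← hc, ← MvPolynomial.C_mul, ← map_sub]
          have : MvPolynomial.eval (I.piecewise z y) B = MvPolynomial.eval (J.piecewise y z) B := by
            have := hom_eq_of_pr (f := MvPolynomial.eval (I.piecewise z y))
              (g := MvPolynomial.eval (J.piecewise y z)) (S := I ∪ J) (fun c => by simp)
              (fun a ha => by
                by_cases h : a ∈ J
                · simp [h, Finset.disjoint_right.1 hd h]
                · have : a ∈ I := by simpa [h] using ha
                  simp [h, this]) hB
            exact this
          rw [this, mul_right_comm, inv_mul_cancel₀ hz, one_mul, sub_self, map_zero]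
        have h2 : ev k J z B ∈ FF J B1 := by rw [heq]; exact Submodule.subset_span ⟨z, rfl⟩
        have h3 : ev k I z (ev k J z B) = 0 := h1 h2
        rw [ev_ev hd z z hB, Finset.piecewise_same, MvPolynomial.C_eq_zero] at h3
        exact hz h3
    have hlt := Submodule.finrank_lt_finrank_of_lt hle
    have hsup : pr k (I ∪ J) B1 = B1 := by
      rw [hB1, map_sub, map_mul, map_mul, alg_C, hB, pr_mono Finset.subset_union_left (hJ z),
        pr_mono Finset.subset_union_right (hI z)]
    have h5 := ih B1 (by omega) hsup (fun y => by rw [hev]; exact sub_mem (hU y) (U.smul_mem _ (hU z)))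
      (fun x => by rw [hev']; exact sub_mem (hV x) (V.smul_mem _ (hV z)))
    have h6 : B = B1 + c⁻¹ • (ev k J z B * ev k I z B) := by
      rw [hB1, MvPolynomial.smul_eq_C_mul]; ring
    rw [h6]
    exact add_mem h5 (Submodule.smul_mem _ _ (Submodule.mul_mem_mul (hU z) (hV z)))

def UU (S : Finset (Fin l)) (Dv : Fin l → Fin l → ℕ → Prop) (Q : Finset (Fin l) → Prop) :
    Submodule k (MP k l) where
  carrier := {b | PAdm S b ∧ (∀ s ∈ S, ∀ t ∈ S, s ≠ t → ∀ e, Dv s t e → dd k s t ^ e ∣ b) ∧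
    ∀ K ⊆ S, Q K → nc K (2 * K.card ^ 2) b = 0}
  add_mem' := by
    rintro a b ⟨h1, h2, h3⟩ ⟨h1', h2', h3'⟩
    refine ⟨⟨by rw [map_add, h1.1, h1'.1], h1.2.add h1'.2⟩, fun s hs t ht hst e he =>
      dvd_add (h2 s hs t ht hst e he) (h2' s hs t ht hst e he), fun K hK hQ => ?_⟩
    rw [nc_add, h3 K hK hQ, h3' K hK hQ, add_zero]
  zero_mem' := ⟨⟨map_zero _, PA.zero S⟩, fun s _ t _ _ e _ => dvd_zero _, fun K _ _ => nc_zero _ _⟩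
  smul_mem' := by
    rintro c b ⟨h1, h2, h3⟩
    rw [MvPolynomial.smul_eq_C_mul]
    refine ⟨⟨by rw [map_mul, alg_C, h1.1], h1.2.smul c⟩, fun s hs t ht hst e he =>
      (h2 s hs t ht hst e he).mul_left _, fun K hK hQ => ?_⟩
    rw [nc_Cmul, h3 K hK hQ, mul_zero]

lemma mem_UU {S : Finset (Fin l)} {Dv : Fin l → Fin l → ℕ → Prop} {Q : Finset (Fin l) → Prop}
    {b : MP k l} : b ∈ UU S Dv Q ↔ PAdm S b ∧
      (∀ s ∈ S, ∀ t ∈ S, s ≠ t → ∀ e, Dv s t e → dd k s t ^ e ∣ b) ∧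
    ∀ K ⊆ S, Q K → nc K (2 * K.card ^ 2) b = 0 := Iff.rfl

lemma B_mem [CharZero k] {S J : Finset (Fin l)} {p B : MP k l} (hp : PAdm S p) (hJ : J ⊆ S)
    {Dv : Fin l → Fin l → ℕ → Prop}
    (hD : ∀ s ∈ S, ∀ t ∈ S, s ≠ t → ∀ e, Dv s t e → dd k s t ^ e ∣ p) {Q : Finset (Fin l) → Prop}
    (hQ : ∀ K ⊆ J, Q K → nc K (2 * K.card ^ 2) p = 0)
    (hB : nc J (2 * J.card ^ 2) p = e0 k (S \ J) ^ (4 * J.card) * B) :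
    B ∈ (UU (S \ J) Dv (fun _ => False) : Submodule k (MP k l)) * UU J Dv Q := by
  have hd : Disjoint (S \ J) J := Finset.sdiff_disjoint
  have hSU : (S \ J) ∪ J = S := Finset.sdiff_union_of_subset hJ
  have hsup : pr k ((S \ J) ∪ J) B = B := by rw [hSU]; exact B_sup hp.1 hB
  have hsup' : pr k (J ∪ (S \ J)) B = B := by rw [Finset.union_comm]; exact hsup
  refine factor hd _ _ _ B (Nat.lt_succ_self _) hsup (fun y => ?_) (fun x => ?_)
  · refine ⟨⟨ev_pr hd y hsup, PA_ev hd y (PA_I hp.2 hJ hB)⟩, fun s hs t ht hst e he => ?_,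
      fun K _ h => h.elim⟩
    rw [Finset.mem_sdiff] at hs ht
    exact ev_dd_dvd y hs.2 ht.2 (B_dvd hB hst (Or.inr ⟨hs.2, ht.2⟩) (hD s hs.1 t ht.1 hst e he))
  · refine ⟨⟨ev_pr hd.symm x hsup', PA_ev hd.symm x (PA_J hp.2 hJ hB)⟩, fun s hs t ht hst e he => ?_,
      fun K hK h => ?_⟩
    · exact ev_dd_dvd x (Finset.disjoint_right.1 hd hs) (Finset.disjoint_right.1 hd ht)
        (B_dvd hB hst (Or.inl ⟨hs, ht⟩) (hD s (hJ hs) t (hJ ht) hst e he))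
    · have h1 : nc K (2 * K.card ^ 2) (nc J (2 * J.card ^ 2) p) = 0 := by
        rw [nc_comm, hQ K hK h, nc_zero]
      have hpr : pr k (S \ J) (e0 k (S \ J) ^ (4 * J.card)) = e0 k (S \ J) ^ (4 * J.card) := by
        rw [map_pow, pr_e0]
      have hdK := Finset.disjoint_of_subset_right hK hd
      rw [hB, nc_hmul0 (sc_disj hdK hpr)] at h1
      rw [ev_nc hdK.symm,
        (mul_eq_zero.1 h1).resolve_left (pow_ne_zero _ (e0_ne_zero _)), map_zero]

end H10

section H11

open MvPolynomial (X C mkDerivation)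

variable {k : Type} [Field k] {l : ℕ}

abbrev VV (J : Finset (Fin l)) (i : Fin l) (Dv : Fin l → Fin l → ℕ → Prop) : Submodule k (MP k l) :=
  UU J Dv (fun K => i ∈ K ∧ K ≠ J)

def GB (S : Finset (Fin l)) (i : Fin l) (Dv : Fin l → Fin l → ℕ → Prop) : Set (MP k l) :=
  {x | ∃ J ⊆ S, i ∈ J ∧ ∃ u ∈ (UU (S \ J) Dv (fun _ => False) : Submodule k (MP k l)),
    ∃ v ∈ (VV J i Dv : Submodule k (MP k l)), x = u * v * Cr k (S \ J) J}

lemma dvd_Cr {I J : Finset (Fin l)} {s t : Fin l} (hs : s ∈ I) (ht : t ∈ J) :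
    dd k s t ^ 4 ∣ Cr k I J :=
  (Finset.dvd_prod_of_mem (fun b => dd k s b ^ 4) ht).trans
    (Finset.dvd_prod_of_mem (fun a => ∏ b ∈ J, dd k a b ^ 4) hs)

lemma dvd_Cr' {I J : Finset (Fin l)} {s t : Fin l} (hs : s ∈ I) (ht : t ∈ J) :
    dd k t s ^ 4 ∣ Cr k I J := by
  have := dvd_Cr (k := k) hs ht
  rw [dd_swap t s, Even.neg_pow (by decide)] at this
  exact this

lemma mul_Cr_mem {S J : Finset (Fin l)} {Dv : Fin l → Fin l → ℕ → Prop}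
    (hDv : ∀ s t e, Dv s t e → e ≤ 4) (hJ : J ⊆ S) {Q Q' : Finset (Fin l) → Prop}
    {u v : MP k l} (hu : u ∈ (UU (S \ J) Dv Q' : Submodule k (MP k l)))
    (hv : v ∈ (UU J Dv Q : Submodule k (MP k l))) :
    u * v * Cr k (S \ J) J ∈ (UU S Dv (fun _ => False) : Submodule k (MP k l)) := by
  have hd : Disjoint (S \ J) J := Finset.sdiff_disjoint
  have hSU : (S \ J) ∪ J = S := Finset.sdiff_union_of_subset hJ
  rw [mem_UU] at hu hv ⊢
  refine ⟨?_, ?_, fun _ _ h => h.elim⟩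
  · have := PAdm.prod hd hu.1 hv.1
    rwa [hSU] at this
  · intro s hs t ht hst e he
    by_cases h1 : s ∈ J <;> by_cases h2 : t ∈ J
    · exact ((hv.2.1 s h1 t h2 hst e he).mul_left _).mul_right _
    · exact ((pow_dvd_pow _ (hDv s t e he)).trans
        (dvd_Cr' (Finset.mem_sdiff.2 ⟨ht, h2⟩) h1)).mul_left _
    · exact ((pow_dvd_pow _ (hDv s t e he)).trans
        (dvd_Cr (Finset.mem_sdiff.2 ⟨hs, h1⟩) h2)).mul_left _
    · exact ((hu.2.1 s (Finset.mem_sdiff.2 ⟨hs, h1⟩) t (Finset.mem_sdiff.2 ⟨ht, h2⟩)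
        hst e he).mul_right _).mul_right _

lemma GB_UU {S : Finset (Fin l)} {i : Fin l} {Dv : Fin l → Fin l → ℕ → Prop}
    (hDv : ∀ s t e, Dv s t e → e ≤ 4) {x : MP k l} (hx : x ∈ AddSubmonoid.closure (GB S i Dv)) :
    x ∈ (UU S Dv (fun _ => False) : Submodule k (MP k l)) := by
  induction hx using AddSubmonoid.closure_induction with
  | mem x h =>
    obtain ⟨J, hJ, _, u, hu, v, hv, rfl⟩ := h
    exact mul_Cr_mem hDv hJ hu hv
  | zero => exact zero_mem _
  | add x y _ _ hx hy => exact add_mem hx hy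

lemma GB_step {S J : Finset (Fin l)} {i : Fin l} {Dv : Fin l → Fin l → ℕ → Prop}
    (hJ : J ⊆ S) (hi : i ∈ J) {B : MP k l}
    (hB : B ∈ (UU (S \ J) Dv (fun _ => False) : Submodule k (MP k l)) * VV J i Dv) :
    B * Cr k (S \ J) J ∈ AddSubmonoid.closure (GB S i Dv) ∧
    nc J (2 * J.card ^ 2) (B * Cr k (S \ J) J) = e0 k (S \ J) ^ (4 * J.card) * B ∧
    ∀ J' ⊆ S, i ∈ J' → J'.card ≤ J.card → J' ≠ J →
      nc J' (2 * J'.card ^ 2) (B * Cr k (S \ J) J) = 0 := by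
  have hd : Disjoint (S \ J) J := Finset.sdiff_disjoint
  have hSU : (S \ J) ∪ J = S := Finset.sdiff_union_of_subset hJ
  induction hB using Submodule.mul_induction_on' with
  | mem_mul_mem u hu v hv =>
    refine ⟨AddSubmonoid.subset_closure ⟨J, hJ, hi, u, hu, v, hv, rfl⟩,
      lead_J hd (mem_UU.1 hu).1 (mem_UU.1 hv).1, fun J' hJ' hi' hc hne => ?_⟩
    rw [lead_prod (by rwa [hSU]) hd (mem_UU.1 hu).1 (mem_UU.1 hv).1,
      (mem_UU.1 hv).2.2 (J' ∩ J) Finset.inter_subset_right ⟨Finset.mem_inter.2 ⟨hi', hi⟩, fun h => ?_⟩]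
    · simp
    · exact hne (Finset.eq_of_subset_of_card_le (Finset.inter_eq_right.1 h) hc).symm
  | add x _ y _ hx hy =>
    rw [add_mul]
    refine ⟨add_mem hx.1 hy.1, by rw [nc_add, hx.2.1, hy.2.1]; ring, fun J' a b c d => ?_⟩
    rw [nc_add, hx.2.2 J' a b c d, hy.2.2 J' a b c d, add_zero]

lemma thmB [CharZero k] {S : Finset (Fin l)} {i : Fin l} (hi : i ∈ S)
    {Dv : Fin l → Fin l → ℕ → Prop}
    (hDv : ∀ s t e, Dv s t e → e ≤ 4) (m : ℕ) : ∀ c, c + m = S.card + 1 → ∀ p : MP k l,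
    p ∈ (UU S Dv (fun _ => False) : Submodule k (MP k l)) →
    (∀ J ⊆ S, i ∈ J → J.card < c → nc J (2 * J.card ^ 2) p = 0) →
    p ∈ AddSubmonoid.closure (GB S i Dv) := by
  induction m with
  | zero =>
    intro c hc p hp h
    have h1 := h S (subset_refl _) hi (by omega)
    rw [hom_iff.1 (mem_UU.1 hp).1.2.hom, if_pos rfl] at h1
    rw [h1]; exact zero_mem _
  | succ m ih =>
    intro c hc p hp h
    have hp' := mem_UU.1 hp
    have hex : ∀ J, ∃ B, J ⊆ S → nc J (2 * J.card ^ 2) p = e0 k (S \ J) ^ (4 * J.card) * B := by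
      intro J
      by_cases hJ : J ⊆ S
      · obtain ⟨B, hB⟩ := exists_B hp'.1.2 hJ
        exact ⟨B, fun _ => hB⟩
      · exact ⟨0, fun h => (hJ h).elim⟩
    choose B hB using hex
    set F := S.powerset.filter (fun J => i ∈ J ∧ J.card = c) with hF
    have hFm : ∀ J ∈ F, J ⊆ S ∧ i ∈ J ∧ J.card = c := fun J hJ => by
      rw [hF, Finset.mem_filter, Finset.mem_powerset] at hJ; exact hJ
    have hst := fun J (hJ : J ∈ F) => GB_step (hFm J hJ).1 (hFm J hJ).2.1
      (B_mem (Q := fun K => i ∈ K ∧ K ≠ J) hp'.1 (hFm J hJ).1 hp'.2.1 (fun K hK hQ =>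
        h K (hK.trans (hFm J hJ).1) hQ.1 (by
          rw [← (hFm J hJ).2.2]
          exact Finset.card_lt_card (lt_of_le_of_ne hK hQ.2))) (hB J (hFm J hJ).1))
    set R := ∑ J ∈ F, B J * Cr k (S \ J) J with hR
    have hRm : R ∈ AddSubmonoid.closure (GB S i Dv) := sum_mem fun J hJ => (hst J hJ).1
    have h1 := ih (c + 1) (by omega) (p - R) (sub_mem hp (GB_UU hDv hRm)) (by
      intro J hJ hiJ hcJ
      have hsub : nc J (2 * J.card ^ 2) (p - R) =
          nc J (2 * J.card ^ 2) p - ∑ K ∈ F, nc J (2 * J.card ^ 2) (B K * Cr k (S \ K) K) := by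
        rw [← nc_sum, ← hR, eq_sub_iff_add_eq, ← nc_add, sub_add_cancel]
      rw [hsub]
      by_cases hJF : J ∈ F
      · rw [Finset.sum_eq_single_of_mem J hJF (fun K hK hne =>
          (hst K hK).2.2 J hJ hiJ (by rw [(hFm K hK).2.2]; omega) hne.symm), (hst J hJF).2.1,
          hB J hJ, sub_self]
      · have hcl : J.card < c := by
          refine lt_of_le_of_ne (by omega) fun hh => hJF ?_
          rw [hF, Finset.mem_filter, Finset.mem_powerset]
          exact ⟨hJ, hiJ, hh⟩
        rw [Finset.sum_eq_zero (fun K hK => (hst K hK).2.2 J hJ hiJ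
          (by rw [(hFm K hK).2.2]; omega) (fun hh => hJF (hh ▸ hK))), h J hJ hiJ hcl, sub_zero])
    have := add_mem h1 hRm
    rwa [sub_add_cancel] at this

end H11

section H12

open MvPolynomial (X C mkDerivation)

variable {k : Type} [Field k] {l : ℕ}

def W (k : Type) [Field k] {l : ℕ} (S : Finset (Fin l)) : MP k l := ∏ x ∈ S.offDiag, dd k x.1 x.2

lemma W_ne_zero (S : Finset (Fin l)) : W k S ≠ 0 :=
  Finset.prod_ne_zero_iff.2 fun _ hx => dd_ne_zero (Finset.mem_offDiag.1 hx).2.2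

lemma pr_W (S : Finset (Fin l)) : pr k S (W k S) = W k S := by
  rw [W, map_prod]
  exact Finset.prod_congr rfl fun x hx =>
    pr_dd (Finset.mem_offDiag.1 hx).1 (Finset.mem_offDiag.1 hx).2.1

lemma sum_offDiag {M : Type} [AddCommGroup M] (S : Finset (Fin l)) (f : Fin l → Fin l → M) :
    ∑ x ∈ S.offDiag, f x.1 x.2 = (∑ a ∈ S, ∑ b ∈ S, f a b) - ∑ a ∈ S, f a a := by
  have h1 : ∑ x ∈ S.diag, f x.1 x.2 = ∑ a ∈ S, f a a := by
    simp
  rw [← Finset.sum_product', ← Finset.diag_union_offDiag, Finset.sum_union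
    (Finset.disjoint_diag_offDiag S), h1, add_sub_cancel_left]

lemma TT_W (S : Finset (Fin l)) : TT k S (W k S) = 0 := by
  have := der_prod (d := TT k S) (B := S.offDiag) (f := fun x => dd k x.1 x.2) (u := fun _ => 0)
    (fun x hx => by
      rw [TT_dd (Finset.mem_offDiag.1 hx).1 (Finset.mem_offDiag.1 hx).2.1, zero_mul])
  rw [Finset.sum_const_zero, zero_mul] at this
  exact this

lemma EE_W (S : Finset (Fin l)) : EE k S (W k S) = (C (2 * ((S.card : k) - 1)) * sg k S) * W k S := by
  have := der_prod (d := EE k S) (B := S.offDiag) (f := fun x => dd k x.1 x.2)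
    (u := fun x => X x.1 + X x.2)
    (fun x hx => by
      rw [EE_dd (Finset.mem_offDiag.1 hx).1 (Finset.mem_offDiag.1 hx).2.1])
  rw [sum_offDiag S (fun a b => (X a + X b : MP k l))] at this
  rw [W, this]
  congr 1
  simp only [Finset.sum_add_distrib, Finset.sum_const, ← Finset.smul_sum]; simp only [sg]
  simp only [nsmul_eq_mul, MvPolynomial.C_mul, map_sub, map_one, map_ofNat, map_natCast]
  ring

lemma offDiag_ite (S K : Finset (Fin l)) (hK : K ⊆ S) :
    ∑ x ∈ S.offDiag, (if x.1 ∈ K ∧ x.2 ∈ K then 1 else 0) = K.card * K.card - K.card := by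
  rw [Finset.sum_boole, ← Finset.offDiag_card]
  simp only [Nat.cast_id]
  congr 1
  ext x
  simp only [Finset.mem_filter, Finset.mem_offDiag]
  constructor
  · rintro ⟨⟨_, _, h⟩, h1, h2⟩; exact ⟨h1, h2, h⟩
  · rintro ⟨h1, h2, h⟩; exact ⟨⟨hK h1, hK h2, h⟩, h1, h2⟩

lemma RR_W {S K : Finset (Fin l)} (hK : K ⊆ S) : RR (e0 k (S \ K)) (sc k K (W k S))
    (K.card * K.card - K.card) (2 * sg k K * e1 k (S \ K)) := by
  have := RR.prod (B := S.offDiag) (x := e0 k (S \ K)) (fun x hx =>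
    RR_dd (k := k) (K := K) (Finset.mem_offDiag.1 hx).1 (Finset.mem_offDiag.1 hx).2.1)
  rw [offDiag_ite S K hK, sum_offDiag S (fun a b => (Z k K a * E k S K b + Z k K b * E k S K a))]
    at this
  have h0 : ∀ a, Z k K a * E k S K a = 0 := fun a => by
    by_cases h : a ∈ K <;> simp [Z, E, h]
  have hE := sum_E (k := k) (I := S) (J := ∅) (by simp) K
  rw [Finset.union_empty, Finset.empty_sdiff, show e0 k (∅ : Finset (Fin l)) = 1 by simp [e0],
    mul_one] at hE
  convert this using 1
  · rw [W, map_prod]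
  · simp only [h0, add_zero, Finset.sum_const_zero, sub_zero, Finset.sum_add_distrib]
    rw [Finset.sum_comm (f := fun a b => Z k K b * E k S K a), ← Finset.sum_mul_sum, ]
    rw [sum_Z, hE, Finset.inter_eq_left.2 hK]
    ring

lemma sc_W {S K : Finset (Fin l)} (hK : K ⊆ S) : ∃ R : PP k l, ¬ Polynomial.X ∣ R ∧
    sc k K (W k S) = Polynomial.X ^ (K.card * K.card - K.card) * R := by
  have : ∀ B ⊆ S.offDiag, ∃ R : PP k l, ¬ Polynomial.X ∣ R ∧
      sc k K (∏ x ∈ B, dd k x.1 x.2) =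
        Polynomial.X ^ (∑ x ∈ B, (if x.1 ∈ K ∧ x.2 ∈ K then 1 else 0)) * R := by
    intro B
    induction B using Finset.induction_on with
    | empty => exact fun _ => ⟨1, PX_prime.not_dvd_one, by simp⟩
    | insert x B hx ih =>
      intro hB
      obtain ⟨R, hR, h⟩ := ih fun y hy => hB (by simp [hy])
      have hx' := (Finset.mem_offDiag.1 (hB (Finset.mem_insert_self x B))).2.2
      rw [Finset.prod_insert hx, Finset.sum_insert hx, map_mul, h]
      by_cases hc : x.1 ∈ K ∧ x.2 ∈ K
      · refine ⟨Polynomial.C (dd k x.1 x.2) * R, not_X_dvd_mul (X_not_dvd_C (dd_ne_zero hx')) hR, ?_⟩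
        rw [sc_dd_mem hc.1 hc.2, if_pos hc, pow_add, pow_one]; ring
      · refine ⟨sc k K (dd k x.1 x.2) * R, not_X_dvd_mul (sc_dd_cop hx' hc) hR, ?_⟩
        rw [if_neg hc, zero_add]; ring
  have := this _ (subset_refl _)
  rwa [offDiag_ite S K hK] at this

lemma sc_W_self (S : Finset (Fin l)) : sc k S (W k S) =
    Polynomial.X ^ (S.card * S.card - S.card) * Polynomial.C (W k S) := by
  rw [W, map_prod, map_prod, ← Finset.offDiag_card, ← Finset.prod_const, ← Finset.prod_mul_distrib]
  exact Finset.prod_congr rfl fun x hx =>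
    sc_dd_mem (Finset.mem_offDiag.1 hx).1 (Finset.mem_offDiag.1 hx).2.1

lemma W_insert {S : Finset (Fin l)} {a : Fin l} (ha : a ∉ S) :
    W k (insert a S) = W k S * (∏ b ∈ S, dd k a b) * ∏ b ∈ S, dd k b a := by
  have hd1 : Disjoint S.offDiag ({a} ×ˢ S) := by
    rw [Finset.disjoint_left]
    intro x hx hx'
    simp only [Finset.mem_offDiag, Finset.mem_product, Finset.mem_singleton] at hx hx'
    exact ha (hx'.1 ▸ hx.1)
  have hd2 : Disjoint (S.offDiag ∪ {a} ×ˢ S) (S ×ˢ {a}) := by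
    rw [Finset.disjoint_left]
    intro x hx hx'
    simp only [Finset.mem_union, Finset.mem_offDiag, Finset.mem_product, Finset.mem_singleton]
      at hx hx'
    rcases hx with hx | hx
    · exact ha (hx'.2 ▸ hx.2.1)
    · exact ha (hx'.2 ▸ hx.2)
  rw [W, Finset.offDiag_insert ha, Finset.prod_union hd2, Finset.prod_union hd1,
    Finset.prod_product, Finset.prod_product]
  simp [W]

lemma W_insert' {S : Finset (Fin l)} {a : Fin l} (ha : a ∉ S) : ∃ c : MP k l, IsUnit c ∧
    W k (insert a S) = c * (W k S * ∏ b ∈ S, dd k a b ^ 2) := by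
  refine ⟨(-1) ^ S.card, (isUnit_one.neg).pow _, ?_⟩
  rw [W_insert ha, ← Finset.prod_const, mul_assoc, ← Finset.prod_mul_distrib, mul_left_comm,
    ← Finset.prod_mul_distrib]
  congr 1
  refine Finset.prod_congr rfl fun b _ => ?_
  rw [dd_swap a b]; ring

lemma W_dvd {S : Finset (Fin l)} (e : ℕ) {v : MP k l}
    (h : ∀ s ∈ S, ∀ t ∈ S, s ≠ t → dd k s t ^ (2 * e) ∣ v) : W k S ^ e ∣ v := by
  induction S using Finset.induction_on with
  | empty => simp [W]
  | insert a S ha ih =>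
    obtain ⟨c, hc, h1⟩ := W_insert' (k := k) ha
    obtain ⟨q, rfl⟩ := ih fun s hs t ht hst => h s (by simp [hs]) t (by simp [ht]) hst
    have h2 : (∏ b ∈ S, dd k a b ^ (2 * e)) ∣ q := by
      refine prod_dd_dvd ha _ fun b hb => ?_
      have hab : a ≠ b := by rintro rfl; exact ha hb
      refine (dd_prime hab).pow_dvd_of_dvd_mul_left _ (fun hh => ?_)
        (h a (by simp) b (by simp [hb]) hab)
      have hh := (dd_prime hab).dvd_of_dvd_pow hh
      rw [W, (dd_prime hab).dvd_finsetProd_iff] at hh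
      obtain ⟨x, hx, hx2⟩ := hh
      rw [Finset.mem_offDiag] at hx
      rcases dd_dvd_dd hx.2.2 hx2 with h3 | h3
      · exact ha (h3.1 ▸ hx.1)
      · exact ha (h3.1 ▸ hx.2.1)
    rw [h1, mul_pow, mul_pow, ← Finset.prod_pow]
    simp only [← pow_mul]
    rw [(hc.pow e).mul_left_dvd]
    exact mul_dvd_mul_left _ h2

lemma dd_sq_dvd_W {S : Finset (Fin l)} {s t : Fin l} (hs : s ∈ S) (ht : t ∈ S) (hst : s ≠ t) :
    ∃ r, W k S = dd k s t ^ 2 * r ∧ ¬ dd k s t ∣ r := by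
  obtain ⟨c, hc, h⟩ := W_insert' (k := k) (Finset.notMem_erase s S)
  rw [Finset.insert_erase hs, ← Finset.mul_prod_erase _ _ (Finset.mem_erase.2 ⟨hst.symm, ht⟩)] at h
  refine ⟨c * (W k (S.erase s) * ∏ b ∈ (S.erase s).erase t, dd k s b ^ 2), by rw [h]; ring, ?_⟩
  rw [hc.dvd_mul_left]
  intro hh
  rcases (dd_prime hst).dvd_or_dvd hh with hh | hh
  · rw [W, (dd_prime hst).dvd_finsetProd_iff] at hh
    obtain ⟨x, hx, hx2⟩ := hh
    simp only [Finset.mem_offDiag, Finset.mem_erase] at hx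
    rcases dd_dvd_dd hx.2.2 hx2 with h3 | h3
    · exact hx.1.1 h3.1.symm
    · exact hx.2.1.1 h3.1.symm
  · rw [(dd_prime hst).dvd_finsetProd_iff] at hh
    obtain ⟨x, hx, hx2⟩ := hh
    simp only [Finset.mem_erase] at hx
    rcases dd_dvd_dd hx.2.1.symm ((dd_prime hst).dvd_of_dvd_pow hx2) with h3 | h3
    · exact hx.1 h3.2.symm
    · exact hx.2.1 h3.1.symm

lemma nc_empty (N : ℕ) (p : MP k l) : nc ∅ N p = if N = 0 then p else 0 := by
  have : sc k (∅ : Finset (Fin l)) p = Polynomial.C p :=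
    sc_disj (I := Finset.univ) (by simp) (nc_self_zero.hom_eq_of_pr_univ p)
  simp [nc, this, Polynomial.coeff_C]

lemma PA_of {S : Finset (Fin l)} {p : MP k l} (h1 : TT k S p = 0)
    (h2 : EE k S p = (C (4 * ((S.card : k) - 2)) * sg k S) * p)
    (h3 : Polynomial.X ^ (4 * S.card) * sc k S p =
      Polynomial.X ^ (2 * S.card ^ 2) * Polynomial.C p)
    (h4 : ∀ K ⊆ S, K.Nonempty → K ≠ S → ∀ N < 2 * K.card ^ 2 + 2, nc K N p = 0) : PA S p := by
  refine ⟨h1, h2, h3, fun K hK N hN => ?_, fun K hK => ?_⟩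
  · by_cases hS : K = S
    · rw [hS, hom_iff.1 h3, if_neg (by rw [hS] at hN; omega)]
    rcases K.eq_empty_or_nonempty with rfl | hne
    · simp at hN
    exact h4 K hK hne hS N (by omega)
  · by_cases hS : K = S
    · rw [hS, hom_iff.1 h3, if_neg (by omega)]
      simp [e1]
    rcases K.eq_empty_or_nonempty with rfl | hne
    · rw [nc_empty, if_neg (by omega)]; simp [sg]
    rw [h4 K hK hne hS _ (by omega), h4 K hK hne hS _ (by omega)]; simp

lemma nc_low {S K : Finset (Fin l)} {p : MP k l} (hp : PA S p) (hK : K ⊆ S)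
    (h0 : nc K (2 * K.card ^ 2) p = 0) : ∀ N < 2 * K.card ^ 2 + 2, nc K N p = 0 := by
  intro N hN
  by_cases h1 : N < 2 * K.card ^ 2
  · exact hp.lo K hK N h1
  by_cases h2 : N = 2 * K.card ^ 2
  · rw [h2, h0]
  have h3 : N = 2 * K.card ^ 2 + 1 := by omega
  have := hp.rel K hK
  rw [h0, mul_zero, add_zero] at this
  rw [h3]
  exact (mul_eq_zero.1 this).resolve_left (e0_ne_zero _)

lemma ind_of [CharZero k] {S : Finset (Fin l)} {v : MP k l} (hv : PAdm S v) (hS : 3 ≤ S.card)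
    (h : ∀ K ⊆ S, K.Nonempty → K ≠ S → nc K (2 * K.card ^ 2) v = 0) :
    ∃ q, v = W k S * q ∧ PInd S q := by
  have h' := fun K hK hne hn => nc_low hv.2 hK (h K hK hne hn)
  have hdv : ∀ K ⊆ S, K.Nonempty → K ≠ S →
      Polynomial.X ^ (2 * K.card ^ 2 + 2) ∣ Polynomial.X ^ (4 * K.card) * sc k K v :=
    fun K hK hne hn => Polynomial.X_pow_dvd_iff.2 fun N hN => h' K hK hne hn N hN
  have hW : W k S ^ 1 ∣ v := by
    apply W_dvd
    intro s hs t ht hst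
    apply dd_pow_dvd hv.2.tt hs ht hst
    have hc : ({s, t} : Finset (Fin l)).card = 2 := Finset.card_pair hst
    have := hdv {s, t} (by intro x; simp; rintro (rfl | rfl) <;> assumption) (by simp)
      (fun hh => by rw [← hh, hc] at hS; omega)
    rw [hc] at this
    have := xcancel (R := 1) (M := 0) (N := 2 * 1) PX_prime.not_dvd_one
      (y := sc k {s, t} v) (A := 2 * 2 ^ 2 + 2) (B := 4 * 2) (by rwa [one_mul]) (by norm_num)
    simpa using this
  rw [pow_one] at hW
  obtain ⟨q, rfl⟩ := hW
  have hle : S.card ≤ S.card * S.card := Nat.le_mul_self _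
  refine ⟨q, rfl, ?_, ?_, ?_, ?_, ?_⟩
  · have := hv.1
    rw [map_mul, pr_W] at this
    exact mul_left_cancel₀ (W_ne_zero S) this
  · have := der_cancel (W_ne_zero S) (u := 0) (v := 0) (d := TT k S) (q := q)
      (by rw [TT_W, zero_mul]) (by rw [hv.2.tt, zero_mul])
    rw [this]; ring
  · rw [der_cancel (W_ne_zero S) (EE_W S) hv.2.ee, ← sg]
    simp only [MvPolynomial.C_mul, map_sub, map_one, map_ofNat, map_natCast]
    ring
  · have := hv.2.hom
    rw [map_mul, map_mul, sc_W_self] at this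
    have hne : (Polynomial.X : PP k l) ^ (S.card * S.card) * Polynomial.C (W k S) ≠ 0 :=
      mul_ne_zero (pow_ne_zero _ Polynomial.X_ne_zero) (Polynomial.C_ne_zero.2 (W_ne_zero S))
    apply mul_left_cancel₀ hne
    calc _ = Polynomial.X ^ (4 * S.card) * (Polynomial.X ^ (S.card * S.card - S.card) *
          Polynomial.C (W k S) * sc k S q) := by
          have : (Polynomial.X : PP k l) ^ (S.card * S.card) * Polynomial.X ^ (3 * S.card) =
            Polynomial.X ^ (4 * S.card) * Polynomial.X ^ (S.card * S.card - S.card) := by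
            rw [← pow_add, ← pow_add]; congr 1; omega
          linear_combination (Polynomial.C (W k S) * sc k S q) * this
      _ = _ := by
          rw [this]; ring
  · intro K hK hne hn
    obtain ⟨R, hR, hR2⟩ := sc_W (k := k) hK
    have h1 := hdv K hK hne hn
    rw [map_mul, hR2, mul_assoc, ← mul_assoc, ← pow_add] at h1
    refine xcancel hR h1 ?_
    have hle : K.card ≤ K.card * K.card := Nat.le_mul_self _
    rw [pow_two]; omega

lemma PInd.adm {S : Finset (Fin l)} {q : MP k l} (hq : PInd S q) : PAdm S (W k S * q) := by
  have hle : S.card ≤ S.card * S.card := Nat.le_mul_self _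
  refine ⟨by rw [map_mul, pr_W, hq.sup], PA_of ?_ ?_ ?_ ?_⟩
  · rw [der_mul (u := 0) (v := 0) (by rw [TT_W, zero_mul]) (by rw [hq.tt, zero_mul])]; ring
  · rw [der_mul (EE_W S) hq.ee, ← sg]
    simp only [MvPolynomial.C_mul, map_sub, map_one, map_ofNat, map_natCast]
    ring
  · rw [map_mul, map_mul, sc_W_self]
    have : (Polynomial.X : PP k l) ^ (S.card * S.card) * Polynomial.X ^ (3 * S.card) =
            Polynomial.X ^ (4 * S.card) * Polynomial.X ^ (S.card * S.card - S.card) := by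
            rw [← pow_add, ← pow_add]; congr 1; omega
    calc _ = Polynomial.C (W k S) * (Polynomial.X ^ (4 * S.card) *
          Polynomial.X ^ (S.card * S.card - S.card)) * sc k S q := by ring
      _ = Polynomial.C (W k S) * Polynomial.X ^ (S.card * S.card) *
          (Polynomial.X ^ (3 * S.card) * sc k S q) := by rw [← this]; ring
      _ = _ := by rw [hq.hom]; ring
  · intro K hK hne hn N hN
    refine Polynomial.X_pow_dvd_iff.1 ?_ N hN
    obtain ⟨R, hR, hR2⟩ := sc_W (k := k) hK
    obtain ⟨y, hy⟩ := hq.ord K hK hne hn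
    have hle : K.card ≤ K.card * K.card := Nat.le_mul_self _
    refine ⟨R * y, ?_⟩
    have : (Polynomial.X : PP k l) ^ (K.card * K.card) * Polynomial.X ^ (3 * K.card) =
            Polynomial.X ^ (4 * K.card) * Polynomial.X ^ (K.card * K.card - K.card) := by
            rw [← pow_add, ← pow_add]; congr 1; omega
    rw [map_mul, hR2]
    calc _ = R * (Polynomial.X ^ (4 * K.card) *
          Polynomial.X ^ (K.card * K.card - K.card)) * sc k K q := by ring
      _ = R * Polynomial.X ^ (K.card * K.card) *
          (Polynomial.X ^ (3 * K.card) * sc k K q) := by rw [← this]; ring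
      _ = _ := by rw [hy]; ring

end H12

section H13

open MvPolynomial (X C mkDerivation)

variable {k : Type} [Field k] {l : ℕ}

def GF (i : Fin l) (p : MP k l) : Set (MP k l) :=
  {x | PAdm Finset.univ x ∧ ((∃ j ≠ i, ∃ b, PAdm ({i, j} : Finset (Fin l))ᶜ b ∧
      x = b * Cr k ({i, j} : Finset (Fin l))ᶜ {i, j}) ∨
    ((∀ j ≠ i, dd k i j ^ 2 ∣ x) ∧ ∃ a b, ∀ j, j ≠ i → j ≠ a → j ≠ b → dd k i j ^ 3 ∣ x)) ∧
    ∀ s t, s ≠ t → ∀ e, (e = 2 ∨ e = 3) → dd k s t ^ e ∣ p → dd k s t ^ e ∣ x}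

lemma const_of {J : Finset (Fin l)} {v : MP k l} (hv : PAdm J v) (hJ : J.card = 2) :
    v = C (MvPolynomial.constantCoeff v) := by
  have h1 : sc k J v = Polynomial.C v := by
    have := hv.2.hom
    rw [hJ] at this
    exact mul_left_cancel₀ (pow_ne_zero _ Polynomial.X_ne_zero) this
  have := hom_eq_of_pr (f := (Polynomial.evalRingHom (0 : MP k l)).comp (sc k J))
    (g := (C (σ := Fin l)).comp MvPolynomial.constantCoeff) (S := J)
    (fun c => by simp [sc_C]) (fun a ha => by simp [sc_X_mem ha]) hv.1
  simpa [h1] using this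

lemma cube_dvd {J : Finset (Fin l)} {s t : Fin l} (hs : s ∈ J) (ht : t ∈ J) (hst : s ≠ t)
    (q : MP k l) : dd k s t ^ 3 ∣ W k J * q ↔ dd k s t ∣ q := by
  obtain ⟨r, hr, hr2⟩ := dd_sq_dvd_W (k := k) hs ht hst
  rw [hr, mul_assoc, pow_succ, mul_dvd_mul_iff_left (pow_ne_zero 2 (dd_ne_zero hst))]
  exact ⟨fun h => ((dd_prime hst).dvd_or_dvd h).resolve_left hr2, fun h => h.mul_left _⟩

lemma sq_dvd {J : Finset (Fin l)} {s t : Fin l} (hs : s ∈ J) (ht : t ∈ J) (hst : s ≠ t)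
    (q : MP k l) : dd k s t ^ 2 ∣ W k J * q := by
  obtain ⟨r, hr, hr2⟩ := dd_sq_dvd_W (k := k) hs ht hst
  rw [hr, mul_assoc]
  exact dvd_mul_right _ _

theorem thmC [CharZero k] (i : Fin l) {p : MP k l} (hp : PAdm Finset.univ p) :
    p ∈ AddSubmonoid.closure (GF i p) := by
  set Dv : Fin l → Fin l → ℕ → Prop := fun s t e => (e = 2 ∨ e = 3) ∧ dd k s t ^ e ∣ p with hDvd
  have hDv : ∀ s t e, Dv s t e → e ≤ 4 := fun s t e h => by
    rcases h.1 with h | h <;> omega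
  have hB := thmB (Finset.mem_univ i) hDv ((Finset.univ : Finset (Fin l)).card + 1) 0 (by omega) p
    (mem_UU.2 ⟨hp, fun s _ t _ _ e h => h.2, fun _ _ h => h.elim⟩) (fun _ _ _ h => by omega)
  refine (AddSubmonoid.closure_le.2 ?_) hB
  rintro x ⟨J, hJ, hi, u, hu, v, hv, rfl⟩
  have hxUU := mem_UU.1 (mul_Cr_mem hDv hJ hu hv)
  have hu' := mem_UU.1 hu
  have hv' := mem_UU.1 hv
  have hpos : 0 < J.card := Finset.card_pos.2 ⟨i, hi⟩
  rcases (by omega : J.card = 1 ∨ J.card = 2 ∨ 3 ≤ J.card) with h1 | h2 | h3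
  · have h4 := hom_iff.1 hv'.1.2.hom (2 * J.card ^ 2)
    rw [if_pos rfl, nc_eq, if_neg (by rw [h1]; norm_num)] at h4
    rw [← h4, mul_zero, zero_mul]
    exact zero_mem _
  · have hc := const_of hv'.1 h2
    set c := MvPolynomial.constantCoeff v
    obtain ⟨j, hji, rfl⟩ : ∃ j, j ≠ i ∧ J = {i, j} := by
      have : (J.erase i).card = 1 := by rw [Finset.card_erase_of_mem hi]; omega
      obtain ⟨j, hj⟩ := Finset.card_eq_one.1 this
      have hj' : j ∈ J.erase i := by rw [hj]; simp
      refine ⟨j, (Finset.mem_erase.1 hj').1, ?_⟩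
      rw [← Finset.insert_erase hi, hj]
    apply AddSubmonoid.subset_closure
    refine ⟨hxUU.1, Or.inl ⟨j, hji, u * v, ?_, ?_⟩, fun s t hst e he h => hxUU.2.1 s (by simp) t
      (by simp) hst e ⟨he, h⟩⟩
    · have := (UU (Finset.univ \ {i, j}) Dv (fun _ => False) : Submodule k (MP k l)).smul_mem c hu
      rw [hc, mul_comm, ← MvPolynomial.smul_eq_C_mul, Finset.compl_eq_univ_sdiff]
      exact (mem_UU.1 this).1
    · rw [Finset.compl_eq_univ_sdiff]
  · obtain ⟨q, rfl, hq⟩ := ind_of hv'.1 h3 (by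
      intro K hK hne hn
      by_cases hiK : i ∈ K
      · exact hv'.2.2 K hK ⟨hiK, hn⟩
      · apply sym_lemma hv'.1.2 hK
        refine hv'.2.2 _ Finset.sdiff_subset ⟨by simp [hi, hiK], fun h => ?_⟩
        obtain ⟨a, ha⟩ := hne
        have : a ∈ J \ K := by rw [h]; exact hK ha
        exact (Finset.mem_sdiff.1 this).2 ha)
    have hA := thmA J.card J i q rfl h3 hi hq
    have key : ∀ q' ∈ AddSubmonoid.closure (GA J i q),
        u * (W k J * q') * Cr k (Finset.univ \ J) J ∈ AddSubmonoid.closure (GF i p) := by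
      intro q' hq'
      induction hq' using AddSubmonoid.closure_induction with
      | zero => simp
      | add x y _ _ hx hy =>
        have := add_mem hx hy
        convert this using 1
        ring
      | mem q' h =>
        obtain ⟨hI, ⟨a, ha, b, hb, hai, hbi, hab, hr⟩, hd⟩ := h
        have hw : W k J * q' ∈ (UU J Dv (fun _ => False) : Submodule k (MP k l)) := by
          refine mem_UU.2 ⟨hI.adm, fun s hs t ht hst e he => ?_, fun _ _ h => h.elim⟩
          rcases he.1 with h | h
          · rw [h]; exact sq_dvd hs ht hst _
          · rw [h, cube_dvd hs ht hst]
            refine hd s hs t ht hst ?_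
            rw [← cube_dvd hs ht hst, ← h]
            exact hv'.2.1 s hs t ht hst e he
        have hx := mem_UU.1 (mul_Cr_mem hDv hJ hu hw)
        apply AddSubmonoid.subset_closure
        refine ⟨hx.1, Or.inr ⟨fun j hj => ?_, a, b, fun j hji hja hjb => ?_⟩,
          fun s t hst e he h => hx.2.1 s (by simp) t (by simp) hst e ⟨he, h⟩⟩
        · by_cases hjJ : j ∈ J
          · exact ((sq_dvd hi hjJ hj.symm _).mul_left _).mul_right _
          · exact ((pow_dvd_pow _ (by norm_num)).trans (dvd_Cr' (by simp [hjJ]) hi)).mul_left _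
        · by_cases hjJ : j ∈ J
          · exact (((cube_dvd hi hjJ hji.symm _).2 (hr j hjJ hji hja hjb)).mul_left _).mul_right _
          · exact ((pow_dvd_pow _ (by norm_num)).trans (dvd_Cr' (by simp [hjJ]) hi)).mul_left _
    exact key q hA

end H13

section H14

open MvPolynomial (X C mkDerivation)

variable {k : Type} [Field k] {l : ℕ}

/-- expansion of a polynomial as a power series over the fraction field -/
def ps (P : PP k l) : PowerSeries (RF k l) :=
  ((P.map (algebraMap (MP k l) (RF k l)) : Polynomial (RF k l)) : PowerSeries (RF k l))

lemma ps_coeff (P : PP k l) (n : ℕ) :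
    PowerSeries.coeff n (ps P) = algebraMap (MP k l) (RF k l) (P.coeff n) := by
  rw [ps, Polynomial.coeff_coe, Polynomial.coeff_map]

lemma ps_mul (P Q : PP k l) : ps (P * Q) = ps P * ps Q := by
  simp [ps]

lemma ps_X_pow (n : ℕ) : ps (Polynomial.X ^ n : PP k l) = PowerSeries.X ^ n := by
  simp [ps]

open scoped RatFunc in
/-- Laurent expansion -/
def toL (F : Type) [Field F] : RatFunc F →+* LaurentSeries F :=
  algebraMap (RatFunc F) (LaurentSeries F)

lemma toL_lcoeff {F : Type} [Field F] (n : ℤ) (f : RatFunc F) :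
    lcoeff n f = (toL F f).coeff n := rfl

lemma toL_poly {F : Type} [Field F] (p : Polynomial F) :
    toL F (algebraMap (Polynomial F) (RatFunc F) p) =
      HahnSeries.ofPowerSeries ℤ F (p : PowerSeries F) := (RatFunc.coe_coe p).symm

lemma coe_T (P : PP k l) : toL (RF k l) (toRatFuncHom k l P) =
    HahnSeries.ofPowerSeries ℤ (RF k l) (ps P) := toL_poly _

lemma ps_inj (P Q : PowerSeries (RF k l)) (h : HahnSeries.ofPowerSeries ℤ (RF k l) P =
    HahnSeries.ofPowerSeries ℤ (RF k l) Q) : P = Q := HahnSeries.ofPowerSeries_injective h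

lemma ofPS_iff {F : Type} [Field F] (f : LaurentSeries F) (m : ℤ) :
    (∀ n < m, f.coeff n = 0) ↔ ∃ g : PowerSeries F,
      f = HahnSeries.single m 1 * HahnSeries.ofPowerSeries ℤ F g := by
  constructor
  · intro h
    refine ⟨PowerSeries.mk fun n => f.coeff (m + n), ?_⟩
    ext n
    rw [HahnSeries.coeff_single_mul, one_mul, PowerSeries.coeff_coe]
    split_ifs with hn
    · exact h n (by omega)
    · rw [PowerSeries.coeff_mk]; congr 1; omega
  · rintro ⟨g, rfl⟩ n hn
    rw [HahnSeries.coeff_single_mul, one_mul, PowerSeries.coeff_coe, if_pos (by omega)]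

lemma lau {P R : PP k l} {d N : ℕ} (hR : R.coeff 0 ≠ 0) {f : RatFunc (RF k l)} {m : ℤ}
    (hf : f * toRatFuncHom k l (Polynomial.X ^ d * R) = toRatFuncHom k l P) (hm : m = N - d) :
    ((∀ n < m, lcoeff n f = 0) ↔ ∀ n < N, P.coeff n = 0) ∧
    ((∀ n < m, lcoeff n f = 0) →
      algebraMap (MP k l) (RF k l) (P.coeff N) = lcoeff m f * algebraMap _ _ (R.coeff 0) ∧
      algebraMap (MP k l) (RF k l) (P.coeff (N + 1)) = lcoeff (m + 1) f * algebraMap _ _ (R.coeff 0)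
        + lcoeff m f * algebraMap _ _ (R.coeff 1)) := by
  set F : LaurentSeries (RF k l) := toL (RF k l) f with hF
  have hl : ∀ n, lcoeff n f = F.coeff n := fun n => toL_lcoeff n f
  have hinj : Function.Injective (algebraMap (MP k l) (RF k l)) := IsFractionRing.injective _ _
  have hR0 : ps R ≠ 0 := fun h => hR (by
    have := ps_coeff R 0
    rw [h, map_zero] at this
    exact hinj (by rw [map_zero, this]))
  have h1 : F * (HahnSeries.single (d : ℤ) 1 * HahnSeries.ofPowerSeries ℤ _ (ps R)) =
      HahnSeries.ofPowerSeries ℤ _ (ps P) := by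
    have := congrArg (toL (RF k l)) hf
    rw [map_mul, coe_T, coe_T, ps_mul, ps_X_pow, map_mul, HahnSeries.ofPowerSeries_X_pow] at this
    exact this
  have h2 : ∀ g, F = HahnSeries.single m 1 * HahnSeries.ofPowerSeries ℤ _ g →
      ps P = PowerSeries.X ^ N * (g * ps R) := by
    intro g hg
    apply ps_inj
    rw [← h1, hg, map_mul, map_mul, HahnSeries.ofPowerSeries_X_pow]
    have : (HahnSeries.single (N : ℤ) 1 : LaurentSeries (RF k l)) =
        HahnSeries.single m 1 * HahnSeries.single (d : ℤ) 1 := by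
      rw [HahnSeries.single_mul_single, mul_one, show m + (d : ℤ) = N by omega]
    rw [this]; ring
  have hc : ∀ g : PowerSeries (RF k l), F = HahnSeries.single m 1 * HahnSeries.ofPowerSeries ℤ _ g →
      ∀ n : ℕ, F.coeff (m + n) = PowerSeries.coeff n g := by
    intro g hg n
    rw [hg, HahnSeries.coeff_single_mul, one_mul, add_sub_cancel_left,
      LaurentSeries.coeff_coe_powerSeries]
  simp only [hl]
  refine ⟨⟨fun h n hn => ?_, fun h => ?_⟩, fun h => ?_⟩
  · obtain ⟨g, hg⟩ := (ofPS_iff F m).1 h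
    apply hinj
    rw [← ps_coeff, h2 g hg, map_zero, PowerSeries.coeff_X_pow_mul', if_neg (by omega)]
  · obtain ⟨P', rfl⟩ := Polynomial.X_pow_dvd_iff.2 h
    refine (ofPS_iff F m).2 ⟨ps P' * (ps R)⁻¹, ?_⟩
    have hs : ∀ e : ℤ, (HahnSeries.single e 1 : LaurentSeries (RF k l)) ≠ 0 := fun e => by simp
    have hne : HahnSeries.single (d : ℤ) 1 * HahnSeries.ofPowerSeries ℤ _ (ps R) ≠ 0 :=
      mul_ne_zero (hs _) (fun h => hR0 (ps_inj _ _ (by rw [h, map_zero])))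
    apply mul_right_cancel₀ hne
    rw [h1, ps_mul, ps_X_pow, map_mul, HahnSeries.ofPowerSeries_X_pow]
    have : (HahnSeries.single (N : ℤ) 1 : LaurentSeries (RF k l)) =
        HahnSeries.single m 1 * HahnSeries.single (d : ℤ) 1 := by
      rw [HahnSeries.single_mul_single, mul_one, show m + (d : ℤ) = N by omega]
    have hi : ps P' = ps P' * (ps R)⁻¹ * ps R := by
      rw [mul_assoc, PowerSeries.inv_mul_cancel, mul_one]
      rw [← PowerSeries.coeff_zero_eq_constantCoeff_apply, ps_coeff]
      exact fun h => hR (hinj (by rw [h, map_zero]))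
    rw [this]
    conv_lhs => rw [hi, map_mul]
    ring
  · obtain ⟨g, hg⟩ := (ofPS_iff F m).1 h
    have h0 := hc g hg 0
    have h1' := hc g hg 1
    rw [Nat.cast_zero, add_zero] at h0
    rw [Nat.cast_one] at h1'
    rw [h0, h1', ← ps_coeff, ← ps_coeff, ← ps_coeff, ← ps_coeff, h2 g hg]
    constructor
    · have := PowerSeries.coeff_X_pow_mul (g * ps R) N 0
      rw [zero_add] at this
      rw [this]
      simp
    · have := PowerSeries.coeff_X_pow_mul (g * ps R) N 1
      rw [add_comm] at this
      rw [this, PowerSeries.coeff_one_mul]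
      simp [mul_comm]

end H14

section H15

open MvPolynomial (X C mkDerivation)

variable {k : Type} [Field k] {l : ℕ}

/-- polynomials inside rational functions -/
abbrev io (k : Type) [Field k] (l : ℕ) : MP k l →+* RF k l := algebraMap (MP k l) (RF k l)

lemma io_inj : Function.Injective (io k l) := IsFractionRing.injective _ _

lemma io_ne {p : MP k l} (h : p ≠ 0) : io k l p ≠ 0 := fun h' => h (io_inj (by rw [h', map_zero]))

lemma io_dd (a b : Fin l) : io k l (dd k a b) = zv a - zv b := by rw [dd, map_sub]; rfl

lemma scaleJ_io (J : Finset (Fin l)) (p : MP k l) :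
    scaleJ J (io k l p) = toRatFuncHom k l (sc k J p) := IsFractionRing.lift_algebraMap _ _

lemma subPair_io (s t : Fin l) (p : MP k l) :
    subPair s t (io k l p) = toRatFuncHom k l (subPairAux k l s t p) :=
  IsFractionRing.lift_algebraMap _ _

lemma T_C (p : MP k l) : toRatFuncHom k l (Polynomial.C p) = RatFunc.C (io k l p) := by
  simp [toRatFuncHom, RatFunc.algebraMap_C]

lemma T_X : toRatFuncHom k l Polynomial.X = RatFunc.X := by
  simp [toRatFuncHom, RatFunc.algebraMap_X]

lemma comp_iff {S K : Finset (Fin l)} (hK : K ⊆ S) {α : RF k l} {p : MP k l}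
    (h : α * io k l (W k S) ^ 2 = io k l p) :
    (∀ n : ℤ, (n < 0 ∨ n = 1) → component K (fun _ => 2) n α = 0) ↔
    (∀ N < 2 * K.card ^ 2, nc K N p = 0) ∧ e0 k (S \ K) * nc K (2 * K.card ^ 2 + 1) p +
      4 * sg k K * e1 k (S \ K) * nc K (2 * K.card ^ 2) p = 0 := by
  obtain ⟨R, hR, hW⟩ := sc_W (k := k) hK
  have hle : K.card ≤ K.card * K.card := Nat.le_mul_self _
  have hRR := (RR_W (k := k) hK).pow 2
  set j := K.card with hj
  have hR0 : (R ^ 2).coeff 0 ≠ 0 := fun h0 =>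
    hR (PX_prime.dvd_of_dvd_pow (Polynomial.X_dvd_iff.2 h0))
  have hf : scaleJ K α * toRatFuncHom k l (Polynomial.X ^ (4 * j + 2 * (j * j - j)) * R ^ 2) =
      toRatFuncHom k l (Polynomial.X ^ (4 * j) * sc k K p) := by
    have h1 := congrArg (scaleJ K) h
    rw [map_mul, map_pow, scaleJ_io, scaleJ_io, hW] at h1
    rw [map_mul (toRatFuncHom k l) _ (sc k K p), ← h1, ← map_pow, mul_left_comm, ← map_mul]
    congr 2
    rw [pow_add, mul_comm 2, pow_mul]
    ring
  have hm : (-(2 * j) : ℤ) = ((2 * j ^ 2 : ℕ) : ℤ) - ((4 * j + 2 * (j * j - j) : ℕ) : ℤ) := by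
    push_cast [Nat.cast_sub hle]; ring
  obtain ⟨h1, h2⟩ := lau hR0 hf hm
  have hcomp : ∀ n, component K (fun _ => 2) n α = lcoeff (n - 2 * j) (scaleJ K α) := by
    intro n
    simp [component, hj, mul_comm]
  have hlt : (∀ n : ℤ, n < 0 → component K (fun _ => 2) n α = 0) ↔
      ∀ n < (-(2 * j) : ℤ), lcoeff n (scaleJ K α) = 0 := by
    constructor
    · intro H n hn
      have := H (n + 2 * j) (by omega)
      rwa [hcomp, add_sub_cancel_right] at this
    · intro H n hn
      rw [hcomp]; exact H _ (by omega)
  have hrel := hRR.rel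
  rw [hW, mul_pow, ← pow_mul, mul_comm (j * j - j) 2, add_comm _ 1, Polynomial.coeff_X_pow_mul] at hrel
  have h0 := Polynomial.coeff_X_pow_mul (R ^ 2) (2 * (j * j - j)) 0
  rw [zero_add] at h0
  rw [h0] at hrel
  have hcore : (∀ n < (-(2 * j) : ℤ), lcoeff n (scaleJ K α) = 0) →
      (component K (fun _ => 2) 1 α = 0 ↔ e0 k (S \ K) * nc K (2 * j ^ 2 + 1) p +
      4 * sg k K * e1 k (S \ K) * nc K (2 * j ^ 2) p = 0) := by
    intro H
    obtain ⟨h3, h4⟩ := h2 H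
    have h5 : io k l (e0 k (S \ K) * nc K (2 * j ^ 2 + 1) p +
        4 * sg k K * e1 k (S \ K) * nc K (2 * j ^ 2) p) =
        io k l (e0 k (S \ K)) * component K (fun _ => 2) 1 α * io k l ((R ^ 2).coeff 0) := by
      have h6 := congrArg (io k l) hrel
      rw [nc, nc, ← hj]
      simp only [map_add, map_mul, map_zero, Nat.cast_ofNat, map_ofNat] at h3 h4 h6 ⊢
      rw [h3, h4, hcomp, show (1 - 2 * j : ℤ) = -(2 * j) + 1 by ring]
      linear_combination (lcoeff (-(2 * (j : ℤ))) (scaleJ K α)) * h6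
    constructor
    · intro hc
      apply io_inj
      rw [h5, hc]; simp
    · intro hc
      rw [hc, map_zero] at h5
      have h6 := io_ne (e0_ne_zero (k := k) (S \ K))
      have h7 := io_ne hR0
      simpa [h6, h7] using h5.symm
  constructor
  · intro H
    have H1 := hlt.1 fun n hn => H n (Or.inl hn)
    exact ⟨h1.1 H1, (hcore H1).1 (H 1 (Or.inr rfl))⟩
  · rintro ⟨H1, H2⟩ n (hn | rfl)
    · exact hlt.2 (h1.2 H1) n hn
    · exact (hcore (h1.2 H1)).2 H2

lemma homog_iff {S : Finset (Fin l)} {α : RF k l} {p : MP k l} {M : ℕ}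
    (h : α * io k l (W k S) ^ M = io k l p) :
    IsHomogeneousOn S (-(2 * (S.card : ℤ))) α ↔
    Polynomial.X ^ (2 * S.card) * sc k S p =
      Polynomial.X ^ (M * (S.card * S.card - S.card)) * Polynomial.C p := by
  have h1 := congrArg (scaleJ S) h
  rw [map_mul, map_pow, scaleJ_io, scaleJ_io, sc_W_self, map_mul, map_pow, T_X, T_C] at h1
  have h2 := congrArg (RatFunc.C (K := RF k l)) h
  rw [map_mul, map_pow] at h2
  have hX : (RatFunc.X : RatFunc (RF k l)) ≠ 0 := RatFunc.X_ne_zero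
  have hW : (RatFunc.C (io k l (W k S)) : RatFunc (RF k l)) ≠ 0 := by
    rw [Ne, map_eq_zero]; exact io_ne (W_ne_zero S)
  have hz : (RatFunc.X : RatFunc (RF k l)) ^ (-(2 * (S.card : ℤ))) * RatFunc.X ^ (2 * S.card) = 1 := by
    rw [← zpow_natCast, ← zpow_add₀ hX]; simp
  rw [IsHomogeneousOn, ← (toRatFuncHom_injective (k := k) (l := l)).eq_iff, map_mul, map_mul, map_pow,
    map_pow, T_X, T_C, ← h1, ← h2]
  set e := S.card * S.card - S.card
  set x : RatFunc (RF k l) := RatFunc.X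
  set w : RatFunc (RF k l) := RatFunc.C (io k l (W k S))
  constructor
  · intro H
    rw [H, mul_pow, ← pow_mul, mul_comm e M]
    linear_combination (RatFunc.C α * x ^ (M * e) * w ^ M) * hz
  · intro H
    have hne : x ^ (2 * S.card) * (x ^ e * w) ^ M ≠ 0 := by positivity
    apply mul_right_cancel₀ hne
    have : scaleJ S α * (x ^ (2 * S.card) * (x ^ e * w) ^ M) =
      x ^ (2 * S.card) * (scaleJ S α * (x ^ e * w) ^ M) := by ring
    rw [this, H, mul_pow, ← pow_mul, mul_comm e M]
    linear_combination -(RatFunc.C α * x ^ (M * e) * w ^ M) * hz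

lemma reg_iff {D : Fin l → Derivation k (RF k l) (RF k l)} (hD : IsPartialDeriv D)
    {S : Finset (Fin l)} {α : RF k l} {p : MP k l} {M : ℕ}
    (h : α * io k l (W k S) ^ M = io k l p) :
    (∑ i ∈ S, ((zv i) ^ 2 * D i α + 4 * zv i * α)) = 0 ↔
    EE k S p = (C (M * (2 * ((S.card : k) - 1)) - 4) * sg k S) * p := by
  let δ : Derivation k (RF k l) (RF k l) := ∑ i ∈ S, ((zv i : RF k l) ^ 2) • D i
  have hδ : ∀ x, δ x = ∑ i ∈ S, (zv i) ^ 2 * D i x := by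
    intro x
    simp only [δ]
    clear δ h
    induction S using Finset.induction_on with
    | empty => simp
    | insert a S ha ih => rw [Finset.sum_insert ha, Finset.sum_insert ha, Derivation.add_apply, ih]; rfl
  have hio : ∀ q : MP k l, io k l (EE k S q) = δ (io k l q) := by
    intro q
    refine der_hom (IsScalarTower.toAlgHom k (MP k l) (RF k l)) (EE k S) δ (fun a => ?_) q
    show io k l (EE k S (X a)) = δ (zv a)
    rw [EE_X, hδ]
    simp only [hD _ a, mul_ite, mul_one, mul_zero, Finset.sum_ite_eq]
    split_ifs
    · rw [map_pow]; rfl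
    · simp
  have hsum : (∑ i ∈ S, ((zv i) ^ 2 * D i α + 4 * zv i * α)) = δ α + 4 * io k l (sg k S) * α := by
    rw [Finset.sum_add_distrib, hδ, sg, map_sum, Finset.mul_sum, Finset.sum_mul]; rfl
  have hW := der_pow (EE_W (k := k) S) M
  have hw := io_ne (pow_ne_zero M (W_ne_zero (k := k) S))
  have h1 := hio (W k S ^ M)
  rw [hW] at h1
  have h2 := congrArg δ h
  rw [← map_pow, Derivation.leibniz, ← h1, ← hio, smul_eq_mul, smul_eq_mul] at h2
  rw [← map_pow] at h
  rw [hsum, ← io_inj.eq_iff, ← h2]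
  simp only [map_mul, map_sub, map_natCast, map_ofNat, map_one] at h ⊢
  rw [← h]
  constructor
  · intro H
    linear_combination (io k l (W k S ^ M)) * H
  · intro H
    apply mul_left_cancel₀ hw
    linear_combination H

lemma eval_subPair (s t : Fin l) (p : MP k l) :
    (subPairAux k l s t p).eval (dd k s t) = p := by
  have h : (Polynomial.evalRingHom (dd k s t)).comp
      (subPairAux k l s t) = RingHom.id _ := by
    apply MvPolynomial.ringHom_ext
    · intro r; simp [subPairAux]
    · intro a; by_cases hs : a = s <;> simp [subPairAux, hs, dd]
  exact DFunLike.congr_fun h p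

lemma subPair_coeff_zero (s t : Fin l) (p : MP k l) :
    (subPairAux k l s t p).coeff 0 = sig k s t p := by
  have h : (Polynomial.constantCoeff).comp
      (subPairAux k l s t) = (sig k s t).toRingHom := by
    apply MvPolynomial.ringHom_ext
    · intro r; simp [subPairAux, sig]
    · intro a; by_cases hs : a = s <;> simp [subPairAux, hs, sig]
  exact DFunLike.congr_fun h p

lemma subPair_dd (s t : Fin l) (hst : s ≠ t) : subPairAux k l s t (dd k s t) = Polynomial.X := by
  simp [subPairAux, dd, hst.symm]

lemma rho_iff {s t : Fin l} (hst : s ≠ t) {α : RF k l} {p : MP k l}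
    (h : α * io k l (W k Finset.univ) ^ 2 = io k l p) (e : ℕ) {m : ℤ} (hm : m = e - 4) :
    (∀ m' < m, rho s t m' α = 0) ↔ dd k s t ^ e ∣ p := by
  obtain ⟨r, hr, hr'⟩ := dd_sq_dvd_W (k := k) (Finset.mem_univ s) (Finset.mem_univ t) hst
  rw [dd_dvd_iff, ← subPair_coeff_zero] at hr'
  set Q := subPairAux k l s t r
  have hQ0 : (Q ^ 2).coeff 0 ≠ 0 := by
    rw [pow_two, Polynomial.mul_coeff_zero]; exact mul_ne_zero hr' hr'
  have hf : subPair s t α * toRatFuncHom k l (Polynomial.X ^ 4 * Q ^ 2) =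
      toRatFuncHom k l (subPairAux k l s t p) := by
    have h1 := congrArg (subPair s t) h
    rw [map_mul, map_pow, subPair_io, subPair_io, hr, map_mul, map_pow, subPair_dd s t hst] at h1
    have hX : (Polynomial.X ^ 4 * Q ^ 2 : PP k l) = (Polynomial.X ^ 2 * Q) ^ 2 := by ring
    rw [hX, map_pow]
    exact h1
  have h1 := (lau hQ0 hf (N := e) (m := m) (by push_cast; exact hm)).1
  unfold rho
  rw [h1, ← Polynomial.X_pow_dvd_iff]
  constructor
  · rintro ⟨q, hq⟩
    have := congrArg (Polynomial.eval (dd k s t)) hq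
    rw [eval_subPair] at this
    rw [this]
    simp
  · rintro ⟨q, rfl⟩
    rw [map_mul, map_pow, subPair_dd s t hst]
    exact dvd_mul_right _ _

end H15

section H16

open MvPolynomial (X C mkDerivation)

variable {k : Type} [Field k] {l : ℕ}

lemma W_eq (S : Finset (Fin l)) : W k S = ∏ i : Fin l, ∏ j : Fin l,
    (if i < j then (if i ∈ S ∧ j ∈ S then dd k i j * dd k j i else 1) else 1) := by
  set g : Fin l → Fin l → MP k l := fun i j => if i ∈ S ∧ j ∈ S ∧ i ≠ j then dd k i j else 1 with hg
  have h1 : W k S = ∏ i : Fin l, ∏ j : Fin l, g i j := by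
    rw [W, ← Finset.prod_product', Finset.univ_product_univ]
    simp only [hg]
    rw [← Finset.prod_filter]
    congr 1
    ext x
    simp [Finset.mem_offDiag]
  have h2 : ∀ i j, g i j = (if i < j then g i j else 1) * (if j < i then g i j else 1) := by
    intro i j
    rcases lt_trichotomy i j with h | h | h
    · simp [h, h.not_gt]
    · simp [h, hg]
    · simp [h, h.not_gt]
  have h3 : ∏ i : Fin l, ∏ j : Fin l, g i j = (∏ i : Fin l, ∏ j : Fin l, (if i < j then g i j else 1)) *
      ∏ i : Fin l, ∏ j : Fin l, (if j < i then g i j else 1) := by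
    rw [← Finset.prod_mul_distrib]
    refine Finset.prod_congr rfl fun i _ => ?_
    rw [← Finset.prod_mul_distrib]
    exact Finset.prod_congr rfl fun j _ => h2 i j
  rw [h1, h3]
  rw [Finset.prod_comm (f := fun i j => if j < i then g i j else 1)]
  simp_rw [← Finset.prod_mul_distrib]
  refine Finset.prod_congr rfl fun i _ => Finset.prod_congr rfl fun j _ => ?_
  by_cases h : i < j
  · by_cases hs : i ∈ S ∧ j ∈ S
    · simp [h, hg, hs, h.ne, h.ne']
    · have ha : g i j = 1 := if_neg (fun x => hs ⟨x.1, x.2.1⟩)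
      have hb : g j i = 1 := if_neg (fun x => hs ⟨x.2.1, x.1⟩)
      simp only [ha, hb, hs, ite_self, if_false, mul_one]
  · simp [h]

lemma Phi_of (S : Finset (Fin l)) (p : MP k l) : io k l p / io k l (W k S) ^ 2 ∈ Phi k l := by
  refine ⟨p, fun i j => if i ∈ S ∧ j ∈ S then -4 else 0, ?_⟩
  have hw := pow_ne_zero 2 (io_ne (W_ne_zero (k := k) S))
  rw [div_eq_iff hw, mul_assoc]
  have : (∏ i : Fin l, ∏ j : Fin l, (if i < j then (zv i - zv j : RF k l) ^
      (if i ∈ S ∧ j ∈ S then -4 else 0 : ℤ) else 1)) * io k l (W k S) ^ 2 = 1 := by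
    rw [W_eq, map_prod, ← Finset.prod_pow, ← Finset.prod_mul_distrib]
    refine Finset.prod_eq_one fun i _ => ?_
    rw [map_prod, ← Finset.prod_pow, ← Finset.prod_mul_distrib]
    refine Finset.prod_eq_one fun j _ => ?_
    by_cases h : i < j
    · by_cases hs : i ∈ S ∧ j ∈ S
      · rw [if_pos h, if_pos hs, if_pos h, if_pos hs, dd_swap i j, ← io_dd, map_mul, map_neg]
        have hne : io k l (dd k i j) ≠ 0 := io_ne (dd_ne_zero h.ne)
        rw [zpow_neg]
        field_simp
      · simp [h, hs]
    · simp [h]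
  rw [this, mul_one]

lemma dep_of {S : Finset (Fin l)} {p : MP k l} (hp : pr k S p = p) :
    dependsOnlyOn S (io k l p) := by
  rw [← hp]
  clear hp
  unfold dependsOnlyOn
  induction p using MvPolynomial.induction_on with
  | C c =>
    rw [alg_C]
    exact Subfield.subset_closure (Or.inl ⟨c, rfl⟩)
  | add p q h1 h2 => rw [map_add, map_add]; exact add_mem h1 h2
  | mul_X p a h1 =>
    rw [map_mul, map_mul, pr_X]
    refine mul_mem h1 ?_
    split_ifs with ha
    · exact Subfield.subset_closure (Or.inr ⟨a, ha, rfl⟩)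
    · rw [map_zero]; exact zero_mem _

lemma hom_two (n : ℕ) (P Q : PP k l) : Polynomial.X ^ (2 * n) * P =
      Polynomial.X ^ (2 * (n * n - n)) * Q ↔
    Polynomial.X ^ (4 * n) * P = Polynomial.X ^ (2 * n ^ 2) * Q := by
  have hle : n ≤ n * n := Nat.le_mul_self _
  have hX : (Polynomial.X : PP k l) ^ (2 * n) ≠ 0 := pow_ne_zero _ Polynomial.X_ne_zero
  rw [show 2 * n ^ 2 = 2 * n + 2 * (n * n - n) by rw [Nat.mul_sub, pow_two]; omega,
    show 4 * n = 2 * n + 2 * n by ring, pow_add, pow_add, mul_assoc, mul_assoc]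
  exact ⟨fun h => by rw [h], fun h => mul_left_cancel₀ hX h⟩

/-- translation between polynomials and rational functions -/
lemma adm_iff {D : Fin l → Derivation k (RF k l) (RF k l)} (hD : IsPartialDeriv D)
    {S : Finset (Fin l)} {α : RF k l} {p : MP k l} (h : α * io k l (W k S) ^ 2 = io k l p) :
    ((∑ i ∈ S, ((zv i) ^ 2 * D i α + 4 * zv i * α)) = 0 ∧
    IsHomogeneousOn S (-(2 * (S.card : ℤ))) α ∧
    ∀ J ⊆ S, ∀ n : ℤ, (n < 0 ∨ n = 1) → component J (fun _ => 2) n α = 0) ↔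
    EE k S p = (C (4 * ((S.card : k) - 2)) * sg k S) * p ∧
    Polynomial.X ^ (4 * S.card) * sc k S p = Polynomial.X ^ (2 * S.card ^ 2) * Polynomial.C p ∧
    ∀ J ⊆ S, (∀ N < 2 * J.card ^ 2, nc J N p = 0) ∧ e0 k (S \ J) * nc J (2 * J.card ^ 2 + 1) p +
      4 * sg k J * e1 k (S \ J) * nc J (2 * J.card ^ 2) p = 0 := by
  rw [reg_iff hD h, homog_iff h, hom_two]
  have h1 : (((2 : ℕ) : k) * (2 * ((S.card : k) - 1)) - 4) = 4 * ((S.card : k) - 2) := by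
    push_cast; ring
  rw [h1]
  refine and_congr Iff.rfl (and_congr Iff.rfl ?_)
  exact forall_congr' fun J => forall_congr' fun hJ => comp_iff hJ h

lemma adm_of {D : Fin l → Derivation k (RF k l) (RF k l)} (hD : IsPartialDeriv D)
    {S : Finset (Fin l)} {p : MP k l} (hp : PAdm S p) :
    Admissible D S (io k l p / io k l (W k S) ^ 2) := by
  have hw := pow_ne_zero 2 (io_ne (W_ne_zero (k := k) S))
  have h1 := dep_of hp.1
  have h2 := dep_of (pr_W (k := k) S)
  refine ⟨Phi_of S p, div_mem h1 (pow_mem h2 2), (adm_iff hD (div_mul_cancel₀ _ hw)).2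
    ⟨hp.2.ee, hp.2.hom, fun J hJ => ⟨hp.2.lo J hJ, hp.2.rel J hJ⟩⟩⟩

end H16

section H17

open MvPolynomial (X C mkDerivation)

variable {k : Type} [Field k] {l : ℕ}

lemma Phi_good {α : RF k l} (h : α ∈ Phi k l) :
    ∃ (M : ℕ) (p : MP k l), α * io k l (W k Finset.univ) ^ M = io k l p := by
  set G : RF k l → Prop := fun x => ∃ (M : ℕ) (p : MP k l),
    x * io k l (W k Finset.univ) ^ M = io k l p with hG
  have hmul : ∀ x y, G x → G y → G (x * y) := by
    rintro x y ⟨M, p, hp⟩ ⟨M', p', hp'⟩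
    refine ⟨M + M', p * p', ?_⟩
    rw [map_mul, ← hp, ← hp', pow_add]; ring
  have hio : ∀ p, G (io k l p) := fun p => ⟨0, p, by simp⟩
  have hone : G 1 := by simpa using hio 1
  obtain ⟨p, e, rfl⟩ := h
  refine hmul _ _ (hio p) (Finset.prod_induction _ G hmul hone fun i _ =>
    Finset.prod_induction _ G hmul hone fun j _ => ?_)
  split_ifs with hij
  · obtain ⟨r, hr, -⟩ := dd_sq_dvd_W (k := k) (Finset.mem_univ i) (Finset.mem_univ j) hij.ne
    rw [← io_dd]
    obtain ⟨n, hn | hn⟩ := Int.eq_nat_or_neg (e i j)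
    · rw [hn, zpow_natCast, ← map_pow]; exact hio _
    · refine ⟨n, (dd k i j * r) ^ n, ?_⟩
      have hne : io k l (dd k i j) ≠ 0 := io_ne (dd_ne_zero hij.ne)
      rw [hn, hr, zpow_neg, zpow_natCast, ← inv_pow, ← mul_pow, map_pow]
      congr 1
      rw [map_mul, map_mul, map_pow]
      field_simp
  · exact hone

/-- Euler operator -/
def HH (k : Type) [Field k] (l : ℕ) : Derivation k (MP k l) (MP k l) := mkDerivation k (fun a => X a)

lemma HH_X (a : Fin l) : HH k l (X a) = X a := by simp [HH, MvPolynomial.mkDerivation_X]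

lemma eval_sc (J : Finset (Fin l)) (p : MP k l) : (sc k J p).eval 1 = p := by
  have h : (Polynomial.evalRingHom (1 : MP k l)).comp (sc k J) = RingHom.id _ := by
    apply MvPolynomial.ringHom_ext
    · intro r; simp [sc, scaleAux]
    · intro i; by_cases hi : i ∈ J <;> simp [sc, scaleAux, hi]
  exact DFunLike.congr_fun h p

lemma HH_eq (p : MP k l) : HH k l p = (Polynomial.derivative (sc k Finset.univ p)).eval 1 := by
  induction p using MvPolynomial.induction_on with
  | C c => rw [der_C, sc_C]; simp
  | add p q h1 h2 => simp only [map_add, Polynomial.eval_add, h1, h2]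
  | mul_X p a h1 =>
    rw [Derivation.leibniz, h1, HH_X, map_mul, sc_X_mem (Finset.mem_univ a)]
    simp [eval_sc]
    ring

lemma euler {p : MP k l} {a e : ℕ} (h : Polynomial.X ^ a * sc k Finset.univ p =
    Polynomial.X ^ e * Polynomial.C p) : HH k l p = C ((e : k) - a) * p := by
  have := congrArg (fun P => (Polynomial.derivative P).eval 1) h
  simp only [Polynomial.derivative_mul, Polynomial.derivative_X_pow, Polynomial.eval_add,
    Polynomial.eval_mul, Polynomial.derivative_C, ← HH_eq, eval_sc] at this
  simp at this
  simp only [map_sub, map_natCast]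
  linear_combination this

lemma comm_TE (q : MP k l) : TT k Finset.univ (EE k Finset.univ q) =
    EE k Finset.univ (TT k Finset.univ q) + 2 * HH k l q := by
  have := der_eq ⁅TT k (Finset.univ : Finset (Fin l)), EE k Finset.univ⁆ ((2 : MP k l) • HH k l)
    (fun a => by
      rw [Derivation.commutator_apply, TT_X, EE_X, if_pos (Finset.mem_univ a),
        if_pos (Finset.mem_univ a), Derivation.smul_apply, HH_X, pow_two, Derivation.leibniz, TT_X,
        if_pos (Finset.mem_univ a)]
      simp; ring) q
  rw [Derivation.commutator_apply, Derivation.smul_apply, smul_eq_mul] at this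
  linear_combination this

lemma comm_TH (q : MP k l) : TT k Finset.univ (HH k l q) =
    HH k l (TT k Finset.univ q) + TT k Finset.univ q := by
  have := der_eq ⁅TT k (Finset.univ : Finset (Fin l)), HH k l⁆ (TT k Finset.univ)
    (fun a => by
      rw [Derivation.commutator_apply, HH_X, TT_X, if_pos (Finset.mem_univ a)]
      simp) q
  rw [Derivation.commutator_apply] at this
  linear_combination this

lemma T_iter_X (a : Fin l) (q : MP k l) (m : ℕ) :
    (TT k (Finset.univ : Finset (Fin l)))^[m + 1] (q * X a) =
      X a * (TT k Finset.univ)^[m + 1] q + ((m : MP k l) + 1) * (TT k Finset.univ)^[m] q := by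
  induction m with
  | zero => simp [Derivation.leibniz, TT_X]; ring
  | succ m ih =>
    rw [Function.iterate_succ_apply', ih, map_add, Derivation.leibniz, Derivation.leibniz,
      TT_X, if_pos (Finset.mem_univ a), ← Function.iterate_succ_apply' (TT k Finset.univ) (m + 1),
      ← Function.iterate_succ_apply' (TT k Finset.univ) m]
    have : TT k (Finset.univ : Finset (Fin l)) ((m : MP k l) + 1) = 0 := by
      rw [map_add, Derivation.map_natCast, Derivation.map_one_eq_zero, add_zero]
    rw [this]
    simp only [smul_eq_mul]
    push_cast; ring

lemma iter_zero (m : ℕ) : (TT k (Finset.univ : Finset (Fin l)))^[m] 0 = 0 :=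
  Function.iterate_fixed (map_zero _) m

lemma iter_add (m : ℕ) (p q : MP k l) : (TT k (Finset.univ : Finset (Fin l)))^[m] (p + q) =
    (TT k Finset.univ)^[m] p + (TT k Finset.univ)^[m] q := by
  induction m generalizing p q with
  | zero => rfl
  | succ m ih => simp only [Function.iterate_succ_apply, map_add, ih]

lemma T_nil (p : MP k l) : ∃ m, ∀ n ≥ m, (TT k (Finset.univ : Finset (Fin l)))^[n] p = 0 := by
  induction p using MvPolynomial.induction_on with
  | C c =>
    refine ⟨1, fun n hn => ?_⟩
    obtain ⟨n, rfl⟩ := Nat.exists_eq_add_of_le' hn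
    rw [Function.iterate_succ_apply, der_C, iter_zero]
  | add p q h1 h2 =>
    obtain ⟨m, hm⟩ := h1
    obtain ⟨m', hm'⟩ := h2
    refine ⟨m + m', fun n hn => ?_⟩
    rw [iter_add, hm n (by omega), hm' n (by omega), add_zero]
  | mul_X p a h1 =>
    obtain ⟨m, hm⟩ := h1
    refine ⟨m + 1, fun n hn => ?_⟩
    obtain ⟨n, rfl⟩ := Nat.exists_eq_add_of_le' (show 1 ≤ n by omega)
    rw [T_iter_X, hm _ (by omega), hm _ (by omega)]; ring

lemma sl2 [CharZero k] {p : MP k l} {c N : k} (hE : EE k Finset.univ p = (C c * sg k Finset.univ) * p)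
    (hH : HH k l p = C N * p) (hc : c * l = 2 * N) : TT k Finset.univ p = 0 := by
  set T := TT k (Finset.univ : Finset (Fin l)) with hT
  have hH' : ∀ r : ℕ, HH k l (T^[r] p) = C (N - r) * T^[r] p := by
    intro r
    induction r with
    | zero => simpa using hH
    | succ r ih =>
      have := comm_TH (T^[r] p)
      rw [ih, der_Cmul] at this
      rw [Function.iterate_succ_apply']
      push_cast
      simp only [map_sub, map_add, map_one] at this ⊢
      linear_combination -this
  have hsg : T (sg k Finset.univ) = (l : MP k l) := by
    simp [sg, hT, map_sum, TT_X]
  have hcC : C c * (l : MP k l) = 2 * C N := by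
    have := congrArg (C (σ := Fin l)) hc
    simpa only [map_mul, map_natCast, map_ofNat] using this
  have hE' : ∀ r : ℕ, EE k Finset.univ (T^[r + 1] p) = (C c * sg k Finset.univ) * T^[r + 1] p +
      ((r : MP k l) * ((r : MP k l) + 1)) * T^[r] p := by
    intro r
    induction r with
    | zero =>
      have := comm_TE p
      rw [hE, mul_assoc, der_Cmul, Derivation.leibniz, ← hT, hsg, hH, smul_eq_mul, smul_eq_mul] at this
      simp only [zero_add, Function.iterate_one, Function.iterate_zero, id, Nat.cast_zero, zero_mul,
        add_zero]
      linear_combination -this + p * hcC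
    | succ r ih =>
      have := comm_TE (T^[r + 1] p)
      have hh : T ((r : MP k l) * ((r : MP k l) + 1)) = 0 := by
        have : ((r : MP k l) * ((r : MP k l) + 1)) = ((r * (r + 1) : ℕ) : MP k l) := by push_cast; rfl
        rw [this, Derivation.map_natCast]
      rw [ih, map_add, mul_assoc, der_Cmul, Derivation.leibniz, Derivation.leibniz, ← hT, hsg, hH',
        hh, smul_eq_mul, smul_eq_mul, smul_eq_mul, ← Function.iterate_succ_apply' T r,
        ← Function.iterate_succ_apply' T (r + 1)] at this
      simp only [map_sub, map_natCast] at this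
      push_cast at this ⊢
      linear_combination -this + (T^[r + 1] p) * hcC
  obtain ⟨m, hm⟩ := T_nil p
  have hdown : ∀ r : ℕ, T^[r + 1 + 1] p = 0 → T^[r + 1] p = 0 := by
    intro r h0
    have := hE' (r + 1)
    rw [h0, map_zero, mul_zero, zero_add] at this
    rcases mul_eq_zero.1 this.symm with h | h
    · exfalso
      have : (((r + 1) * (r + 1 + 1) : ℕ) : MP k l) = 0 := by push_cast at h ⊢; exact h
      exact absurd (Nat.cast_eq_zero.1 this) (by positivity)
    · exact h
  have : ∀ s r : ℕ, s + r = m → T^[r + 1] p = 0 := by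
    intro s
    induction s with
    | zero => intro r hr; exact hm _ (by omega)
    | succ s ih => intro r hr; exact hdown r (ih (r + 1) (by omega))
  exact this m 0 (by omega)

lemma padm_of [CharZero k] {D : Fin l → Derivation k (RF k l) (RF k l)} (hD : IsPartialDeriv D)
    {α : RF k l} (hα : Admissible D Finset.univ α) :
    ∃ p : MP k l, PAdm Finset.univ p ∧ α * io k l (W k Finset.univ) ^ 2 = io k l p := by
  obtain ⟨hP, -, hreg, hhom, hcomp⟩ := hα
  obtain ⟨m, p, hp⟩ : ∃ (m : ℕ) (p : MP k l), α * io k l (W k Finset.univ) ^ (m + 2) = io k l p := by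
    obtain ⟨M, p, hp⟩ := Phi_good hP
    exact ⟨M, p * W k Finset.univ ^ 2, by rw [pow_add, ← mul_assoc, hp, map_mul, map_pow]⟩
  have hE := (reg_iff hD hp).1 hreg
  have hH := euler ((homog_iff hp).1 hhom)
  have hle : l ≤ l * l := Nat.le_mul_self _
  have hT : TT k Finset.univ p = 0 := by
    refine sl2 hE hH ?_
    rw [Finset.card_univ, Fintype.card_fin]
    push_cast [Nat.cast_sub hle]
    ring
  have hdvd : W k Finset.univ ^ m ∣ p := by
    refine W_dvd m fun s hs t ht hst => dd_pow_dvd hT hs ht hst ?_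
    have hc2 : ({s, t} : Finset (Fin l)).card = 2 := Finset.card_pair hst
    obtain ⟨R, hR, hW⟩ := sc_W (k := k) (Finset.subset_univ {s, t})
    rw [hc2] at hW
    have hR0 : (R ^ (m + 2)).coeff 0 ≠ 0 := fun h0 =>
      hR (PX_prime.dvd_of_dvd_pow (Polynomial.X_dvd_iff.2 h0))
    have hf : scaleJ {s, t} α * toRatFuncHom k l (Polynomial.X ^ (2 * (m + 2)) * R ^ (m + 2)) =
        toRatFuncHom k l (sc k {s, t} p) := by
      have h1 := congrArg (scaleJ {s, t}) hp
      rw [map_mul, map_pow, scaleJ_io, scaleJ_io, hW, ← map_pow, mul_pow, ← pow_mul] at h1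
      exact h1
    rw [Polynomial.X_pow_dvd_iff]
    refine (lau hR0 hf (N := 2 * m) (m := -4) (by push_cast; ring)).1.1 fun n hn => ?_
    have := hcomp {s, t} (Finset.subset_univ _) (n + 4) (Or.inl (by omega))
    simpa [component, hc2] using this
  obtain ⟨q, rfl⟩ := hdvd
  have hw : io k l (W k Finset.univ ^ m) ≠ 0 := io_ne (pow_ne_zero _ (W_ne_zero _))
  have hq : α * io k l (W k Finset.univ) ^ 2 = io k l q := by
    apply mul_left_cancel₀ hw
    rw [← map_mul, ← hp, map_pow, pow_add]; ring
  obtain ⟨h1, h2, h3⟩ := (adm_iff hD hq).1 ⟨hreg, hhom, hcomp⟩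
  refine ⟨q, ⟨nc_self_zero.hom_eq_of_pr_univ q, ?_, h1, h2, fun J hJ => (h3 J hJ).1, fun J hJ => (h3 J hJ).2⟩, hq⟩
  have hTW : TT k Finset.univ (W k (Finset.univ : Finset (Fin l)) ^ m) = 0 := by
    rw [Derivation.leibniz_pow, TT_W]; simp
  rw [Derivation.leibniz, hTW, smul_zero, add_zero, smul_eq_mul] at hT
  exact (mul_eq_zero.1 hT).resolve_left (pow_ne_zero _ (W_ne_zero _))

end H17

section H18

open MvPolynomial (X C mkDerivation)

variable {k : Type} [Field k] {l : ℕ}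

lemma W_insert_sq {S : Finset (Fin l)} {a : Fin l} (ha : a ∉ S) :
    W k (insert a S) ^ 2 = W k S ^ 2 * ∏ b ∈ S, dd k b a ^ 4 := by
  have h : ((∏ b ∈ S, dd k a b) * ∏ b ∈ S, dd k b a) ^ 2 = ∏ b ∈ S, dd k b a ^ 4 := by
    rw [← Finset.prod_mul_distrib, ← Finset.prod_pow]
    refine Finset.prod_congr rfl fun b _ => ?_
    rw [dd_swap b a]; ring
  rw [W_insert ha, mul_assoc, mul_pow, h]

lemma W_split {i j : Fin l} (hij : j ≠ i) : W k Finset.univ ^ 2 =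
    W k ({i, j} : Finset (Fin l))ᶜ ^ 2 * dd k i j ^ 4 * Cr k ({i, j} : Finset (Fin l))ᶜ {i, j} := by
  set I := ({i, j} : Finset (Fin l))ᶜ with hI
  have hj : j ∉ I := by simp [hI]
  have hi : i ∉ insert j I := by simp [hI, hij.symm]
  have hu : (Finset.univ : Finset (Fin l)) = insert i (insert j I) := by
    ext a
    simp only [hI, Finset.mem_univ, Finset.mem_insert, Finset.mem_compl, Finset.mem_singleton]
    tauto
  have hCr : Cr k I {i, j} = (∏ b ∈ I, dd k b i ^ 4) * ∏ b ∈ I, dd k b j ^ 4 := by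
    rw [Cr, ← Finset.prod_mul_distrib]
    exact Finset.prod_congr rfl fun b _ => Finset.prod_pair hij.symm
  rw [hu, W_insert_sq hi, W_insert_sq hj, Finset.prod_insert hj, hCr, dd_swap i j]
  ring

lemma final [CharZero k] {D : Fin l → Derivation k (RF k l) (RF k l)} (hD : IsPartialDeriv D)
    {i : Fin l} {α : RF k l} {p x : MP k l}
    (hp : α * io k l (W k Finset.univ) ^ 2 = io k l p) (hx : x ∈ GF i p) {f : RF k l}
    (hf : f = io k l x / io k l (W k Finset.univ) ^ 2) :
    Admissible D Finset.univ f ∧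
      ((∃ j, j ≠ i ∧ ∃ β, Admissible D ({i, j} : Finset (Fin l))ᶜ β ∧
          f = (zv i - zv j) ^ (-4 : ℤ) * β) ∨
        ((∀ j, j ≠ i → ∀ m' < (-2 : ℤ), rho i j m' f = 0) ∧
          (Finset.univ.filter (fun j => j ≠ i ∧ rho i j (-2) f ≠ 0)).card ≤ 2)) ∧
      ∀ s t, s < t →
        ((∀ m' < (-1 : ℤ), rho s t m' α = 0) → (∀ m' < (-1 : ℤ), rho s t m' f = 0)) ∧
        (((∀ m' < (-2 : ℤ), rho s t m' α = 0) ∧ rho s t (-2) α ≠ 0) →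
          ∀ m' < (-2 : ℤ), rho s t m' f = 0) := by
  have hw := pow_ne_zero 2 (io_ne (W_ne_zero (k := k) (Finset.univ : Finset (Fin l))))
  have hfx : f * io k l (W k Finset.univ) ^ 2 = io k l x := by rw [hf, div_mul_cancel₀ _ hw]
  obtain ⟨h1, h2, h3⟩ := hx
  refine ⟨hf ▸ adm_of hD h1, ?_, fun s t hst => ⟨fun h => ?_, fun h => ?_⟩⟩
  · rcases h2 with ⟨j, hj, b, hb, rfl⟩ | ⟨h4, a, b, h5⟩
    · refine Or.inl ⟨j, hj, _, adm_of hD hb, ?_⟩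
      have e1 : io k l (W k ({i, j} : Finset (Fin l))ᶜ) ≠ 0 := io_ne (W_ne_zero _)
      have e2 : io k l (dd k i j) ≠ 0 := io_ne (dd_ne_zero hj.symm)
      have hs := congrArg (io k l) (W_split (k := k) hj)
      rw [map_pow, map_mul, map_mul, map_pow, map_pow] at hs
      rw [hs] at hw
      have e3 : io k l (Cr k ({i, j} : Finset (Fin l))ᶜ {i, j}) ≠ 0 := right_ne_zero_of_mul hw
      rw [hf, hs, ← io_dd, map_mul, zpow_neg, show (4 : ℤ) = ((4 : ℕ) : ℤ) from rfl, zpow_natCast]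
      field_simp
    · refine Or.inr ⟨fun j hj => (rho_iff hj.symm hfx 2 (by norm_num)).2 (h4 j hj), ?_⟩
      refine (Finset.card_le_card (t := {a, b}) fun j hj => ?_).trans Finset.card_le_two
      obtain ⟨hji, hj2⟩ := (Finset.mem_filter.1 hj).2
      by_contra hab
      simp only [Finset.mem_insert, Finset.mem_singleton, not_or] at hab
      exact hj2 ((rho_iff hji.symm hfx 3 (m := -1) (by norm_num)).2 (h5 j hji hab.1 hab.2) _
        (by norm_num))
  · exact (rho_iff hst.ne hfx 3 (by norm_num)).2 (h3 s t hst.ne 3 (Or.inr rfl)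
      ((rho_iff hst.ne hp 3 (by norm_num)).1 h))
  · exact (rho_iff hst.ne hfx 2 (by norm_num)).2 (h3 s t hst.ne 2 (Or.inl rfl)
      ((rho_iff hst.ne hp 2 (by norm_num)).1 h.1))

end H18

/-- every admissible `α ∈ R^l` can be written, for any fixed `i`, as a
finite sum `α = Σ_m α_m` of admissible functions `α_m ∈ R^l` such that:
(i) either `α_m = (z_i-z_j)^{-4}·β` for some `j ≠ i` and some `β ∈ R^{l-2}` in the
variables other than `z_i, z_j`, or `ord_{ij'}α_m ≥ -2` for all `j' ≠ i` and at most
two indices `j' ≠ i` have `ord_{ij'}α_m = -2`;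
(ii) for `s < t`: if `ord_{st}α ≥ -1` then `ord_{st}α_m ≥ -1`, and if
`ord_{st}α = -2` then `ord_{st}α_m ≥ -2`. -/
theorem statement12 {k : Type} [Field k] [CharZero k] {l : ℕ}
    (D : Fin l → Derivation k (RF k l) (RF k l)) (hD : IsPartialDeriv D)
    (α : RF k l) (hadm : Admissible D Finset.univ α) (i : Fin l) :
    ∃ (N : ℕ) (f : Fin N → RF k l),
      α = ∑ m, f m ∧
      ∀ m : Fin N,
        Admissible D Finset.univ (f m) ∧
        ((∃ j : Fin l, j ≠ i ∧ ∃ β : RF k l,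
            Admissible D ({i, j}ᶜ : Finset (Fin l)) β ∧
            f m = (zv i - zv j) ^ (-4 : ℤ) * β) ∨
         ((∀ j : Fin l, j ≠ i → ∀ m' : ℤ, m' < -2 → rho i j m' (f m) = 0) ∧
          (Finset.univ.filter (fun j : Fin l => j ≠ i ∧ rho i j (-2) (f m) ≠ 0)).card ≤ 2)) ∧
        (∀ s t : Fin l, s < t →
          ((∀ m' : ℤ, m' < -1 → rho s t m' α = 0) →
            (∀ m' : ℤ, m' < -1 → rho s t m' (f m) = 0)) ∧
          (((∀ m' : ℤ, m' < -2 → rho s t m' α = 0) ∧ rho s t (-2) α ≠ 0) →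
            (∀ m' : ℤ, m' < -2 → rho s t m' (f m) = 0))) := by
  obtain ⟨p, hp, hpα⟩ := padm_of hD hadm
  obtain ⟨L, hL, hsum⟩ := AddSubmonoid.exists_list_of_mem_closure (thmC i hp)
  have hw := pow_ne_zero 2 (io_ne (W_ne_zero (k := k) (Finset.univ : Finset (Fin l))))
  refine ⟨L.length, fun m => io k l (L.get m) / io k l (W k Finset.univ) ^ 2, ?_, fun m => ?_⟩
  · rw [← Finset.sum_div, ← map_sum, eq_div_iff hw, hpα, ← hsum, ← Fin.sum_univ_getElem]; rfl
  · exact final hD hpα (hL _ (L.get_mem m)) rfl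

end Griess
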